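/- arXiv:math/0411245 — 5 statements merged into one kernel-verified Lean document; each statement's English description precedes it below -/
import Mathlib

section
/- Let f : ℂ² → ℂ² be an open polynomial map (with respect to the Euclidean topology). Then the coimage ℂ² − f(ℂ²) is a finite set. -/
open MvPolynomial Topology

namespace CoimageAux

abbrev R2 := MvPolynomial (Fin 2) ℂ

/-- maximal ideal of a point -/
noncomputable abbrev mI (z : Fin 2 → ℂ) : Ideal R2 := vanishingIdeal ℂ {z}

lemma mem_mI (z : Fin 2 → ℂ) (p : R2) : p ∈ mI z ↔ eval z p = 0 := by
  rw [mem_vanishingIdeal_singleton_iff]; rfl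

lemma mI_inj : Function.Injective mI := by
  intro z w h
  funext i
  have h1 : (X i - C (z i) : R2) ∈ mI z := by rw [mem_mI]; simp
  rw [h, mem_mI] at h1
  simp only [map_sub, eval_X, eval_C] at h1
  exact (sub_eq_zero.mp h1).symm

lemma exists_prime (I : Ideal R2) (S : Set (Fin 2 → ℂ))
    (h : {z | I ≤ mI z ∧ z ∈ S}.Infinite) :
    ∃ p : Ideal R2, p.IsPrime ∧ I ≤ p ∧ ¬ p.IsMaximal ∧ ∃ z ∈ S, p ≤ mI z := by
  by_contra hc
  push Not at hc
  apply h
  have hfin := Ideal.finite_minimalPrimes_of_isNoetherianRing R2 I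
  refine (hfin.preimage mI_inj.injOn).subset ?_
  rintro z ⟨hz, hzS⟩
  obtain ⟨p, hp, hpz⟩ := Ideal.exists_minimalPrimes_le hz
  have hmax : p.IsMaximal := by
    by_contra hm
    exact hc p hp.1.1 hp.1.2 hm z hzS hpz
  have : p = mI z := hmax.eq_of_le (Ideal.IsPrime.ne_top inferInstance) hpz
  change mI z ∈ I.minimalPrimes
  rwa [← this]

lemma dim_two (p : Ideal R2) [hp : p.IsPrime] (hm : ¬ p.IsMaximal) (g : R2) (hg : Prime g)
    (hgp : g ∈ p) : p = Ideal.span {g} := by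
  by_contra hne
  have hle : Ideal.span {g} ≤ p := by simpa [Ideal.span_le] using hgp
  have hlt : Ideal.span {g} < p := lt_of_le_of_ne hle (Ne.symm hne)
  have hgpr : (Ideal.span {g}).IsPrime := (Ideal.span_singleton_prime hg.ne_zero).2 hg
  obtain ⟨m, hmm, hpm⟩ := Ideal.exists_le_maximal p hp.ne_top
  have hpm' : p < m := lt_of_le_of_ne hpm (by rintro rfl; exact hm hmm)
  let a0 : PrimeSpectrum R2 := ⟨⊥, Ideal.isPrime_bot⟩
  let a1 : PrimeSpectrum R2 := ⟨_, hgpr⟩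
  let a2 : PrimeSpectrum R2 := ⟨p, hp⟩
  let a3 : PrimeSpectrum R2 := ⟨m, hmm.isPrime⟩
  have h01 : a0 < a1 := by
    change (⊥ : Ideal R2) < Ideal.span {g}
    rw [bot_lt_iff_ne_bot, Ne, Ideal.span_singleton_eq_bot]
    exact hg.ne_zero
  have h12 : a1 < a2 := hlt
  have h23 : a2 < a3 := hpm'
  have e1 := Order.height_add_one_le h01
  have e2 := Order.height_add_one_le h12
  have e3 := Order.height_add_one_le h23
  have e4 := Order.height_le_krullDim a3
  have e5 : ringKrullDim R2 = 2 := by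
    rw [MvPolynomial.ringKrullDim_of_isNoetherianRing]; simp
  rw [ringKrullDim] at e5
  rw [e5] at e4
  have e4' : Order.height a3 ≤ 2 := WithBot.coe_le_coe.1 e4
  have : (3 : ℕ∞) ≤ Order.height a3 := by
    calc (3 : ℕ∞) = 0 + 1 + 1 + 1 := by norm_num
      _ ≤ Order.height a0 + 1 + 1 + 1 := by gcongr; exact zero_le
      _ ≤ Order.height a1 + 1 + 1 := by gcongr
      _ ≤ Order.height a2 + 1 := by gcongr
      _ ≤ _ := e3
  have := this.trans e4'
  revert this
  decide

lemma eq_zero_of_open (p : R2) (U : Set (Fin 2 → ℂ)) (hU : IsOpen U) (hne : U.Nonempty)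
    (h : ∀ z ∈ U, eval z p = 0) : p = 0 := by
  obtain ⟨z, hz⟩ := hne
  obtain ⟨ε, hε, hb⟩ := Metric.isOpen_iff.1 hU z hz
  refine funext_set (fun i => Metric.ball (z i) ε) (fun i => ?_) fun x hx => ?_
  · exact infinite_of_mem_nhds (z i) (Metric.ball_mem_nhds _ hε)
  · rw [map_zero]
    apply h x (hb _)
    rw [ball_pi _ hε]
    exact hx

lemma diff_eval (g : R2) (x : ℂ) : Differentiable ℂ fun y : ℂ => eval ![x, y] g := by
  induction g using MvPolynomial.induction_on with
  | C a => simp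
  | add p q hp hq =>
    simp only [map_add]
    exact hp.add hq
  | mul_X p n hp =>
    simp only [map_mul, eval_X]
    refine hp.mul ?_
    fin_cases n
    · exact differentiable_const x
    · exact differentiable_id

lemma not_isolated (g : R2) (z : Fin 2 → ℂ) (hz : eval z g = 0) (ρ : ℝ) (hρ : 0 < ρ) :
    ∃ w ∈ Metric.ball z ρ, w ≠ z ∧ eval w g = 0 := by
  by_contra hc
  push Not at hc
  have hcont : Continuous fun xy : ℂ × ℂ => eval ![xy.1, xy.2] g := by
    refine (MvPolynomial.continuous_eval g).comp ?_
    refine continuous_pi fun i => ?_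
    fin_cases i
    · exact continuous_fst
    · exact continuous_snd
  have hdiff : ∀ x : ℂ, Differentiable ℂ fun y : ℂ => eval ![x, y] g := by
    exact fun x => diff_eval g x
  have hzz : ![z 0, z 1] = z := by ext i; fin_cases i <;> rfl
  have hmem : ∀ x y : ℂ, dist x (z 0) < ρ → dist y (z 1) < ρ → ![x, y] ∈ Metric.ball z ρ := by
    intro x y hx hy
    rw [Metric.mem_ball, dist_pi_lt_iff hρ]
    intro i
    fin_cases i
    · exact hx
    · exact hy
  set r := ρ / 2 with hr
  have hr0 : 0 < r := by positivity
  have hrρ : r < ρ := by linarith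
  have hpos : ∀ y ∈ Metric.sphere (z 1) r, 0 < ‖eval ![z 0, y] g‖ := by
    intro y hy
    rw [norm_pos_iff]
    rw [Metric.mem_sphere] at hy
    apply hc _ (hmem _ _ (by simpa using hρ) (by linarith))
    intro h
    have : y = z 1 := congrFun h 1
    rw [this, dist_self] at hy
    linarith
  obtain ⟨m, hm0, hm⟩ : ∃ m > 0, ∀ y ∈ Metric.sphere (z 1) r, m ≤ ‖eval ![z 0, y] g‖ := by
    have hne : (Metric.sphere (z 1) r).Nonempty := NormedSpace.sphere_nonempty.2 hr0.le
    obtain ⟨y0, hy0, hmin⟩ := (isCompact_sphere (z 1) r).exists_isMinOn hne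
      (f := fun y => ‖eval ![z 0, y] g‖)
      ((hcont.comp (Continuous.prodMk_right (z 0))).norm.continuousOn)
    exact ⟨_, hpos y0 hy0, fun y hy => hmin hy⟩
  have hev1 : ∀ᶠ x in 𝓝 (z 0), ∀ y ∈ Metric.sphere (z 1) r, m / 2 < ‖eval ![x, y] g‖ := by
    refine (isCompact_sphere (z 1) r).eventually_forall_of_forall_eventually fun y hy => ?_
    refine hcont.norm.continuousAt.eventually (lt_mem_nhds ?_)
    have := hm y hy
    change m / 2 < ‖eval ![z 0, y] g‖
    linarith
  have hev2 : ∀ᶠ x in 𝓝 (z 0), ‖eval ![x, z 1] g‖ < m / 2 := by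
    have hc2 : Continuous fun x : ℂ => ‖eval ![x, z 1] g‖ :=
      (hcont.comp (Continuous.prodMk_left (z 1))).norm
    refine hc2.continuousAt.eventually (gt_mem_nhds ?_)
    simp only [hzz, hz, norm_zero]
    linarith
  have hev3 : ∀ᶠ x in 𝓝 (z 0), dist x (z 0) < ρ := Metric.ball_mem_nhds _ hρ
  obtain ⟨x, ⟨h1, h2, h3⟩, hxne⟩ :=
    (((hev1.and (hev2.and hev3)).filter_mono nhdsWithin_le_nhds).and
      (eventually_mem_nhdsWithin (a := z 0) (s := {z 0}ᶜ))).exists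
  have hnz : ∀ y ∈ Metric.closedBall (z 1) r, eval ![x, y] g ≠ 0 := by
    intro y hy
    rw [Metric.mem_closedBall] at hy
    apply hc _ (hmem _ _ h3 (by linarith))
    intro h
    exact hxne (congrFun h 0)
  have hd : DiffContOnCl ℂ (fun y => (eval ![x, y] g)⁻¹) (Metric.ball (z 1) r) := by
    refine DiffContOnCl.inv (hdiff x).diffContOnCl ?_
    intro y hy
    rw [closure_ball _ hr0.ne'] at hy
    exact hnz y hy
  have := Complex.norm_le_of_forall_mem_frontier_norm_le (C := (m / 2)⁻¹) Metric.isBounded_ball hd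
    (fun y hy => by
      rw [frontier_ball _ hr0.ne'] at hy
      rw [norm_inv]
      exact inv_anti₀ (by positivity) (h1 y hy).le)
    (subset_closure (Metric.mem_ball_self hr0))
  rw [norm_inv, inv_le_inv₀ (norm_pos_iff.2 (hnz _ (Metric.mem_closedBall_self hr0.le)))
    (by positivity)] at this
  linarith

lemma dense_curve (g f : R2) (hg : Prime g) (hf : f ∉ Ideal.span {g}) (z : Fin 2 → ℂ)
    (hz : eval z g = 0) : z ∈ closure {w | eval w g = 0 ∧ eval w f ≠ 0} := by
  have hfin : {w | eval w g = 0 ∧ eval w f = 0}.Finite := by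
    by_contra hinf
    obtain ⟨p, hp, hIp, hpm, -⟩ := exists_prime (Ideal.span {g, f}) Set.univ (by
      convert hinf using 2
      simp only [Ideal.span_le, Set.insert_subset_iff, Set.singleton_subset_iff, SetLike.mem_coe,
        mem_mI, Set.mem_univ, and_true])
    have h := dim_two p hpm g hg (hIp (Ideal.subset_span (by simp)))
    exact hf (h ▸ hIp (Ideal.subset_span (by simp)))
  rw [Metric.mem_closure_iff]
  intro ε hε
  by_contra hc
  push Not at hc
  have hopen : IsOpen ({w | eval w g = 0 ∧ eval w f = 0} \ {z})ᶜ :=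
    (hfin.subset Set.sdiff_subset).isClosed.isOpen_compl
  obtain ⟨δ, hδ, hb⟩ := Metric.isOpen_iff.1 hopen z (by simp)
  obtain ⟨w, hw, hwz, hwg⟩ := not_isolated g z hz (min ε δ) (lt_min hε hδ)
  rw [Metric.mem_ball, lt_min_iff] at hw
  have hwf : eval w f = 0 := by
    by_contra hwf
    have := hc w ⟨hwg, hwf⟩
    rw [dist_comm] at this
    linarith [hw.1]
  exact hb hw.2 ⟨⟨hwg, hwf⟩, hwz⟩

lemma exists_data (q : Fin 2 → R2) :
    ∃ T : Finset (PrimeSpectrum.BasicConstructibleSetData R2), ∀ z : Fin 2 → ℂ,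
      (¬ ∃ x : Fin 2 → ℂ, ∀ i, z i = eval x (q i)) ↔
        ∃ c ∈ T, (∀ j, eval z (c.g j) = 0) ∧ eval z c.f ≠ 0 := by
  let φ : R2 →ₐ[ℂ] R2 := aeval q
  have hev : ∀ (x : Fin 2 → ℂ) (p : R2), eval x (φ p) = eval (fun i => eval x (q i)) p := by
    intro x p
    have : (aeval x : R2 →ₐ[ℂ] ℂ).comp φ = aeval (fun i => eval x (q i)) := by
      ext i; simp [φ, MvPolynomial.aeval_eq_eval]
    exact DFunLike.congr_fun this p
  have hfp : φ.toRingHom.FinitePresentation := by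
    refine RingHom.FinitePresentation.of_finiteType.1 ?_
    refine RingHom.FiniteType.of_comp_finiteType (f := (C : ℂ →+* R2)) ?_
    have : φ.toRingHom.comp (C : ℂ →+* R2) = C := by
      ext <;> simp [φ]
    rw [this]
    change (algebraMap ℂ R2).FiniteType
    rw [RingHom.finiteType_algebraMap]
    infer_instance
  obtain ⟨T, hT⟩ := PrimeSpectrum.exists_constructibleSetData_iff.2
    (PrimeSpectrum.isConstructible_range_comap hfp).compl
  refine ⟨T, fun z => ?_⟩
  have key : (∃ x : Fin 2 → ℂ, ∀ i, z i = eval x (q i)) ↔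
      (⟨mI z, inferInstance⟩ : PrimeSpectrum R2) ∈
        Set.range (PrimeSpectrum.comap φ.toRingHom) := by
    constructor
    · rintro ⟨x, hx⟩
      refine ⟨⟨mI x, inferInstance⟩, ?_⟩
      ext p
      change φ p ∈ mI x ↔ p ∈ mI z
      rw [mem_mI, mem_mI, hev, funext hx]
    · rintro ⟨P, hP⟩
      obtain ⟨M, hM, hPM⟩ := Ideal.exists_le_maximal P.asIdeal P.2.ne_top
      obtain ⟨x, rfl⟩ := isMaximal_iff_eq_vanishingIdeal_singleton.1 hM
      refine ⟨x, fun i => ?_⟩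
      have h1 : (X i - C (z i) : R2) ∈ mI z := by rw [mem_mI]; simp
      have h2 : (X i - C (z i) : R2) ∈ (PrimeSpectrum.comap φ.toRingHom P).asIdeal := by
        rw [hP]; exact h1
      have h3 : φ (X i - C (z i) : R2) ∈ mI x := hPM h2
      rw [mem_mI, hev] at h3
      simp only [map_sub, eval_X, eval_C] at h3
      exact (sub_eq_zero.mp h3).symm
  rw [key, ← Set.mem_compl_iff, ← hT]
  simp only [PrimeSpectrum.ConstructibleSetData.toSet, Set.mem_iUnion, exists_prop,
    PrimeSpectrum.BasicConstructibleSetData.toSet, Set.mem_sdiff, PrimeSpectrum.mem_zeroLocus,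
    Set.range_subset_iff, Set.singleton_subset_iff, SetLike.mem_coe, mem_mI, ne_eq]

end CoimageAux

open CoimageAux in
/-- The coimage `ℂ² − f(ℂ²)` of an open polynomial map `f : ℂ² → ℂ²`
is finite. -/
theorem coimage_finite_of_open_poly
    (F : (Fin 2 → ℂ) → (Fin 2 → ℂ))
    (hFpoly : ∃ q : Fin 2 → MvPolynomial (Fin 2) ℂ,
      ∀ x i, F x i = MvPolynomial.eval x (q i))
    (hopen : IsOpenMap F) :
    (Set.range F)ᶜ.Finite := by
  obtain ⟨q, hq⟩ := hFpoly
  obtain ⟨T, hT⟩ := exists_data q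
  have hrange : ∀ z, z ∈ (Set.range F)ᶜ ↔
      ∃ c ∈ T, (∀ j, eval z (c.g j) = 0) ∧ eval z c.f ≠ 0 := by
    intro z
    rw [← hT, Set.mem_compl_iff, Set.mem_range]
    refine not_congr (exists_congr fun x => ?_)
    rw [funext_iff]
    exact forall_congr' fun i => by rw [hq]; exact eq_comm
  have hev : ∀ (x : Fin 2 → ℂ) (p : R2), eval x (aeval q p) = eval (F x) p := by
    intro x p
    have : (aeval x : R2 →ₐ[ℂ] ℂ).comp (aeval q) = aeval (F x) := by
      ext i; simp [hq, MvPolynomial.aeval_eq_eval]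
    exact DFunLike.congr_fun this p
  have hopenR : IsOpen (Set.range F) := hopen.isOpen_range
  have hneR : (Set.range F).Nonempty := Set.range_nonempty F
  have hcl : IsClosed (Set.range F)ᶜ := hopenR.isClosed_compl
  have hU : (Set.range F)ᶜ = ⋃ c ∈ T, {z | (∀ j, eval z (c.g j) = 0) ∧ eval z c.f ≠ 0} := by
    ext z; rw [hrange]; simp only [Set.mem_iUnion, exists_prop, Set.mem_ofPred_eq]
  rw [hU]
  refine T.finite_toSet.biUnion fun c hcT => ?_
  by_contra hinf
  obtain ⟨p, hp, hIp, hpm, z0, hz0, hpz0⟩ := exists_prime (Ideal.span (Set.range c.g))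
    {z | eval z c.f ≠ 0} (by
      convert hinf using 2
      simp only [Ideal.span_le, Set.range_subset_iff, SetLike.mem_coe, mem_mI, Set.mem_ofPred_eq])
  have hfp : c.f ∉ p := fun h => hz0 ((mem_mI _ _).1 (hpz0 h))
  have hsub : ∀ z, p ≤ mI z → eval z c.f ≠ 0 → z ∈ (Set.range F)ᶜ := by
    intro z hz hzf
    rw [hrange]
    exact ⟨c, hcT, fun j => (mem_mI _ _).1 (hz (hIp (Ideal.subset_span ⟨j, rfl⟩))), hzf⟩
  by_cases hp0 : p = ⊥
  · subst hp0
    apply hfp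
    rw [Ideal.mem_bot]
    refine eq_zero_of_open _ _ hopenR hneR fun z hz => ?_
    by_contra h
    exact hsub z bot_le h hz
  · obtain ⟨g, hgp, hg⟩ := hp.exists_mem_prime_of_ne_bot hp0
    obtain rfl := dim_two p hpm g hg hgp
    have hz : ∀ z, eval z g = 0 → z ∈ (Set.range F)ᶜ := by
      intro z hz
      refine closure_minimal ?_ hcl (dense_curve g c.f hg hfp z hz)
      rintro w ⟨hwg, hwf⟩
      refine hsub w ?_ hwf
      rw [Ideal.span_le, Set.singleton_subset_iff]
      exact (mem_mI _ _).2 hwg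
    have hunit : IsUnit (aeval q g : R2) := by
      by_contra hnu
      obtain ⟨M, hM, hgM⟩ := exists_max_ideal_of_mem_nonunits hnu
      obtain ⟨x, rfl⟩ := isMaximal_iff_eq_vanishingIdeal_singleton.1 hM
      have h := (mem_mI _ _).1 hgM
      rw [hev] at h
      exact hz _ h ⟨x, rfl⟩
    obtain ⟨r, hr, hrC⟩ := MvPolynomial.isUnit_iff_eq_C_of_isReduced.1 hunit
    have hgC : g - C r = 0 := by
      refine eq_zero_of_open _ _ hopenR hneR ?_
      rintro _ ⟨x, rfl⟩
      rw [map_sub, ← hev, hrC]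
      simp
    apply hg.not_isUnit
    rw [sub_eq_zero.1 hgC]
    exact hr.map C
end

section
/- Let f : ℂ² → ℂ² be a Jacobian pair, i.e., a polynomial map whose Jacobian determinant is a nonzero constant. Then the iterated images f^k(ℂ²) stabilize: there exists K > 0 with f^k(ℂ²) = f^K(ℂ²) for all k ≥ K, and the stable image ⋂_{k>0} f^k(ℂ²) is an open, simply connected, cofinite subset of ℂ². -/
open MvPolynomial

/-- A copy of the coordinate ring of the plane, used as the target of the comorphism. -/
def PlaneRing : Type := MvPolynomial (Fin 2) ℂ

noncomputable instance : CommRing PlaneRing := inferInstanceAs (CommRing (MvPolynomial (Fin 2) ℂ))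
noncomputable instance : Algebra ℂ PlaneRing := inferInstanceAs (Algebra ℂ (MvPolynomial (Fin 2) ℂ))
instance : IsDomain PlaneRing := inferInstanceAs (IsDomain (MvPolynomial (Fin 2) ℂ))

/-- The comorphism of the polynomial map given by `q`. -/
noncomputable def comorph (q : Fin 2 → MvPolynomial (Fin 2) ℂ) :
    MvPolynomial (Fin 2) ℂ →ₐ[ℂ] PlaneRing :=
  (MvPolynomial.aeval q : MvPolynomial (Fin 2) ℂ →ₐ[ℂ] MvPolynomial (Fin 2) ℂ)

/-- the coordinates of the copy -/
noncomputable def PlaneRing.x (i : Fin 2) : PlaneRing := (X i : MvPolynomial (Fin 2) ℂ)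

lemma smooth_aux (q : Fin 2 → MvPolynomial (Fin 2) ℂ) (c : ℂ) (hc : c ≠ 0)
    (hjac : ∀ x : Fin 2 → ℂ,
      (Matrix.of fun i j => MvPolynomial.eval x (MvPolynomial.pderiv j (q i))).det = c) :
    letI : Algebra (MvPolynomial (Fin 2) ℂ) PlaneRing := (comorph q).toRingHom.toAlgebra
    Algebra.IsStandardSmooth (MvPolynomial (Fin 2) ℂ) PlaneRing := by
  let : Algebra (MvPolynomial (Fin 2) ℂ) PlaneRing := (comorph q).toRingHom.toAlgebra
  have hj : (Matrix.of fun i j => MvPolynomial.pderiv j (q i)).det = C c := by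
    apply MvPolynomial.funext
    intro x
    rw [RingHom.map_det, eval_C, ← hjac x]
    congr 1
  have halg : ∀ a, algebraMap (MvPolynomial (Fin 2) ℂ) PlaneRing a = (aeval q a : MvPolynomial (Fin 2) ℂ) :=
    fun a => rfl
  have hval : ∀ s : MvPolynomial (Fin 2) ℂ,
      aeval PlaneRing.x (MvPolynomial.map (C : ℂ →+* MvPolynomial (Fin 2) ℂ) s) = (s : PlaneRing) := by
    intro s
    induction s using MvPolynomial.induction_on with
    | C a => 
      rw [map_C, aeval_C, halg, aeval_C]; rfl
    | add p q hp hq => 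
      rw [map_add, map_add, hp, hq]; rfl
    | mul_X p i hp =>
      rw [map_mul, map_mul, hp, map_X, aeval_X]; rfl
  let G : Algebra.Generators (MvPolynomial (Fin 2) ℂ) PlaneRing (Fin 2) :=
    { val := PlaneRing.x
      σ' := fun s => MvPolynomial.map C (s : MvPolynomial (Fin 2) ℂ)
      aeval_val_σ' := hval }
  let rel : Fin 2 → MvPolynomial (Fin 2) (MvPolynomial (Fin 2) ℂ) := 
    fun i => MvPolynomial.map C (q i) - C (X i)
  have hspan : Ideal.span (Set.range rel) = RingHom.ker (aeval PlaneRing.x : MvPolynomial (Fin 2) (MvPolynomial (Fin 2) ℂ) →ₐ[MvPolynomial (Fin 2) ℂ] PlaneRing) := by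
    apply le_antisymm
    · rw [Ideal.span_le]
      rintro _ ⟨i, rfl⟩
      simp only [rel, SetLike.mem_coe, RingHom.mem_ker, map_sub]
      rw [hval, aeval_C, halg, aeval_X]
      exact sub_self _
    · intro P hP
      let J := Ideal.span (Set.range rel)
      let f1 : MvPolynomial (Fin 2) (MvPolynomial (Fin 2) ℂ) →+* _ ⧸ J := Ideal.Quotient.mk J
      let ev : MvPolynomial (Fin 2) (MvPolynomial (Fin 2) ℂ) →+* MvPolynomial (Fin 2) ℂ :=
        eval₂Hom (aeval q : MvPolynomial (Fin 2) ℂ →ₐ[ℂ] MvPolynomial (Fin 2) ℂ).toRingHom X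
      let f2 : MvPolynomial (Fin 2) (MvPolynomial (Fin 2) ℂ) →+* _ ⧸ J :=
        (Ideal.Quotient.mk J).comp ((MvPolynomial.map C).comp ev)
      have : f1 = f2 := by
        apply MvPolynomial.ringHom_ext'
        · apply MvPolynomial.ringHom_ext
          · intro r
            simp [f1, f2, ev]
          · intro i
            simp only [f1, f2, ev, RingHom.comp_apply, coe_eval₂Hom, eval₂_C]
            rw [eq_comm, Ideal.Quotient.eq]
            apply Ideal.subset_span
            exact ⟨i, by simp [rel]⟩
        · intro i
          simp [f1, f2, ev]
      have hP' : ev P = 0 := hP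
      rw [← Ideal.Quotient.eq_zero_iff_mem]
      change f1 P = 0
      rw [this]
      simp [f2, hP']
  let P : Algebra.PreSubmersivePresentation (MvPolynomial (Fin 2) ℂ) PlaneRing (Fin 2) (Fin 2) :=
    { toGenerators := G
      relation := rel
      span_range_relation_eq_ker := hspan
      map := id
      map_inj := Function.injective_id }
  have hu : IsUnit P.jacobian := by
    rw [P.jacobian_eq_jacobiMatrix_det]
    have : P.jacobiMatrix = ((MvPolynomial.map C).mapMatrix (Matrix.of fun i j => MvPolynomial.pderiv j (q i))).transpose := by
      ext1 i j
      rw [P.jacobiMatrix_apply]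
      change pderiv i (rel j) = _
      simp only [rel]
      simp [pderiv_map]
    rw [this, Matrix.det_transpose, ← RingHom.map_det, hj]
    rw [map_C]
    apply IsUnit.map
    apply IsUnit.map
    exact (isUnit_iff_ne_zero.2 hc).map C
  exact (Algebra.SubmersivePresentation.mk P hu).isStandardSmooth

/-- The closed point of the spectrum attached to `y`. -/
noncomputable def planePt (y : Fin 2 → ℂ) : PrimeSpectrum (MvPolynomial (Fin 2) ℂ) :=
  ⟨RingHom.ker (aeval y : MvPolynomial (Fin 2) ℂ →ₐ[ℂ] ℂ), RingHom.ker_isPrime _⟩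

/-- The point of the spectrum attached to a complex-valued homomorphism. -/
noncomputable def homPt {B : Type*} [CommRing B] [Algebra ℂ B] (θ : B →ₐ[ℂ] ℂ) : PrimeSpectrum B :=
  ⟨RingHom.ker θ, RingHom.ker_isPrime _⟩

lemma mem_planePt (y : Fin 2 → ℂ) (a : MvPolynomial (Fin 2) ℂ) :
    a ∈ (planePt y).asIdeal ↔ aeval y a = 0 := Iff.rfl

lemma planePt_max (y : Fin 2 → ℂ) : (planePt y).asIdeal.IsMaximal :=
  RingHom.ker_isMaximal_of_surjective (aeval y : MvPolynomial (Fin 2) ℂ →ₐ[ℂ] ℂ)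
    fun c => ⟨C c, by simp⟩

lemma exists_hom_of_maximal {B : Type*} [CommRing B] [Algebra ℂ B] [Algebra.FiniteType ℂ B]
    (M : Ideal B) [hM : M.IsMaximal] : ∃ θ : B →ₐ[ℂ] ℂ, RingHom.ker θ = M := by
  let := Ideal.Quotient.field M
  have : Algebra.FiniteType ℂ (B ⧸ M) :=
    Algebra.FiniteType.of_surjective (Ideal.Quotient.mkₐ ℂ M) (Ideal.Quotient.mkₐ_surjective ℂ M)
  have := finite_of_finite_type_of_isJacobsonRing ℂ (B ⧸ M)
  have hb : Function.Bijective (algebraMap ℂ (B ⧸ M)) :=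
    IsAlgClosed.algebraMap_bijective_of_isIntegral
  let e : ℂ ≃ₐ[ℂ] (B ⧸ M) := AlgEquiv.ofBijective (Algebra.ofId ℂ (B ⧸ M)) hb
  refine ⟨(e.symm : (B ⧸ M) →ₐ[ℂ] ℂ).comp (Ideal.Quotient.mkₐ ℂ M), ?_⟩
  ext x
  simp [RingHom.mem_ker, Ideal.Quotient.eq_zero_iff_mem]

lemma point_image {B : Type*} [CommRing B] [Algebra ℂ B] [Algebra.FiniteType ℂ B]
    (ψ : MvPolynomial (Fin 2) ℂ →ₐ[ℂ] B) (U : Set (PrimeSpectrum B)) (hU : IsOpen U)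
    (y : Fin 2 → ℂ) :
    planePt y ∈ PrimeSpectrum.comap ψ.toRingHom '' U ↔
      ∃ θ : B →ₐ[ℂ] ℂ, homPt θ ∈ U ∧ θ.comp ψ = aeval y := by
  constructor
  · rintro ⟨Q, hQU, hQ⟩
    have : IsJacobsonRing B := isJacobsonRing_of_finiteType (A := ℂ)
    have hlc : IsLocallyClosed (U ∩ closure {Q}) :=
      hU.isLocallyClosed.inter isClosed_closure.isLocallyClosed
    obtain ⟨M, ⟨hMU, hMQ⟩, hMc⟩ := nonempty_inter_closedPoints
      (Z := U ∩ closure {Q}) ⟨Q, hQU, subset_closure rfl⟩ hlc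
    rw [mem_closedPoints_iff, PrimeSpectrum.isClosed_singleton_iff_isMaximal] at hMc
    rw [← specializes_iff_mem_closure, ← PrimeSpectrum.le_iff_specializes] at hMQ
    obtain ⟨θ, hθ⟩ := exists_hom_of_maximal M.asIdeal
    have hMθ : homPt θ = M := PrimeSpectrum.ext hθ
    refine ⟨θ, hMθ ▸ hMU, ?_⟩
    have key : ∀ a, aeval y a = (0 : ℂ) → θ (ψ a) = 0 := by
      intro a ha
      have h1 : a ∈ (planePt y).asIdeal := ha
      rw [← hQ] at h1
      have h2 : ψ a ∈ Q.asIdeal := h1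
      have h3 := hMQ h2
      rw [← hθ] at h3
      exact h3
    ext i
    have := key (X i - C (y i)) (by simp)
    rw [map_sub, map_sub, sub_eq_zero] at this
    have h4 : ψ (C (y i)) = algebraMap ℂ B (y i) := ψ.commutes _
    rw [h4, θ.commutes] at this
    simpa using this
  · rintro ⟨θ, hU, h⟩
    refine ⟨homPt θ, hU, ?_⟩
    apply PrimeSpectrum.ext
    ext a
    have : θ (ψ a) = aeval y a := by rw [← h]; rfl
    change θ (ψ a) = 0 ↔ aeval y a = 0
    rw [this]

lemma hom_comorph (q : Fin 2 → MvPolynomial (Fin 2) ℂ) (θ : PlaneRing →ₐ[ℂ] ℂ) (y : Fin 2 → ℂ) :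
    θ.comp (comorph q) = aeval y ↔ ∀ i, eval (fun j => θ (PlaneRing.x j)) (q i) = y i := by
  have h : ∀ p : MvPolynomial (Fin 2) ℂ, θ p = eval (fun j => θ (PlaneRing.x j)) p := by
    intro p
    have := MvPolynomial.aeval_unique (S₁ := ℂ) (σ := Fin 2) (R := ℂ) θ
    rw [← MvPolynomial.coe_aeval_eq_eval]
    exact DFunLike.congr_fun this p
  have h2 : ∀ i, (θ.comp (comorph q)) (X i) = eval (fun j => θ (PlaneRing.x j)) (q i) := by
    intro i
    rw [← h]
    change θ (aeval q (X i) : MvPolynomial (Fin 2) ℂ) = _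
    rw [aeval_X]
  constructor
  · intro h3 i
    rw [← h2, h3, aeval_X]
  · intro h3
    ext i
    rw [h2, h3, aeval_X]

/-- Evaluation at a point. -/
noncomputable def evalHom (a : Fin 2 → ℂ) : PlaneRing →ₐ[ℂ] ℂ :=
  (aeval a : MvPolynomial (Fin 2) ℂ →ₐ[ℂ] ℂ)

lemma evalHom_x (a : Fin 2 → ℂ) (i : Fin 2) : evalHom a (PlaneRing.x i) = a i :=
  aeval_X (R := ℂ) a i

section geometry
instance : Algebra.FiniteType ℂ PlaneRing :=
  inferInstanceAs (Algebra.FiniteType ℂ (MvPolynomial (Fin 2) ℂ))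

/-- the comorphism is open on spectra, and injective -/
lemma comorph_open (q : Fin 2 → MvPolynomial (Fin 2) ℂ) (c : ℂ) (hc : c ≠ 0)
    (hjac : ∀ x : Fin 2 → ℂ,
      (Matrix.of fun i j => MvPolynomial.eval x (MvPolynomial.pderiv j (q i))).det = c) : IsOpenMap (PrimeSpectrum.comap (comorph q).toRingHom) ∧
    Function.Injective (comorph q) := by
  let : Algebra (MvPolynomial (Fin 2) ℂ) PlaneRing := (comorph q).toRingHom.toAlgebra
  have := smooth_aux q c hc hjac
  constructor
  · exact PrimeSpectrum.isOpenMap_comap_of_hasGoingDown_of_finitePresentation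
      (R := MvPolynomial (Fin 2) ℂ) (S := PlaneRing)
  · have : Module.IsTorsionFree (MvPolynomial (Fin 2) ℂ) PlaneRing := inferInstance
    exact FaithfulSMul.algebraMap_injective (MvPolynomial (Fin 2) ℂ) PlaneRing

lemma double_open (q : Fin 2 → MvPolynomial (Fin 2) ℂ) (c : ℂ) (hc : c ≠ 0)
    (hjac : ∀ x : Fin 2 → ℂ,
      (Matrix.of fun i j => MvPolynomial.eval x (MvPolynomial.pderiv j (q i))).det = c) : ∃ J : Ideal (MvPolynomial (Fin 2) ℂ), ∀ y : Fin 2 → ℂ,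
    y ∈ zeroLocus ℂ J ↔ ∀ a b : Fin 2 → ℂ, (∀ i, eval a (q i) = y i) → (∀ i, eval b (q i) = y i) →
      a = b := by
  let : Algebra (MvPolynomial (Fin 2) ℂ) PlaneRing := (comorph q).toRingHom.toAlgebra
  have := smooth_aux q c hc hjac
  have : IsScalarTower ℂ (MvPolynomial (Fin 2) ℂ) PlaneRing :=
    IsScalarTower.of_algebraMap_eq fun r => ((comorph q).commutes r).symm
  let B := TensorProduct (MvPolynomial (Fin 2) ℂ) PlaneRing PlaneRing
  have : Algebra.FinitePresentation (MvPolynomial (Fin 2) ℂ) B :=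
    Algebra.FinitePresentation.trans _ PlaneRing B
  have : Algebra.FiniteType ℂ B :=
    Algebra.FiniteType.trans (S := MvPolynomial (Fin 2) ℂ) inferInstance inferInstance
  have hop : IsOpenMap (PrimeSpectrum.comap (algebraMap (MvPolynomial (Fin 2) ℂ) B)) :=
    PrimeSpectrum.isOpenMap_comap_of_hasGoingDown_of_finitePresentation
  let ψ : MvPolynomial (Fin 2) ℂ →ₐ[ℂ] B := IsScalarTower.toAlgHom ℂ (MvPolynomial (Fin 2) ℂ) B
  let g : Fin 2 → B := fun i => PlaneRing.x i ⊗ₜ 1 - 1 ⊗ₜ PlaneRing.x i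
  let U : Set (PrimeSpectrum B) := ⋃ i, PrimeSpectrum.basicOpen (g i)
  have hU : IsOpen U := isOpen_iUnion fun i => (PrimeSpectrum.basicOpen (g i)).2
  obtain ⟨J, hJ⟩ := (PrimeSpectrum.isClosed_iff_zeroLocus_ideal _).1 (hop U hU).isClosed_compl
  refine ⟨J, fun y => ?_⟩
  have h1 : y ∈ zeroLocus ℂ J ↔ planePt y ∈ PrimeSpectrum.zeroLocus (J : Set _) := Iff.rfl
  rw [h1, ← hJ, Set.mem_compl_iff]
  have h2 := point_image ψ U hU y
  have h3 : PrimeSpectrum.comap ψ.toRingHom = 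
    PrimeSpectrum.comap (algebraMap (MvPolynomial (Fin 2) ℂ) B) := rfl
  rw [← h3, h2]
  have hmem : ∀ θ : B →ₐ[ℂ] ℂ, homPt θ ∈ U ↔ ∃ i, θ (PlaneRing.x i ⊗ₜ 1) ≠ θ (1 ⊗ₜ PlaneRing.x i) := by
    intro θ
    simp only [U, Set.mem_iUnion, SetLike.mem_coe, PrimeSpectrum.mem_basicOpen]
    refine exists_congr fun i => ?_
    change ¬ (θ (g i) = 0) ↔ _
    rw [map_sub, sub_eq_zero]
  have hl : (Algebra.TensorProduct.includeLeft : PlaneRing →ₐ[ℂ] B).comp (comorph q) = ψ := rfl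
  let iR : PlaneRing →ₐ[ℂ] B := (Algebra.TensorProduct.includeRight : PlaneRing →ₐ[MvPolynomial (Fin 2) ℂ] B).restrictScalars ℂ
  have hr : iR.comp (comorph q) = ψ := by
    apply AlgHom.ext
    intro a
    exact (Algebra.TensorProduct.includeRight : PlaneRing →ₐ[MvPolynomial (Fin 2) ℂ] B).commutes a
  constructor
  · intro hn a b ha hb
    by_contra hab
    apply hn
    have ha' : (evalHom a).comp (comorph q) = aeval y := by
      rw [hom_comorph]; simpa only [evalHom_x] using ha
    have hb' : (evalHom b).comp (comorph q) = aeval y := by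
      rw [hom_comorph]; simpa only [evalHom_x] using hb
    let : Algebra (MvPolynomial (Fin 2) ℂ) ℂ := (aeval y : MvPolynomial (Fin 2) ℂ →ₐ[ℂ] ℂ).toRingHom.toAlgebra
    have : IsScalarTower ℂ (MvPolynomial (Fin 2) ℂ) ℂ :=
      IsScalarTower.of_algebraMap_eq fun r => ((aeval y : MvPolynomial (Fin 2) ℂ →ₐ[ℂ] ℂ).commutes r).symm
    let ea : PlaneRing →ₐ[MvPolynomial (Fin 2) ℂ] ℂ :=
      { (evalHom a).toRingHom with commutes' := fun r => DFunLike.congr_fun ha' r }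
    let eb : PlaneRing →ₐ[MvPolynomial (Fin 2) ℂ] ℂ :=
      { (evalHom b).toRingHom with commutes' := fun r => DFunLike.congr_fun hb' r }
    let θ0 : B →ₐ[MvPolynomial (Fin 2) ℂ] ℂ := Algebra.TensorProduct.lift ea eb fun _ _ => Commute.all _ _
    let θ : B →ₐ[ℂ] ℂ := θ0.restrictScalars ℂ
    refine ⟨θ, ?_, ?_⟩
    · rw [hmem]
      obtain ⟨i, hi⟩ := Function.ne_iff.1 hab
      refine ⟨i, ?_⟩
      have e1 : θ (PlaneRing.x i ⊗ₜ 1) = a i := by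
        change θ0 _ = _
        rw [Algebra.TensorProduct.lift_tmul, map_one, mul_one]
        exact evalHom_x a i
      have e2 : θ (1 ⊗ₜ PlaneRing.x i) = b i := by
        change θ0 _ = _
        rw [Algebra.TensorProduct.lift_tmul, map_one, one_mul]
        exact evalHom_x b i
      rw [e1, e2]; exact hi
    · apply AlgHom.ext
      intro r
      exact θ0.commutes r
  · rintro h ⟨θ, hθ, hc⟩
    rw [hmem] at hθ
    obtain ⟨i, hi⟩ := hθ
    apply hi
    have ea := (hom_comorph q (θ.comp Algebra.TensorProduct.includeLeft) y).1 (by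
      rw [AlgHom.comp_assoc, hl, hc])
    have eb := (hom_comorph q (θ.comp iR) y).1 (by
      rw [AlgHom.comp_assoc, hr, hc])
    exact congrFun (h _ _ ea eb) i

lemma dim_chain (P Q M : PrimeSpectrum (MvPolynomial (Fin 2) ℂ)) (h1 : ⊥ < P) (h2 : P < Q)
    (h3 : Q < M) : False := by
  let s : LTSeries (PrimeSpectrum (MvPolynomial (Fin 2) ℂ)) :=
    (((RelSeries.singleton {p : PrimeSpectrum (MvPolynomial (Fin 2) ℂ) × PrimeSpectrum (MvPolynomial (Fin 2) ℂ) | p.1 < p.2} ⊥).snoc P (by simpa using h1)).snoc Q (by simpa using h2)).snoc M (by simpa using h3)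
  have hs : s.length = 3 := rfl
  have h := Order.LTSeries.length_le_krullDim s
  have h' : Order.krullDim (PrimeSpectrum (MvPolynomial (Fin 2) ℂ)) = 2 := by
    change ringKrullDim _ = 2
    rw [MvPolynomial.ringKrullDim_of_isNoetherianRing]
    simp
  rw [h', hs] at h
  have : (3 : ℕ) ≤ 2 := by exact_mod_cast h
  omega

lemma planePt_injective : Function.Injective planePt := by
  intro y z h
  ext i
  have h1 : (X i - C (z i) : MvPolynomial (Fin 2) ℂ) ∈ (planePt z).asIdeal := by
    rw [mem_planePt]; simp
  rw [← h, mem_planePt] at h1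
  simpa [sub_eq_zero] using h1

lemma missing_finite (q : Fin 2 → MvPolynomial (Fin 2) ℂ) (c : ℂ) (hc : c ≠ 0)
    (hjac : ∀ x : Fin 2 → ℂ,
      (Matrix.of fun i j => MvPolynomial.eval x (MvPolynomial.pderiv j (q i))).det = c) : {y : Fin 2 → ℂ | ¬ ∃ a : Fin 2 → ℂ, ∀ i, eval a (q i) = y i}.Finite := by
  obtain ⟨hop, hinj⟩ := comorph_open q c hc hjac
  obtain ⟨I, hI⟩ := (PrimeSpectrum.isClosed_iff_zeroLocus_ideal _).1
    (hop Set.univ isOpen_univ).isClosed_compl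
  have hcomap : ∀ Q, ¬ I ≤ (PrimeSpectrum.comap (comorph q).toRingHom Q).asIdeal := by
    intro Q h
    have : PrimeSpectrum.comap (comorph q).toRingHom Q ∈ PrimeSpectrum.zeroLocus (I : Set _) := h
    rw [← hI] at this
    exact this ⟨Q, trivial, rfl⟩
  have hmax : ∀ p ∈ I.minimalPrimes, p.IsMaximal := by
    intro p hp
    have hprime : p.IsPrime := hp.1.1
    have hIp : I ≤ p := hp.1.2
    have hbot : p ≠ ⊥ := by
      rintro rfl
      have hI0 : I = ⊥ := le_bot_iff.1 hIp
      exact hcomap ⟨⊥, Ideal.isPrime_bot⟩ (hI0.le.trans bot_le)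
    obtain ⟨h, hhp, hh⟩ := hprime.exists_mem_prime_of_ne_bot hbot
    have hspan : (Ideal.span {h}).IsPrime := (Ideal.span_singleton_prime hh.ne_zero).2 hh
    have hle : Ideal.span {h} ≤ p := by
      rw [Ideal.span_le]; simpa using hhp
    have hne : Ideal.span {h} ≠ p := by
      intro heq
      have hu : IsUnit (comorph q h) := by
        by_contra hu
        obtain ⟨Q, hQ, hQh⟩ := exists_max_ideal_of_mem_nonunits hu
        refine hcomap ⟨Q, hQ.isPrime⟩ (hIp.trans ?_)
        rw [← heq, Ideal.span_le]
        simpa using hQh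
      have hu' : IsUnit (aeval q h : MvPolynomial (Fin 2) ℂ) := hu
      rw [MvPolynomial.isUnit_iff_eq_C_of_isReduced] at hu'
      obtain ⟨d, hd, hd'⟩ := hu'
      have hCd : h = C d := by
        apply hinj
        change (aeval q h : MvPolynomial (Fin 2) ℂ) = (aeval q (C d) : MvPolynomial (Fin 2) ℂ)
        rw [hd', aeval_C]; rfl
      exact hh.not_isUnit (hCd ▸ hd.map C)
    by_contra hpm
    obtain ⟨M, hM, hpM⟩ := Ideal.exists_le_maximal p hprime.ne_top
    have hpM' : p ≠ M := by rintro rfl; exact hpm hM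
    refine dim_chain ⟨_, hspan⟩ ⟨p, hprime⟩ ⟨M, hM.isPrime⟩ ?_ ?_ ?_
    · rw [bot_lt_iff_ne_bot]
      intro hb
      have : Ideal.span {h} = ⊥ := congrArg PrimeSpectrum.asIdeal hb
      rw [Ideal.span_singleton_eq_bot] at this
      exact hh.ne_zero this
    · exact lt_of_le_of_ne hle fun hb => hne (congrArg PrimeSpectrum.asIdeal hb)
    · exact lt_of_le_of_ne hpM fun hb => hpM' (congrArg PrimeSpectrum.asIdeal hb)
  have hfin := I.finite_minimalPrimes_of_isNoetherianRing
  refine Set.Finite.of_finite_image (f := fun y => (planePt y).asIdeal) (hfin.subset ?_)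
    (fun y _ z _ h => planePt_injective (PrimeSpectrum.ext h))
  rintro _ ⟨y, hy, rfl⟩
  have hy' : planePt y ∈ PrimeSpectrum.zeroLocus (I : Set _) := by
    rw [← hI, Set.mem_compl_iff, point_image _ _ isOpen_univ]
    rintro ⟨θ, -, hθ⟩
    exact hy ⟨_, (hom_comorph q θ y).1 hθ⟩
  have hIy : I ≤ (planePt y).asIdeal := hy'
  have := (planePt y).2
  obtain ⟨p, hp, hpy⟩ := Ideal.exists_minimalPrimes_le hIy
  have : p = (planePt y).asIdeal := (hmax p hp).eq_of_le (planePt y).2.ne_top hpy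
  change (planePt y).asIdeal ∈ _
  rwa [← this]

end geometry

section orbit

lemma exists_minimal_index (u : ℕ → ℕ) : ∃ N, ∀ k, u N ≤ u k := by
  classical
  have hex : ∃ v, ∃ n, u n = v := ⟨_, 0, rfl⟩
  obtain ⟨N, hN⟩ := Nat.find_spec hex
  exact ⟨N, fun k => hN ▸ Nat.find_min' hex ⟨k, rfl⟩⟩

lemma orbit_of_not_stable {X : Type*} (F : X → X) (h1 : (Set.range F)ᶜ.Finite)
    (hns : ¬ ∃ K > 0, ∀ k ≥ K, F^[k] '' Set.univ = F^[K] '' Set.univ) :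
    ∃ x : ℕ → X, (∀ k, F (x k) = x (k + 1)) ∧ (∀ k a, F a = x (k + 1) → a = x k) ∧
      ∃ m, x 0 ∉ Set.range F^[m] := by
  let E : ℕ → Set X := fun k => (Set.range F^[k])ᶜ
  have hE0 : E 0 = ∅ := by simp [E]
  have hEs : ∀ k y, y ∈ E (k + 1) ↔ ∀ x, F x = y → x ∈ E k := by
    intro k y
    simp only [E, Set.mem_compl_iff, Set.mem_range, Function.iterate_succ_apply', not_exists]
    constructor
    · rintro h _ hx z rfl
      exact h z hx
    · intro h z hz
      exact h _ hz z rfl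
  have hmono1 : ∀ k, E k ⊆ E (k + 1) := by
    intro k
    induction k with
    | zero => rw [hE0]; exact Set.empty_subset _
    | succ k ih =>
      intro y hy
      rw [hEs] at hy ⊢
      exact fun x hx => ih (hy x hx)
  have hmono : Monotone E := monotone_nat_of_le_succ hmono1
  have hfin : ∀ k, (E k).Finite := by
    intro k
    induction k with
    | zero => rw [hE0]; exact Set.finite_empty
    | succ k ih =>
      refine (h1.union (ih.image F)).subset ?_
      intro y hy
      by_cases hr : y ∈ Set.range F
      · obtain ⟨x, rfl⟩ := hr
        exact Or.inr ⟨x, (hEs _ _).1 hy x rfl, rfl⟩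
      · exact Or.inl hr
  let D : ℕ → Set X := fun k => E (k + 1) \ E k
  have hDfin : ∀ k, (D k).Finite := fun k => (hfin (k + 1)).subset Set.sdiff_subset
  have hDsub : ∀ k, D (k + 1) ⊆ F '' D k := by
    rintro k y ⟨hy1, hy2⟩
    rw [hEs] at hy1 hy2
    push Not at hy2
    obtain ⟨x, hx, hx2⟩ := hy2
    exact ⟨x, ⟨hy1 x hx, hx2⟩, hx⟩
  have hDdisj : ∀ i j y, y ∈ D i → y ∈ D j → i = j := by
    have : ∀ i j y, y ∈ D i → y ∈ D j → i < j → False := fun i j y hi hj hij =>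
      hj.2 (hmono (Nat.succ_le_of_lt hij) hi.1)
    intro i j y hi hj
    rcases lt_trichotomy i j with h | h | h
    · exact (this i j y hi hj h).elim
    · exact h
    · exact (this j i y hj hi h).elim
  have hDne : ∀ k, (D k).Nonempty := by
    intro k
    by_contra hk
    rw [Set.not_nonempty_iff_eq_empty] at hk
    have hj : ∀ j, D (k + j) = ∅ := by
      intro j
      induction j with
      | zero => exact hk
      | succ j ih =>
        have := hDsub (k + j)
        rw [ih, Set.image_empty] at this
        exact Set.subset_empty_iff.1 this
    have hE : ∀ j, E (k + j) = E k := by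
      intro j
      induction j with
      | zero => rfl
      | succ j ih =>
        rw [← ih]
        exact (Set.sdiff_eq_empty.1 (hj j)).antisymm (hmono1 _)
    apply hns
    refine ⟨k + 1, Nat.succ_pos _, fun l hl => ?_⟩
    obtain ⟨j, rfl⟩ := Nat.exists_eq_add_of_le hl
    rw [Set.image_univ, Set.image_univ]
    apply compl_injective
    change E (k + 1 + j) = E (k + 1)
    rw [add_assoc, hE, hE]
  have hcard : ∀ k, (D (k + 1)).ncard ≤ (D k).ncard := fun k =>
    (Set.ncard_le_ncard (hDsub k) ((hDfin k).image F)).trans (Set.ncard_image_le (hDfin k))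
  have hanti : Antitone fun k => (D k).ncard := antitone_nat_of_succ_le hcard
  obtain ⟨N, hN⟩ : ∃ N, ∀ k ≥ N, (D k).ncard = (D N).ncard := by
    obtain ⟨N, hN⟩ := exists_minimal_index fun k => (D k).ncard
    exact ⟨N, fun k hk => le_antisymm (hanti hk) (hN k)⟩
  have himg : ∀ k ≥ N, F '' D k = D (k + 1) := by
    intro k hk
    symm
    apply Set.eq_of_subset_of_ncard_le (hDsub k) _ ((hDfin k).image F)
    rw [hN (k + 1) (by omega), ← hN k hk]
    exact Set.ncard_image_le (hDfin k)
  have hinj : ∀ k ≥ N, Set.InjOn F (D k) := by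
    intro k hk
    apply Set.injOn_of_ncard_image_eq _ (hDfin k)
    rw [himg k hk, hN _ hk, hN _ (by omega)]
  have hev : ∀ᶠ k in Filter.atTop, ∀ s ∈ F '' E N, s ∉ D k := by
    rw [Filter.eventually_all_finite ((hfin N).image F)]
    intro s _
    by_cases hs : ∃ j, s ∈ D j
    · obtain ⟨j, hj⟩ := hs
      filter_upwards [Filter.eventually_gt_atTop j] with k hk hk'
      exact hk.ne (hDdisj _ _ s hj hk')
    · exact Filter.Eventually.of_forall fun k hk => hs ⟨k, hk⟩
  obtain ⟨M, hM⟩ := Filter.eventually_atTop.1 (hev.and (Filter.eventually_ge_atTop N))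
  obtain ⟨x0, hx0⟩ := hDne M
  have hMN : N ≤ M := (hM M le_rfl).2
  have hx : ∀ k, F^[k] x0 ∈ D (M + k) := by
    intro k
    induction k with
    | zero => exact hx0
    | succ k ih =>
      rw [Function.iterate_succ_apply', ← add_assoc, ← himg (M + k) (by omega)]
      exact ⟨_, ih, rfl⟩
  refine ⟨fun k => F^[k] x0, fun k => (Function.iterate_succ_apply' F k x0).symm, ?_, M + 1, ?_⟩
  · intro k a ha
    simp only at ha ⊢
    have hy := hx (k + 1)
    rw [← ha] at hy
    have haE : a ∈ E (M + k + 1) := (hEs _ _).1 hy.1 a rfl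
    have haN : a ∉ E N := fun h => (hM (M + (k + 1)) (by omega)).1 (F a) ⟨a, h, rfl⟩ hy
    have hex : ∃ j, a ∈ E j := ⟨_, haE⟩
    classical
    have hj1 := Nat.find_spec hex
    have hjN : N < Nat.find hex := by
      by_contra hlt
      exact haN (hmono (not_lt.1 hlt) hj1)
    obtain ⟨j, hj⟩ : ∃ j, Nat.find hex = j + 1 := ⟨Nat.find hex - 1, by omega⟩
    have haD : a ∈ D j := ⟨hj ▸ hj1, Nat.find_min hex (by omega)⟩
    have hFa : F a ∈ D (j + 1) := by
      rw [← himg j (by omega)]; exact ⟨a, haD, rfl⟩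
    have hjk : j = M + k := by
      have := hDdisj _ _ _ hFa hy
      omega
    subst hjk
    exact hinj (M + k) (by omega) haD (hx k) (by rw [ha, Function.iterate_succ_apply'])
  · exact hx0.1

end orbit

lemma stabilize (F : (Fin 2 → ℂ) → (Fin 2 → ℂ)) (q : Fin 2 → MvPolynomial (Fin 2) ℂ)
    (hq : ∀ x i, F x i = MvPolynomial.eval x (q i)) (c : ℂ) (hc : c ≠ 0)
    (hjac : ∀ x : Fin 2 → ℂ,
      (Matrix.of fun i j => MvPolynomial.eval x (MvPolynomial.pderiv j (q i))).det = c) :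
    ∃ K > 0, ∀ k ≥ K, F^[k] '' Set.univ = F^[K] '' Set.univ := by
  have hF : (fun v i => eval v (q i)) = F := by
    funext v i; exact (hq v i).symm
  by_contra hns
  have hfin : (Set.range F)ᶜ.Finite := by
    refine (missing_finite q c hc hjac).subset ?_
    rintro y hy ⟨a, ha⟩
    exact hy ⟨a, funext fun i => by rw [hq, ha]⟩
  obtain ⟨x, hx1, hx2, m, hm⟩ := orbit_of_not_stable F hfin hns
  obtain ⟨J, hJ⟩ := double_open q c hc hjac
  let T : Set (Fin 2 → ℂ) := Set.range fun k => x (k + 1)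
  let I := vanishingIdeal ℂ T
  have hTZ : T ⊆ zeroLocus ℂ I := zeroLocus_vanishingIdeal_le T
  have hJI : J ≤ I := by
    intro p hp y hy
    obtain ⟨k, rfl⟩ := hy
    refine (hJ (x (k + 1))).2 ?_ p hp
    intro a b ha hb
    have ea : F a = x (k + 1) := funext fun i => by rw [hq, ha]
    have eb : F b = x (k + 1) := funext fun i => by rw [hq, hb]
    rw [hx2 k a ea, hx2 k b eb]
  have hmaps : Set.MapsTo F (zeroLocus ℂ I) (zeroLocus ℂ I) := by
    intro z hz p hp
    have hcomp : ∀ w, aeval (F w) p = aeval w (bind₁ q p) := by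
      intro w
      rw [aeval_bind₁]
      congr 2
      funext i
      rw [hq]; rfl
    rw [hcomp]
    apply hz
    rintro _ ⟨k, rfl⟩
    rw [← hcomp, hx1]
    exact hp _ ⟨k + 1, rfl⟩
  have hinj : Set.InjOn F (zeroLocus ℂ I) := by
    intro a ha b hb hab
    have h := (hJ (F a)).1 (zeroLocus_anti_mono hJI (hmaps ha))
    exact h a b (fun i => (hq a i).symm) (fun i => by rw [hab, hq])
  have hsurj : Set.SurjOn F (zeroLocus ℂ I) (zeroLocus ℂ I) := by
    have := ax_grothendieck_zeroLocus I q
    rw [hF] at this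
    exact this hmaps hinj
  have hsurjn : ∀ n, Set.SurjOn F^[n] (zeroLocus ℂ I) (zeroLocus ℂ I) := fun n => hsurj.iterate n
  obtain ⟨z, -, hz⟩ := hsurjn (m + 1) (hTZ ⟨0, rfl⟩)
  rw [Function.iterate_succ_apply'] at hz
  exact hm ⟨z, hx2 0 _ hz⟩

section topology
open scoped unitInterval

lemma homotopic_of_map {V : Type*} [NormedAddCommGroup V] {U : Set V} {x y : U} (p₁ p₂ : Path x y) (H : I × I → V)
    (hH : Continuous H) (hU : ∀ z, H z ∈ U) (h0 : ∀ t, H (0, t) = p₁ t) (h1 : ∀ t, H (1, t) = p₂ t)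
    (hx : ∀ s, H (s, 0) = x) (hy : ∀ s, H (s, 1) = y) : p₁.Homotopic p₂ := by
  refine ⟨{ toFun := fun z => ⟨H z, hU z⟩
            continuous_toFun := hH.subtype_mk _
            map_zero_left := fun t => Subtype.ext (h0 t)
            map_one_left := fun t => Subtype.ext (h1 t)
            prop' := ?_ }⟩
  rintro s t (rfl | rfl)
  · exact Subtype.ext ((hx s).trans (by simp))
  · exact Subtype.ext ((hy s).trans (by simp))

variable {V : Type*} [NormedAddCommGroup V] [NormedSpace ℝ V]

/-- Bernstein approximation as a function on the line. -/
noncomputable def bern (n : ℕ) (f : C(I, V)) (t : ℝ) : V :=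
  ∑ k : Fin (n + 1), (bernsteinPolynomial ℝ n k).eval t • f (bernstein.z k)

lemma bern_eq (n : ℕ) (f : C(I, V)) (t : I) : bern n f t = bernsteinApproximation n f t := by
  rw [bernsteinApproximation.apply]; rfl

lemma bern_contDiff (n : ℕ) (f : C(I, V)) : ContDiff ℝ 1 (bern n f) := by
  unfold bern
  refine ContDiff.sum fun k _ => ContDiff.smul ?_ contDiff_const
  simpa using (bernsteinPolynomial ℝ n k).contDiff_aeval (𝕜 := ℝ) 1

lemma exists_generic [FiniteDimensional ℝ V] (hV : 2 < Module.finrank ℝ V) (S : Set V)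
    (hS : S.Finite) (g : ℝ → V) (hg : ContDiff ℝ 1 g) (x : V) :
    ∃ v : V, ∀ s ∈ Set.Ioo (0 : ℝ) 1, ∀ t ∈ Set.Ioo (0 : ℝ) 1,
      (1 - s) • g t + s • x + (s * (1 - s) * (t * (1 - t))) • v ∉ S := by
  let Q : Set (ℝ × ℝ) := Set.Ioo 0 1 ×ˢ Set.Ioo 0 1
  let f : V → ℝ × ℝ → V := fun e z =>
    (z.1 * (1 - z.1) * (z.2 * (1 - z.2)))⁻¹ • (e - ((1 - z.1) • g z.2 + z.1 • x))
  have hpos : ∀ z ∈ Q, 0 < z.1 * (1 - z.1) * (z.2 * (1 - z.2)) := by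
    rintro ⟨s, t⟩ ⟨⟨h1, h2⟩, h3, h4⟩
    simp only at h1 h2 h3 h4 ⊢
    have : 0 < 1 - s := by linarith
    have : 0 < 1 - t := by linarith
    positivity
  have hconv : Convex ℝ Q := (convex_Ioo 0 1).prod (convex_Ioo 0 1)
  have hf : ∀ e, ContDiffOn ℝ 1 (f e) Q := by
    intro e
    apply ContDiffOn.smul
    · apply ContDiffOn.inv
      · fun_prop
      · exact fun z hz => (hpos z hz).ne'
    · have : ContDiff ℝ 1 fun z : ℝ × ℝ => g z.2 := hg.comp contDiff_snd
      apply ContDiff.contDiffOn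
      fun_prop
  have hdimQ : dimH Q ≤ 2 := by
    refine (dimH_mono (Set.subset_univ Q)).trans ?_
    rw [Real.dimH_univ_eq_finrank]
    simp
  have hdim : dimH (⋃ e ∈ S, f e '' Q) < Module.finrank ℝ V := by
    rw [dimH_bUnion hS.countable]
    refine lt_of_le_of_lt (b := 2) ?_ (by exact_mod_cast hV)
    exact iSup₂_le fun e _ => ((hf e).dimH_image_le hconv subset_rfl).trans hdimQ
  obtain ⟨v, hv⟩ := (dense_compl_of_dimH_lt_finrank hdim).nonempty
  refine ⟨v, fun s hs t ht hmem => hv ?_⟩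
  rw [Set.mem_iUnion₂]
  refine ⟨_, hmem, (s, t), ⟨hs, ht⟩, ?_⟩
  simp only [f]
  rw [add_sub_cancel_left, inv_smul_smul₀ (hpos (s, t) ⟨hs, ht⟩).ne']

lemma simplyConnected_compl_finite [FiniteDimensional ℝ V] (hV : 2 < Module.finrank ℝ V) (S : Set V)
    (hS : S.Finite) : SimplyConnectedSpace ↥(Sᶜ) := by
  rw [simply_connected_iff_loops_nullhomotopic]
  constructor
  · rw [← isPathConnected_iff_pathConnectedSpace]
    apply hS.countable.isPathConnected_compl_of_one_lt_rank
    rw [← Module.finrank_eq_rank]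
    exact_mod_cast (by omega : 1 < Module.finrank ℝ V)
  intro x γ
  let f : C(I, V) := ⟨fun t => (γ t : V), by fun_prop⟩
  have hf0 : f 0 = x := by simp [f]
  have hf1 : f 1 = x := by simp [f]
  obtain ⟨δ, hδ, hthick⟩ := (isCompact_range f.continuous).exists_thickening_subset_open
    hS.isClosed.isOpen_compl (by rintro _ ⟨t, rfl⟩; exact (γ t).2)
  have hev := (bernsteinApproximation_uniform f).eventually (Metric.ball_mem_nhds f hδ)
  obtain ⟨n, hn, hn0⟩ := (hev.and (Filter.eventually_ne_atTop 0)).exists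
  have hdist : ∀ t : I, dist (bern n f t) (f t) < δ := fun t => by
    rw [bern_eq]
    exact (ContinuousMap.dist_apply_le_dist t).trans_lt hn
  have hb0 : bern n f 0 = x := by
    have := bern_eq n f 0
    rw [bernsteinApproximation.apply_zero, hf0] at this
    exact this
  have hb1 : bern n f 1 = x := by
    have := bern_eq n f 1
    rw [bernsteinApproximation.apply_one hn0, hf1] at this
    exact this
  have hg := bern_contDiff n f
  generalize bern n f = g at *
  have hgc : Continuous g := hg.continuous
  have hin : ∀ s t : I, (1 - (s : ℝ)) • f t + (s : ℝ) • g t ∈ Sᶜ := by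
    intro s t
    apply hthick
    rw [Metric.mem_thickening_iff]
    refine ⟨f t, ⟨t, rfl⟩, ?_⟩
    have h1 : (1 - (s : ℝ)) • f t + (s : ℝ) • g t - f t = (s : ℝ) • (g t - f t) := by
      module
    rw [dist_eq_norm, h1, norm_smul, ← dist_eq_norm]
    have hs : ‖(s : ℝ)‖ ≤ 1 := by
      rw [Real.norm_of_nonneg s.2.1]; exact s.2.2
    calc ‖(s : ℝ)‖ * dist (g t) (f t) ≤ 1 * dist (g t) (f t) := by gcongr
      _ < δ := by rw [one_mul]; exact hdist t
  have hgS : ∀ t : I, g t ∈ Sᶜ := fun t => by simpa using hin 1 t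
  let γ' : Path x x :=
    { toFun := fun t => ⟨g t, hgS t⟩
      continuous_toFun := by fun_prop
      source' := Subtype.ext hb0
      target' := Subtype.ext hb1 }
  have hh1 : γ.Homotopic γ' := by
    refine homotopic_of_map γ γ' (fun z => (1 - (z.1 : ℝ)) • f z.2 + (z.1 : ℝ) • g z.2)
      (by fun_prop) (fun z => hin z.1 z.2) (fun t => ?_) (fun t => ?_) (fun s => ?_) (fun s => ?_)
    · simp [f]
    · simp [γ']
    · simp [hf0, hb0, ← add_smul]
    · simp [hf1, hb1, ← add_smul]
  obtain ⟨v, hv⟩ := exists_generic hV S hS g hg x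
  have hh2 : γ'.Homotopic (Path.refl x) := by
    refine homotopic_of_map γ' _ (fun z => (1 - (z.1 : ℝ)) • g z.2 + (z.1 : ℝ) • (x : V) +
        ((z.1 : ℝ) * (1 - z.1) * (z.2 * (1 - z.2))) • v)
      (by fun_prop) (fun z => ?_) (fun t => ?_) (fun t => ?_) (fun s => ?_) (fun s => ?_)
    · obtain ⟨⟨s, hs0, hs1⟩, ⟨t, ht0, ht1⟩⟩ := z
      simp only
      rcases hs0.eq_or_lt with rfl | hs0
      · simpa using hgS ⟨t, ht0, ht1⟩
      rcases hs1.eq_or_lt with rfl | hs1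
      · simp
      rcases ht0.eq_or_lt with rfl | ht0
      · simp [hb0, ← add_smul]
      rcases ht1.eq_or_lt with rfl | ht1
      · simp [hb1, ← add_smul]
      exact hv s ⟨hs0, hs1⟩ t ⟨ht0, ht1⟩
    · simp [γ']
    · simp
    · simp [hb0, ← add_smul]
    · simp [hb1, ← add_smul]
  exact hh1.trans hh2

end topology

/-- The iterated images of a Jacobian pair stabilize, and the stable image is
an open, simply connected, cofinite subset of `ℂ²`. -/
theorem iterated_images_stabilize_jacobian_pair
    (F : (Fin 2 → ℂ) → (Fin 2 → ℂ))
    (q : Fin 2 → MvPolynomial (Fin 2) ℂ)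
    (hq : ∀ x i, F x i = MvPolynomial.eval x (q i))
    (c : ℂ) (hc : c ≠ 0)
    (hjac : ∀ x : Fin 2 → ℂ,
      (Matrix.of fun i j => MvPolynomial.eval x (MvPolynomial.pderiv j (q i))).det = c) :
    (∃ K > 0, ∀ k ≥ K, F^[k] '' Set.univ = F^[K] '' Set.univ) ∧
    IsOpen (⋂ k > 0, F^[k] '' Set.univ) ∧
    SimplyConnectedSpace ↥(⋂ k > 0, F^[k] '' Set.univ) ∧
    (⋂ k > 0, F^[k] '' Set.univ)ᶜ.Finite := by
  have hst := stabilize F q hq c hc hjac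
  have hfin1 : (Set.range F)ᶜ.Finite := by
    refine (missing_finite q c hc hjac).subset ?_
    rintro y hy ⟨a, ha⟩
    exact hy ⟨a, funext fun i => by rw [hq, ha]⟩
  have hfink : ∀ k, (Set.range F^[k])ᶜ.Finite := by
    intro k
    induction k with
    | zero => simp
    | succ k ih =>
      refine (hfin1.union (ih.image F)).subset ?_
      intro y hy
      by_cases hr : y ∈ Set.range F
      · obtain ⟨x, rfl⟩ := hr
        refine Or.inr ⟨x, ?_, rfl⟩
        rintro ⟨w, rfl⟩
        exact hy ⟨w, Function.iterate_succ_apply' F k w⟩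
      · exact Or.inl hr
  have hfin : (⋂ k > 0, F^[k] '' Set.univ)ᶜ.Finite := by
    obtain ⟨K, hK, hst⟩ := hst
    have hsub : F^[K] '' Set.univ ⊆ ⋂ k > 0, F^[k] '' Set.univ := by
      refine Set.subset_iInter₂ fun k _ => ?_
      rw [← hst (k + K) (Nat.le_add_left _ _), Function.iterate_add, Set.image_comp]
      exact Set.image_mono (Set.subset_univ _)
    refine (hfink K).subset (Set.compl_subset_compl.2 ?_)
    rwa [Set.image_univ] at hsub
  refine ⟨hst, ?_, ?_, hfin⟩
  · simpa using hfin.isClosed.isOpen_compl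
  · have hV : 2 < Module.finrank ℝ (Fin 2 → ℂ) := by
      rw [Module.finrank_pi_fintype]
      simp
    have := simplyConnected_compl_finite hV _ hfin
    rwa [compl_compl] at this
end

section
/- The two-dimensional complex Jacobian conjecture JC(ℂ,2) is equivalent to the following assertion: if f is a Jacobian pair and Ω is a cofinite subset of ℂ² such that f(Ω) = Ω, then the restriction f|_Ω is injective. That is, (every Jacobian pair is bijective with polynomial inverse) if and only if (for every Jacobian pair f and every cofinite Ω ⊆ ℂ² with f(Ω) = Ω, f is injective on Ω). -/
/-- A polynomial map `ℂ² → ℂ²`: every coordinate function is polynomial. -/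
def IsPolyMap (F : (Fin 2 → ℂ) → (Fin 2 → ℂ)) : Prop :=
  ∃ q : Fin 2 → MvPolynomial (Fin 2) ℂ, ∀ x i, F x i = MvPolynomial.eval x (q i)

/-- A Jacobian pair: a polynomial map `ℂ² → ℂ²` whose Jacobian determinant is a nonzero
constant. -/
def IsJacobianPair (F : (Fin 2 → ℂ) → (Fin 2 → ℂ)) : Prop :=
  ∃ q : Fin 2 → MvPolynomial (Fin 2) ℂ,
    (∀ x i, F x i = MvPolynomial.eval x (q i)) ∧
    ∃ c : ℂ, c ≠ 0 ∧ ∀ x : Fin 2 → ℂ,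
      (Matrix.of fun i j => MvPolynomial.eval x (MvPolynomial.pderiv j (q i))).det = c

/-- The two-dimensional complex Jacobian conjecture `JC(ℂ,2)`: every Jacobian pair is
bijective with polynomial inverse. -/
def JC2 : Prop :=
  ∀ F : (Fin 2 → ℂ) → (Fin 2 → ℂ), IsJacobianPair F →
    ∃ G : (Fin 2 → ℂ) → (Fin 2 → ℂ), IsPolyMap G ∧
      Function.LeftInverse G F ∧ Function.RightInverse G F

open TensorProduct MvPolynomial

section alg
variable {σ τ : Type} [Fintype σ] [Fintype τ] [DecidableEq σ] [DecidableEq τ]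

theorem jc_mapBaseChange_bij [Algebra (MvPolynomial σ ℂ) (MvPolynomial τ ℂ)]
    [IsScalarTower ℂ (MvPolynomial σ ℂ) (MvPolynomial τ ℂ)]
    (M : Matrix σ τ (MvPolynomial τ ℂ)) (N : Matrix τ σ (MvPolynomial τ ℂ))
    (hM : ∀ i j, M i j = pderiv j (algebraMap (MvPolynomial σ ℂ) (MvPolynomial τ ℂ) (X i)))
    (hMN : M * N = 1) (hNM : N * M = 1) :
    Function.Bijective
      (KaehlerDifferential.mapBaseChange ℂ (MvPolynomial σ ℂ) (MvPolynomial τ ℂ)) := by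
  let b := (KaehlerDifferential.mvPolynomialBasis ℂ σ).baseChange (MvPolynomial τ ℂ)
  let c := KaehlerDifferential.mvPolynomialBasis ℂ τ
  have hmat : ∀ i, KaehlerDifferential.mapBaseChange ℂ (MvPolynomial σ ℂ) (MvPolynomial τ ℂ) (b i) = ∑ j, M i j • c j := by
    intro i
    simp only [b, Module.Basis.baseChange_apply, KaehlerDifferential.mapBaseChange_tmul,
      KaehlerDifferential.mvPolynomialBasis_apply, KaehlerDifferential.map_D, one_smul]
    rw [← c.sum_repr (KaehlerDifferential.D ℂ (MvPolynomial τ ℂ) (algebraMap (MvPolynomial σ ℂ) (MvPolynomial τ ℂ) (X i)))]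
    refine Finset.sum_congr rfl fun j _ => ?_
    rw [KaehlerDifferential.mvPolynomialBasis_repr_apply, hM]
  let g : Ω[(MvPolynomial τ ℂ)⁄ℂ] →ₗ[(MvPolynomial τ ℂ)] (MvPolynomial τ ℂ) ⊗[(MvPolynomial σ ℂ)] Ω[(MvPolynomial σ ℂ)⁄ℂ] := c.constr (MvPolynomial τ ℂ) (fun j => ∑ i, N j i • b i)
  have h1 : g ∘ₗ KaehlerDifferential.mapBaseChange ℂ (MvPolynomial σ ℂ) (MvPolynomial τ ℂ) = LinearMap.id := by
    refine b.ext fun i => ?_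
    simp only [LinearMap.comp_apply, hmat, map_sum, map_smul, g, Module.Basis.constr_basis,
      LinearMap.id_apply, Finset.smul_sum, smul_smul]
    rw [Finset.sum_comm]
    simp only [← Finset.sum_smul, ← Matrix.mul_apply, hMN, Matrix.one_apply, ite_smul, one_smul, zero_smul]
    simp
  have h2 : KaehlerDifferential.mapBaseChange ℂ (MvPolynomial σ ℂ) (MvPolynomial τ ℂ) ∘ₗ g = LinearMap.id := by
    refine c.ext fun i => ?_
    simp only [LinearMap.comp_apply, hmat, map_sum, map_smul, g, Module.Basis.constr_basis,
      LinearMap.id_apply, Finset.smul_sum, smul_smul]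
    rw [Finset.sum_comm]
    simp only [← Finset.sum_smul, ← Matrix.mul_apply, hNM, Matrix.one_apply, ite_smul, one_smul, zero_smul]
    simp
  exact Function.bijective_iff_has_inverse.2 ⟨g, fun x => LinearMap.congr_fun h1 x, fun x => LinearMap.congr_fun h2 x⟩

theorem jc_etale [Algebra (MvPolynomial σ ℂ) (MvPolynomial τ ℂ)]
    [IsScalarTower ℂ (MvPolynomial σ ℂ) (MvPolynomial τ ℂ)]
    (M : Matrix σ τ (MvPolynomial τ ℂ)) (N : Matrix τ σ (MvPolynomial τ ℂ))
    (hM : ∀ i j, M i j = pderiv j (algebraMap (MvPolynomial σ ℂ) (MvPolynomial τ ℂ) (X i)))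
    (hMN : M * N = 1) (hNM : N * M = 1) :
    Algebra.Etale (MvPolynomial σ ℂ) (MvPolynomial τ ℂ) := by
  have hb := jc_mapBaseChange_bij M N hM hMN hNM
  have hft : Algebra.FiniteType (MvPolynomial σ ℂ) (MvPolynomial τ ℂ) := Algebra.FiniteType.of_restrictScalars_finiteType ℂ (MvPolynomial σ ℂ) (MvPolynomial τ ℂ)
  have hfp : Algebra.FinitePresentation (MvPolynomial σ ℂ) (MvPolynomial τ ℂ) := Algebra.FinitePresentation.of_finiteType.1 hft
  have hsub : Subsingleton (Ω[MvPolynomial τ ℂ⁄MvPolynomial σ ℂ]) := by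
    refine subsingleton_of_forall_eq 0 fun x => ?_
    obtain ⟨y, rfl⟩ := KaehlerDifferential.map_surjective ℂ (MvPolynomial σ ℂ) (MvPolynomial τ ℂ) x
    exact (KaehlerDifferential.exact_mapBaseChange_map ℂ (MvPolynomial σ ℂ) (MvPolynomial τ ℂ) y).2 (hb.2 y)
  have hH : Subsingleton (Algebra.H1Cotangent (MvPolynomial σ ℂ) (MvPolynomial τ ℂ)) := by
    refine subsingleton_of_forall_eq 0 fun x => ?_
    have h1 : Algebra.H1Cotangent.δ ℂ (MvPolynomial σ ℂ) (MvPolynomial τ ℂ) x = 0 := by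
      apply hb.1
      rw [map_zero]
      exact (Algebra.H1Cotangent.exact_δ_mapBaseChange ℂ (MvPolynomial σ ℂ) (MvPolynomial τ ℂ) _).2 ⟨x, rfl⟩
    obtain ⟨z, rfl⟩ := (Algebra.H1Cotangent.exact_map_δ ℂ (MvPolynomial σ ℂ) (MvPolynomial τ ℂ) x).1 h1
    have : Subsingleton (Algebra.H1Cotangent ℂ (MvPolynomial τ ℂ)) := Algebra.FormallySmooth.subsingleton_h1Cotangent
    rw [Subsingleton.elim z 0, map_zero]
  have : Algebra.FormallyEtale (MvPolynomial σ ℂ) (MvPolynomial τ ℂ) := ⟨hsub, hH⟩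
  exact {}

/-- maximal ideals of finitely generated algebras are points -/
theorem jc_exists_point {B : Type*} [CommRing B] [Algebra ℂ B] [Algebra.FiniteType ℂ B]
    (I : Ideal B) (hI : I ≠ ⊤) : ∃ ψ : B →ₐ[ℂ] ℂ, ∀ t ∈ I, ψ t = 0 := by
  obtain ⟨m, hm, hIm⟩ := Ideal.exists_le_maximal I hI
  let : Field (B ⧸ m) := Ideal.Quotient.field m
  have : Algebra.FiniteType ℂ (B ⧸ m) := inferInstance
  have hfin : Module.Finite ℂ (B ⧸ m) := finite_of_finite_type_of_isJacobsonRing _ _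
  have hbij : Function.Bijective (algebraMap ℂ (B ⧸ m)) :=
    IsAlgClosed.algebraMap_bijective_of_isIntegral
  let e : ℂ ≃ₐ[ℂ] (B ⧸ m) := AlgEquiv.ofBijective (Algebra.ofId _ _) hbij
  refine ⟨e.symm.toAlgHom.comp (Ideal.Quotient.mkₐ ℂ m), fun t ht => ?_⟩
  have : Ideal.Quotient.mk m t = 0 := Ideal.Quotient.eq_zero_iff_mem.2 (hIm ht)
  simp [this]

theorem jc_epi [Algebra (MvPolynomial σ ℂ) (MvPolynomial τ ℂ)]
    [IsScalarTower ℂ (MvPolynomial σ ℂ) (MvPolynomial τ ℂ)]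
    [Algebra.Etale (MvPolynomial σ ℂ) (MvPolynomial τ ℂ)]
    (hinj : ∀ ψ₁ ψ₂ : MvPolynomial τ ℂ →ₐ[ℂ] ℂ,
      (∀ r : MvPolynomial σ ℂ, ψ₁ (algebraMap _ _ r) = ψ₂ (algebraMap _ _ r)) → ψ₁ = ψ₂)
    (a : MvPolynomial τ ℂ) :
    (1 : MvPolynomial τ ℂ) ⊗ₜ[MvPolynomial σ ℂ] a = a ⊗ₜ[MvPolynomial σ ℂ] 1 := by
  obtain ⟨t, ht1, ht2⟩ := (Algebra.FormallyUnramified.iff_exists_tensorProduct (R := (MvPolynomial σ ℂ)) (S := (MvPolynomial τ ℂ))).1 inferInstance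
  have hu : IsUnit t := by
    by_contra hnu
    have : Algebra.FiniteType ℂ (MvPolynomial τ ℂ ⊗[(MvPolynomial σ ℂ)] (MvPolynomial τ ℂ)) := Algebra.FiniteType.trans (S := (MvPolynomial τ ℂ)) inferInstance inferInstance
    obtain ⟨ψ, hψ⟩ := jc_exists_point (Ideal.span {t}) (by rwa [Ne, Ideal.span_singleton_eq_top])
    have ht : ψ t = 0 := hψ t (Ideal.mem_span_singleton_self t)
    let i1 : (MvPolynomial τ ℂ) →ₐ[ℂ] (MvPolynomial τ ℂ) ⊗[(MvPolynomial σ ℂ)] (MvPolynomial τ ℂ) := (Algebra.TensorProduct.includeLeft (R := (MvPolynomial σ ℂ)) (S := (MvPolynomial σ ℂ)) (A := (MvPolynomial τ ℂ)) (B := (MvPolynomial τ ℂ))).restrictScalars ℂ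
    let i2 : (MvPolynomial τ ℂ) →ₐ[ℂ] (MvPolynomial τ ℂ) ⊗[(MvPolynomial σ ℂ)] (MvPolynomial τ ℂ) := (Algebra.TensorProduct.includeRight (R := (MvPolynomial σ ℂ)) (A := (MvPolynomial τ ℂ)) (B := (MvPolynomial τ ℂ))).restrictScalars ℂ
    have he := hinj (ψ.comp i1) (ψ.comp i2) (fun r => by
      simp only [AlgHom.comp_apply, i1, i2, AlgHom.restrictScalars_apply, AlgHom.commutes])
    have hall : ∀ x : (MvPolynomial τ ℂ) ⊗[(MvPolynomial σ ℂ)] (MvPolynomial τ ℂ), ψ x = ψ (i1 (Algebra.TensorProduct.lmul' (MvPolynomial σ ℂ) x)) := by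
      intro x
      induction x with
      | zero => simp
      | add x y hx hy => simp only [map_add, hx, hy]
      | tmul x y =>
        have h3 : x ⊗ₜ[(MvPolynomial σ ℂ)] y = i1 x * i2 y := by simp [i1, i2]
        have h4 : ψ (i2 y) = ψ (i1 y) := (DFunLike.congr_fun he y).symm
        rw [h3, map_mul, h4, ← map_mul, ← map_mul]
        simp [i1, i2]
    rw [hall, ht2] at ht
    simp at ht
  exact sub_eq_zero.1 (hu.mul_left_eq_zero.1 (ht1 a))

/-- from the epimorphism property, every element is a fraction -/
theorem jc_frac {R A : Type*} [CommRing R] [IsDomain R] [CommRing A] [IsDomain A] [Algebra R A]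
    (hinj : Function.Injective (algebraMap R A)) (a : A)
    (h : (1 : A) ⊗ₜ[R] a = a ⊗ₜ[R] 1) :
    ∃ u v : R, u ≠ 0 ∧ algebraMap R A u * a = algebraMap R A v := by
  by_contra! hno
  let K := FractionRing R
  let L := FractionRing A
  have : FaithfulSMul R A := (faithfulSMul_iff_algebraMap_injective R A).2 hinj
  have : FaithfulSMul R L := FaithfulSMul.trans R A L
  let : Algebra K L := FractionRing.liftAlgebra R L
  have : IsScalarTower R K L := inferInstance
  set x : L := algebraMap A L a
  have hx : x ∉ (Submodule.span K {(1 : L)}) := by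
    intro hx
    obtain ⟨k, hk⟩ := Submodule.mem_span_singleton.1 hx
    obtain ⟨v, u, hu, rfl⟩ := IsFractionRing.div_surjective (A := R) k
    have hu0 : u ≠ 0 := nonZeroDivisors.ne_zero hu
    apply hno u v hu0
    apply IsFractionRing.injective A L
    rw [map_mul]
    change _ * x = _
    rw [← hk, Algebra.smul_def, mul_one, ← IsScalarTower.algebraMap_apply, ← IsScalarTower.algebraMap_apply, map_div₀, ← IsScalarTower.algebraMap_apply, ← IsScalarTower.algebraMap_apply]
    have : algebraMap R L u ≠ 0 := by
      simpa using hu0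
    exact mul_div_cancel₀ _ this
  obtain ⟨φ, hφ2, hφ⟩ := Submodule.exists_le_ker_of_notMem hx
  let φR : L →ₗ[R] K := φ.restrictScalars R
  let B : A →ₗ[R] A →ₗ[R] L := LinearMap.mk₂ R (fun p q => algebraMap K L (φ (algebraMap A L p)) * algebraMap A L q)
    (by intros; simp [add_mul]) 
    (by
      intro c m n
      have : φ (c • algebraMap A L m) = c • φ (algebraMap A L m) := φR.map_smul c _
      rw [show algebraMap A L (c • m) = c • algebraMap A L m from by simp [Algebra.smul_def, ← IsScalarTower.algebraMap_apply], this]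
      rw [show algebraMap K L (c • φ (algebraMap A L m)) = c • algebraMap K L (φ (algebraMap A L m)) from by simp [Algebra.smul_def, ← IsScalarTower.algebraMap_apply]]
      rw [smul_mul_assoc])
    (by intros; simp [mul_add])
    (by
      intro c m n
      rw [show algebraMap A L (c • n) = c • algebraMap A L n from by simp [Algebra.smul_def, ← IsScalarTower.algebraMap_apply], mul_smul_comm])
  have h5 := congrArg (TensorProduct.lift B) h
  simp only [TensorProduct.lift.tmul, B, LinearMap.mk₂_apply, map_one, mul_one] at h5
  have h1 : φ 1 = 0 := hφ (Submodule.mem_span_singleton_self 1)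
  rw [h1, map_zero, zero_mul] at h5
  apply hφ2
  have := (map_eq_zero (algebraMap K L)).1 h5.symm
  simpa using this
end alg

section geom
variable {σ τ : Type} [Fintype σ] [Fintype τ]

theorem jc_eval_algebraMap [Algebra (MvPolynomial σ ℂ) (MvPolynomial τ ℂ)]
    [IsScalarTower ℂ (MvPolynomial σ ℂ) (MvPolynomial τ ℂ)]
    (F : (τ → ℂ) → (σ → ℂ))
    (hF : ∀ x i, F x i = eval x (algebraMap (MvPolynomial σ ℂ) (MvPolynomial τ ℂ) (X i)))
    (x : τ → ℂ) (r : MvPolynomial σ ℂ) :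
    eval x (algebraMap (MvPolynomial σ ℂ) (MvPolynomial τ ℂ) r) = eval (F x) r := by
  have h : ((aeval x : MvPolynomial τ ℂ →ₐ[ℂ] ℂ).comp
      (IsScalarTower.toAlgHom ℂ (MvPolynomial σ ℂ) (MvPolynomial τ ℂ))) = aeval (F x) := by
    ext i
    simp [hF, aeval_eq_eval]
  simpa [aeval_eq_eval] using DFunLike.congr_fun h r

theorem jc_inverse_poly [Algebra (MvPolynomial σ ℂ) (MvPolynomial τ ℂ)]
    [IsScalarTower ℂ (MvPolynomial σ ℂ) (MvPolynomial τ ℂ)]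
    [Algebra.Etale (MvPolynomial σ ℂ) (MvPolynomial τ ℂ)]
    (F : (τ → ℂ) → (σ → ℂ))
    (hF : ∀ x i, F x i = eval x (algebraMap (MvPolynomial σ ℂ) (MvPolynomial τ ℂ) (X i)))
    (hinj : Function.Injective F) (hsurj : Function.Surjective F) (a : MvPolynomial τ ℂ) :
    ∃ g : MvPolynomial σ ℂ, algebraMap (MvPolynomial σ ℂ) (MvPolynomial τ ℂ) g = a := by
  classical
  have hev := jc_eval_algebraMap F hF
  have hai : Function.Injective (algebraMap (MvPolynomial σ ℂ) (MvPolynomial τ ℂ)) := by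
    refine (injective_iff_map_eq_zero _).2 fun r hr => ?_
    refine MvPolynomial.funext fun y => ?_
    obtain ⟨x, rfl⟩ := hsurj y
    rw [← hev, hr, map_zero, map_zero]
  have hepi := jc_epi (σ := σ) (τ := τ) (fun ψ₁ ψ₂ h => by
    have hx : (fun j => ψ₁ (X j)) = fun j => ψ₂ (X j) := by
      apply hinj
      funext i
      have h1 := h (X i)
      rw [show ψ₁ = aeval (fun j => ψ₁ (X j)) from aeval_unique ψ₁,
        show ψ₂ = aeval (fun j => ψ₂ (X j)) from aeval_unique ψ₂] at h1
      rw [hF, hF]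
      simpa [aeval_eq_eval] using h1
    ext j
    exact congrFun hx j) a
  obtain ⟨u, v, hu, huv⟩ := jc_frac hai a hepi
  obtain ⟨u', v', c, hrel, hcu, hcv⟩ := UniqueFactorizationMonoid.exists_reduced_factors u hu v
  have hc : c ≠ 0 := by rintro rfl; simp at hcu; exact hu hcu.symm
  have hu' : u' ≠ 0 := by rintro rfl; simp at hcu; exact hu hcu.symm
  have huv' : algebraMap (MvPolynomial σ ℂ) (MvPolynomial τ ℂ) u' * a = algebraMap _ _ v' := by
    have : algebraMap (MvPolynomial σ ℂ) (MvPolynomial τ ℂ) c ≠ 0 := by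
      rwa [Ne, map_eq_zero_iff _ hai]
    apply mul_left_cancel₀ this
    rw [← mul_assoc, ← map_mul, ← map_mul, hcu, hcv, huv]
  have hunit : IsUnit u' := by
    by_contra hnu
    obtain ⟨p, hp, hpu⟩ := WfDvdMonoid.exists_irreducible_factor hnu hu'
    have hpp : Prime p := hp.prime
    have : (Ideal.span {p}).IsPrime := (Ideal.span_singleton_prime hpp.ne_zero).2 hpp
    have hv : v' ∈ Ideal.span {p} := by
      rw [← MvPolynomial.IsPrime.vanishingIdeal_zeroLocus (K := ℂ) (Ideal.span {p}),
        mem_vanishingIdeal_iff]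
      intro y hy
      obtain ⟨x, rfl⟩ := hsurj y
      have hpy := hy p (Ideal.mem_span_singleton_self p)
      obtain ⟨w, rfl⟩ := hpu
      have h2 := congrArg (eval x) huv'
      rw [map_mul, hev, hev, map_mul] at h2
      rw [aeval_eq_eval] at hpy ⊢
      change eval (F x) p = 0 at hpy
      change eval (F x) v' = 0
      rw [← h2, hpy]
      simp
    exact hp.not_isUnit (hrel hpu (Ideal.mem_span_singleton.1 hv))
  obtain ⟨w, rfl⟩ := hunit
  refine ⟨↑w⁻¹ * v', ?_⟩
  rw [map_mul, ← huv', ← mul_assoc, ← map_mul]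
  simp

theorem jc_cofinite_image [Algebra (MvPolynomial (Fin 2) ℂ) (MvPolynomial τ ℂ)]
    [IsScalarTower ℂ (MvPolynomial (Fin 2) ℂ) (MvPolynomial τ ℂ)]
    [Algebra.Etale (MvPolynomial (Fin 2) ℂ) (MvPolynomial τ ℂ)]
    (F : (τ → ℂ) → (Fin 2 → ℂ))
    (hF : ∀ x i, F x i = eval x (algebraMap (MvPolynomial (Fin 2) ℂ) (MvPolynomial τ ℂ) (X i))) :
    (Set.range F)ᶜ.Finite := by
  classical
  have hev := jc_eval_algebraMap F hF
  have hflat : Module.Flat (MvPolynomial (Fin 2) ℂ) (MvPolynomial τ ℂ) := Algebra.Smooth.flat _ _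
  have hai : Function.Injective (algebraMap (MvPolynomial (Fin 2) ℂ) (MvPolynomial τ ℂ)) := by
    have : Module.IsTorsionFree (MvPolynomial (Fin 2) ℂ) (MvPolynomial τ ℂ) := inferInstance
    exact FaithfulSMul.algebraMap_injective _ _
  have hopen : IsOpenMap (PrimeSpectrum.comap
      (algebraMap (MvPolynomial (Fin 2) ℂ) (MvPolynomial τ ℂ))) :=
    PrimeSpectrum.isOpenMap_comap_of_hasGoingDown_of_finitePresentation
  obtain ⟨I, hI⟩ := (PrimeSpectrum.isClosed_iff_zeroLocus_ideal _).1 hopen.isOpen_range.isClosed_compl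
  have hZ : ∀ P : PrimeSpectrum (MvPolynomial (Fin 2) ℂ), I ≤ P.asIdeal ↔
      P ∉ Set.range (PrimeSpectrum.comap
      (algebraMap (MvPolynomial (Fin 2) ℂ) (MvPolynomial τ ℂ))) := by
    intro P
    rw [← Set.mem_compl_iff, hI]
    rfl
  have hker : ∀ x : Fin 2 → ℂ, (RingHom.ker (eval x)).IsPrime := fun x => RingHom.ker_isPrime _
  have hkerτ : ∀ x : τ → ℂ, (RingHom.ker (eval x)).IsPrime := fun x => RingHom.ker_isPrime _
  have hcomap : ∀ x : τ → ℂ, PrimeSpectrum.comap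
      (algebraMap (MvPolynomial (Fin 2) ℂ) (MvPolynomial τ ℂ)) ⟨_, hkerτ x⟩ = ⟨_, hker (F x)⟩ := by
    intro x
    ext r
    simp [RingHom.mem_ker, hev]
  have hirr : ∀ h : MvPolynomial (Fin 2) ℂ, Prime h → ¬ I ≤ Ideal.span {h} := by
    intro h hp hle
    have hnz : IsUnit (algebraMap (MvPolynomial (Fin 2) ℂ) (MvPolynomial τ ℂ) h) := by
      by_contra hnu
      obtain ⟨ψ, hψ⟩ := jc_exists_point
        (Ideal.span {algebraMap (MvPolynomial (Fin 2) ℂ) (MvPolynomial τ ℂ) h})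
        (by rwa [Ne, Ideal.span_singleton_eq_top])
      have h1 := hψ _ (Ideal.mem_span_singleton_self _)
      rw [show ψ = aeval (fun j => ψ (X j)) from aeval_unique ψ] at h1
      rw [aeval_eq_eval] at h1
      have h2 : eval (fun j => ψ (X j))
        (algebraMap (MvPolynomial (Fin 2) ℂ) (MvPolynomial τ ℂ) h) = 0 := h1
      rw [hev] at h2
      refine (hZ ⟨_, hker _⟩).1 (hle.trans ?_) ⟨_, hcomap (fun j => ψ (X j))⟩
      rw [Ideal.span_singleton_le_iff_mem]
      exact h2
    obtain ⟨c, hc, hce⟩ := MvPolynomial.isUnit_iff_eq_C_of_isReduced.1 hnz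
    have h3 : h = C c := by
      apply hai
      rw [hce, ← MvPolynomial.algebraMap_eq, ← MvPolynomial.algebraMap_eq,
        ← IsScalarTower.algebraMap_apply]
    exact hp.not_isUnit (h3 ▸ hc.map C)
  have hmax : ∀ P : Ideal (MvPolynomial (Fin 2) ℂ), P.IsPrime → I ≤ P → P.IsMaximal := by
    intro P hP hIP
    have hbot : P ≠ ⊥ := by
      rintro rfl
      refine (hZ ⟨⊥, hP⟩).1 hIP ⟨⟨⊥, Ideal.isPrime_bot⟩, ?_⟩
      ext r
      simp
    obtain ⟨h, hhP, hh⟩ := hP.exists_mem_prime_of_ne_bot hbot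
    have hspan : (Ideal.span {h}).IsPrime := (Ideal.span_singleton_prime hh.ne_zero).2 hh
    have hlt1 : (⊥ : Ideal (MvPolynomial (Fin 2) ℂ)) < Ideal.span {h} := by
      rw [bot_lt_iff_ne_bot, Ne, Ideal.span_singleton_eq_bot]
      exact hh.ne_zero
    have hlt2 : Ideal.span {h} < P := by
      refine lt_of_le_of_ne ((Ideal.span_singleton_le_iff_mem _).2 hhP) ?_
      rintro rfl
      exact hirr h hh hIP
    obtain ⟨m, hm, hPm⟩ := Ideal.exists_le_maximal P hP.ne_top
    rcases hPm.eq_or_lt with rfl | hlt3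
    · exact hm
    exfalso
    have e1 := Ideal.height_add_one_le_of_lt_of_isPrime hlt1
    have e2 := Ideal.height_add_one_le_of_lt_of_isPrime hlt2
    have e3 := Ideal.height_add_one_le_of_lt_of_isPrime hlt3
    have e4 := Ideal.height_le_ringKrullDim_of_ne_top (I := m) hm.ne_top
    rw [MvPolynomial.ringKrullDim_of_isNoetherianRing, ringKrullDim_eq_zero_of_field] at e4
    have e5 : m.height ≤ 2 := by
      simp at e4
      exact WithBot.coe_le_coe.1 (show ((m.height : ℕ∞) : WithBot ℕ∞) ≤ ((2 : ℕ∞) : WithBot ℕ∞) from e4)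
    have e6 : (3 : ℕ∞) ≤ m.height := by
      calc (3 : ℕ∞) = 0 + 1 + 1 + 1 := by norm_num
        _ ≤ _ := by
          refine le_trans ?_ e3
          gcongr
          refine le_trans ?_ e2
          gcongr
          refine le_trans ?_ e1
          gcongr
          exact zero_le
    have := e6.trans e5
    norm_num at this
  have hfin := Ideal.finite_minimalPrimes_of_isNoetherianRing _ I
  refine Set.Finite.of_finite_image (f := fun y => RingHom.ker (eval y)) (hfin.subset ?_) ?_
  · rintro _ ⟨y, hy, rfl⟩
    have hIy : I ≤ RingHom.ker (eval y) := by
      refine (hZ ⟨_, hker y⟩).2 ?_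
      rintro ⟨Q, hQ⟩
      obtain ⟨ψ, hψ⟩ := jc_exists_point Q.asIdeal Q.isPrime.ne_top
      apply hy
      refine ⟨fun j => ψ (X j), ?_⟩
      funext i
      have h1 : (X i - C (y i)) ∈ RingHom.ker (eval y) := by simp [RingHom.mem_ker]
      have h2 : algebraMap (MvPolynomial (Fin 2) ℂ) (MvPolynomial τ ℂ) (X i - C (y i)) ∈ Q.asIdeal := by
        have h3 := congrArg PrimeSpectrum.asIdeal hQ
        simp only at h3
        rw [← h3] at h1
        exact h1
      have h4 := hψ _ h2
      rw [show ψ = aeval (fun j => ψ (X j)) from aeval_unique ψ, aeval_eq_eval] at h4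
      have h5 : eval (fun j => ψ (X j))
        (algebraMap (MvPolynomial (Fin 2) ℂ) (MvPolynomial τ ℂ) (X i - C (y i))) = 0 := h4
      rw [hev] at h5
      simpa [sub_eq_zero] using h5
    have := hker y
    obtain ⟨P, hP, hPy⟩ := Ideal.exists_minimalPrimes_le hIy
    have hPm := hmax P hP.1.1 hP.1.2
    have : P = RingHom.ker (eval y) := hPm.eq_of_le (hker y).ne_top hPy
    change RingHom.ker (eval y) ∈ I.minimalPrimes
    rwa [← this]
  · intro y _ z _ hyz
    funext i
    have h1 : (X i - C (y i)) ∈ RingHom.ker (eval y) := by simp [RingHom.mem_ker]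
    simp only at hyz
    rw [hyz, RingHom.mem_ker] at h1
    simp [sub_eq_zero] at h1
    exact h1.symm

end geom

section main

theorem jc_alg {τ : Type} [Fintype τ] [DecidableEq τ] (q : Fin 2 → MvPolynomial τ ℂ)
    (M : Matrix (Fin 2) τ (MvPolynomial τ ℂ)) (N : Matrix τ (Fin 2) (MvPolynomial τ ℂ))
    (hM : ∀ i j, M i j = pderiv j (q i)) (hMN : M * N = 1) (hNM : N * M = 1)
    (F : (τ → ℂ) → (Fin 2 → ℂ)) (hF : ∀ x i, F x i = eval x (q i)) :
    (Set.range F)ᶜ.Finite ∧ (Function.Injective F → Function.Surjective F →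
      ∀ j, ∃ g : MvPolynomial (Fin 2) ℂ, aeval q g = X j) := by
  let : Algebra (MvPolynomial (Fin 2) ℂ) (MvPolynomial τ ℂ) := (aeval q).toRingHom.toAlgebra
  have hal : ∀ r, algebraMap (MvPolynomial (Fin 2) ℂ) (MvPolynomial τ ℂ) r = aeval q r :=
    fun _ => rfl
  have : IsScalarTower ℂ (MvPolynomial (Fin 2) ℂ) (MvPolynomial τ ℂ) :=
    IsScalarTower.of_algebraMap_eq fun z => by rw [hal, AlgHom.commutes]
  have : Algebra.Etale (MvPolynomial (Fin 2) ℂ) (MvPolynomial τ ℂ) :=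
    jc_etale M N (fun i j => by rw [hM, hal, aeval_X]) hMN hNM
  have hF' : ∀ x i, F x i = eval x (algebraMap (MvPolynomial (Fin 2) ℂ) (MvPolynomial τ ℂ) (X i)) :=
    fun x i => by rw [hF, hal, aeval_X]
  exact ⟨jc_cofinite_image F hF', fun h1 h2 j => jc_inverse_poly F hF' h1 h2 (X j)⟩

theorem jc_matrix {F : (Fin 2 → ℂ) → (Fin 2 → ℂ)} (h : IsJacobianPair F) :
    ∃ q : Fin 2 → MvPolynomial (Fin 2) ℂ, (∀ x i, F x i = eval x (q i)) ∧
      ∃ N : Matrix (Fin 2) (Fin 2) (MvPolynomial (Fin 2) ℂ),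
        (Matrix.of fun i j => pderiv j (q i)) * N = 1 ∧
        N * (Matrix.of fun i j => pderiv j (q i)) = 1 := by
  obtain ⟨q, hq, c, hc, hdet⟩ := h
  refine ⟨q, hq, (Matrix.of fun i j => pderiv j (q i))⁻¹, ?_⟩
  have hd : (Matrix.of fun i j => pderiv j (q i)).det = C c := by
    refine MvPolynomial.funext fun x => ?_
    rw [eval_C, ← hdet x, Matrix.det_fin_two, Matrix.det_fin_two]
    simp
  have hu : IsUnit (Matrix.of fun i j => pderiv j (q i)).det := by
    rw [hd]
    exact (isUnit_iff_ne_zero.2 hc).map C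
  exact ⟨Matrix.mul_nonsing_inv _ hu, Matrix.nonsing_inv_mul _ hu⟩

theorem jc_eval_aeval (q : Fin 2 → MvPolynomial (Fin 2) ℂ) (x : Fin 2 → ℂ)
    (r : MvPolynomial (Fin 2) ℂ) :
    eval x (aeval q r) = eval (fun i => eval x (q i)) r := by
  induction r using MvPolynomial.induction_on with
  | C a => simp
  | add p r hp hr => simp only [map_add, hp, hr]
  | mul_X p n hp => simp only [map_mul, hp, aeval_X, eval_X]

theorem jc_eval_polynomial_aeval (a : MvPolynomial (Fin 2) ℂ) (x : Fin 2 → ℂ)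
    (p : Polynomial ℂ) :
    eval x (Polynomial.aeval a p) = p.eval (eval x a) := by
  have h := Polynomial.aeval_algHom_apply (aeval x : MvPolynomial (Fin 2) ℂ →ₐ[ℂ] ℂ) a p
  rw [aeval_eq_eval, Polynomial.coe_aeval_eq_eval] at h
  exact h.symm

theorem jc_of_injective {F : (Fin 2 → ℂ) → (Fin 2 → ℂ)} (h : IsJacobianPair F)
    (hinj : Function.Injective F) :
    ∃ G : (Fin 2 → ℂ) → (Fin 2 → ℂ), IsPolyMap G ∧
      Function.LeftInverse G F ∧ Function.RightInverse G F := by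
  obtain ⟨q, hq, N, h1, h2⟩ := jc_matrix h
  have hFq : F = fun x i => eval x (q i) := by
    funext x i
    exact hq x i
  have hsurj : Function.Surjective F := by
    rw [hFq] at hinj ⊢
    exact ax_grothendieck_univ q hinj
  choose g hg using (jc_alg q _ N (fun i j => rfl) h1 h2 F hq).2 hinj hsurj
  have hl : Function.LeftInverse (fun y i => eval y (g i)) F := by
    intro x
    funext j
    have h3 := congrArg (eval x) (hg j)
    rw [eval_X] at h3
    rw [← h3, jc_eval_aeval, hFq]
  refine ⟨fun y i => eval y (g i), ⟨g, fun _ _ => rfl⟩, hl, ?_⟩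
  exact hl.rightInverse_of_surjective hsurj

theorem jc_cofinite {F : (Fin 2 → ℂ) → (Fin 2 → ℂ)} (h : IsJacobianPair F) :
    (Set.range F)ᶜ.Finite := by
  obtain ⟨q, hq, N, h1, h2⟩ := jc_matrix h
  exact (jc_alg q _ N (fun i j => rfl) h1 h2 F hq).1

theorem jc_hasStrictFDerivAt (p : MvPolynomial (Fin 2) ℂ) (x : Fin 2 → ℂ) :
    HasStrictFDerivAt (fun x : Fin 2 → ℂ => eval x p)
      (∑ j, eval x (pderiv j p) • (ContinuousLinearMap.proj j : (Fin 2 → ℂ) →L[ℂ] ℂ)) x := by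
  induction p using MvPolynomial.induction_on with
  | C a =>
    simp only [eval_C]
    refine (hasStrictFDerivAt_const (𝕜 := ℂ) a x).congr_fderiv ?_
    ext v
    simp
  | add p r hp hr =>
    simp only [map_add]
    refine (hp.add hr).congr_fderiv ?_
    rw [← Finset.sum_add_distrib]
    exact Finset.sum_congr rfl fun j _ => (add_smul _ _ _).symm
  | mul_X p n hp =>
    have hX : HasStrictFDerivAt (fun x : Fin 2 → ℂ => x n)
      (ContinuousLinearMap.proj n : (Fin 2 → ℂ) →L[ℂ] ℂ) x :=
      (ContinuousLinearMap.proj n : (Fin 2 → ℂ) →L[ℂ] ℂ).hasStrictFDerivAt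
    have hm := hp.mul hX
    simp only [map_mul, eval_X]
    refine hm.congr_fderiv ?_
    ext v
    fin_cases n <;> simp [Fin.sum_univ_two, pderiv_X, Pi.single_apply] <;> ring

theorem jc_map_nhds {F : (Fin 2 → ℂ) → (Fin 2 → ℂ)} (h : IsJacobianPair F) (x : Fin 2 → ℂ) :
    Filter.map F (nhds x) = nhds (F x) := by
  obtain ⟨q, hq, N, h1, h2⟩ := jc_matrix h
  have hFq : F = fun x i => eval x (q i) := by
    funext x i
    exact hq x i
  let L : (Fin 2 → ℂ) →L[ℂ] (Fin 2 → ℂ) := ContinuousLinearMap.pi fun i =>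
    ∑ j, eval x (pderiv j (q i)) • (ContinuousLinearMap.proj j : (Fin 2 → ℂ) →L[ℂ] ℂ)
  have hL : HasStrictFDerivAt F L x := by
    rw [hFq]
    exact hasStrictFDerivAt_pi.2 fun i => jc_hasStrictFDerivAt (q i) x
  refine hL.map_nhds_eq_of_surj ?_
  rw [LinearMap.range_eq_top]
  intro v
  have h3 := congrArg (fun T => T.map (eval x)) h1
  simp only [Matrix.map_mul] at h3
  refine ⟨(N.map (eval x)).mulVec v, ?_⟩
  have h4 : L ((N.map (eval x)).mulVec v) =
      ((Matrix.of fun i j => pderiv j (q i)).map (eval x)).mulVec ((N.map (eval x)).mulVec v) := by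
    funext i
    simp [L, Matrix.mulVec, dotProduct]
  change L _ = v
  rw [h4, Matrix.mulVec_mulVec, h3]
  simp

/-- shears -/
def jcShear0 (p : Polynomial ℂ) (x : Fin 2 → ℂ) : Fin 2 → ℂ := ![x 0 + p.eval (x 1), x 1]
def jcShear1 (p : Polynomial ℂ) (x : Fin 2 → ℂ) : Fin 2 → ℂ := ![x 0, x 1 + p.eval (x 0)]

theorem jcShear0_bij (p : Polynomial ℂ) : Function.Bijective (jcShear0 p) := by
  refine Function.bijective_iff_has_inverse.2 ⟨jcShear0 (-p), fun x => ?_, fun x => ?_⟩ <;>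
  · funext i
    fin_cases i <;> simp [jcShear0]

theorem jcShear1_bij (p : Polynomial ℂ) : Function.Bijective (jcShear1 p) := by
  refine Function.bijective_iff_has_inverse.2 ⟨jcShear1 (-p), fun x => ?_, fun x => ?_⟩ <;>
  · funext i
    fin_cases i <;> simp [jcShear1]

theorem jcShear0_pair (p : Polynomial ℂ) {F : (Fin 2 → ℂ) → (Fin 2 → ℂ)} (h : IsJacobianPair F) :
    IsJacobianPair (jcShear0 p ∘ F) := by
  obtain ⟨q, hq, c, hc, hdet⟩ := h
  refine ⟨![q 0 + Polynomial.aeval (q 1) p, q 1], ?_, c, hc, fun x => ?_⟩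
  · intro x i
    fin_cases i
    · simp [jcShear0, hq, jc_eval_polynomial_aeval]
    · simp [jcShear0, hq]
  · rw [← hdet x, Matrix.det_fin_two, Matrix.det_fin_two]
    simp [Derivation.map_aeval]
    ring

theorem jcShear1_pair (p : Polynomial ℂ) {F : (Fin 2 → ℂ) → (Fin 2 → ℂ)} (h : IsJacobianPair F) :
    IsJacobianPair (jcShear1 p ∘ F) := by
  obtain ⟨q, hq, c, hc, hdet⟩ := h
  refine ⟨![q 0, q 1 + Polynomial.aeval (q 0) p], ?_, c, hc, fun x => ?_⟩
  · intro x i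
    fin_cases i
    · simp [jcShear1, hq]
    · simp [jcShear1, hq, jc_eval_polynomial_aeval]
  · rw [← hdet x, Matrix.det_fin_two, Matrix.det_fin_two]
    simp [Derivation.map_aeval]
    ring

/-- Automorphism moving a finite set. -/
theorem jc_move (S : Finset (Fin 2 → ℂ)) (t : (Fin 2 → ℂ) → (Fin 2 → ℂ))
    (ht : Set.InjOn (fun s => t s 1) S) :
    ∃ A : (Fin 2 → ℂ) → (Fin 2 → ℂ), Function.Bijective A ∧ (∀ s ∈ S, A s = t s) ∧
      ∀ F, IsJacobianPair F → IsJacobianPair (A ∘ F) := by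
  classical
  -- a direction separating the points of `S`
  obtain ⟨c, hc⟩ : ∃ c : ℂ, Set.InjOn (fun s : Fin 2 → ℂ => s 0 + c * s 1) S := by
    have hfin : (Set.image (fun z : (Fin 2 → ℂ) × (Fin 2 → ℂ) =>
        -(z.1 0 - z.2 0) / (z.1 1 - z.2 1)) (S ×ˢ S : Finset _)).Finite :=
      (Finset.finite_toSet _).image _
    obtain ⟨c, hc⟩ := hfin.infinite_compl.nonempty
    refine ⟨c, fun a ha b hb hab => ?_⟩
    simp only at hab
    by_contra hne
    by_cases h1 : a 1 = b 1
    · apply hne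
      funext i
      fin_cases i
      · rw [h1] at hab
        simpa using hab
      · exact h1
    · apply hc
      refine ⟨(a, b), by simpa using ⟨ha, hb⟩, ?_⟩
      have : a 1 - b 1 ≠ 0 := sub_ne_zero.2 h1
      simp only
      rw [div_eq_iff this]
      linear_combination -hab
  let p₀ : Polynomial ℂ := Polynomial.C c * Polynomial.X
  let f : (Fin 2 → ℂ) → ℂ := fun s => s 0 + c * s 1
  let p₁ : Polynomial ℂ := Lagrange.interpolate S f (fun s => t s 1 - s 1)
  let p₂ : Polynomial ℂ := Lagrange.interpolate S (fun s => t s 1) (fun s => t s 0 - f s)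
  refine ⟨jcShear0 p₂ ∘ jcShear1 p₁ ∘ jcShear0 p₀,
    (jcShear0_bij _).comp ((jcShear1_bij _).comp (jcShear0_bij _)), ?_, ?_⟩
  · intro s hs
    have e1 : p₁.eval (f s) = t s 1 - s 1 := Lagrange.eval_interpolate_at_node _ hc hs
    have e2 : p₂.eval (t s 1) = t s 0 - f s := Lagrange.eval_interpolate_at_node _ ht hs
    have s0 : jcShear0 p₀ s = ![f s, s 1] := by simp [jcShear0, p₀, f]
    have s1 : jcShear1 p₁ ![f s, s 1] = ![f s, t s 1] := by simp [jcShear1, e1]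
    have s2 : jcShear0 p₂ ![f s, t s 1] = ![t s 0, t s 1] := by simp [jcShear0, e2]
    simp only [Function.comp_apply, s0, s1, s2]
    funext i
    fin_cases i <;> rfl
  · intro F hF
    exact jcShear0_pair _ (jcShear1_pair _ (jcShear0_pair _ hF))

theorem jc_injective
    (H : ∀ F : (Fin 2 → ℂ) → (Fin 2 → ℂ), IsJacobianPair F →
        ∀ Ω : Set (Fin 2 → ℂ), Ωᶜ.Finite → F '' Ω = Ω → Set.InjOn F Ω)
    {F : (Fin 2 → ℂ) → (Fin 2 → ℂ)} (hF : IsJacobianPair F) : Function.Injective F := by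
  classical
  by_contra hninj
  obtain ⟨a, b, hab, hne⟩ : ∃ a b, F a = F b ∧ a ≠ b := by
    simpa [Function.Injective] using hninj
  obtain ⟨U, V, hU, hV, haU, hbV, hUV⟩ := t2_separation hne
  have hFV : F '' V ∈ nhds (F a) := by
    rw [hab, ← jc_map_nhds hF b]
    exact Filter.image_mem_map (hV.mem_nhds hbV)
  have hU' : U ∩ F ⁻¹' (F '' V) ∈ nhds a := by
    refine Filter.inter_mem (hU.mem_nhds haU) ?_
    have : Filter.Tendsto F (nhds a) (nhds (F a)) := (jc_map_nhds hF a).le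
    exact this hFV
  let ℓ : ℂ → (Fin 2 → ℂ) := fun z => ![a 0, z]
  have hℓ : Continuous ℓ := by
    refine continuous_pi fun i => ?_
    fin_cases i
    · exact continuous_const
    · exact continuous_id
  have hℓa : ℓ (a 1) = a := by
    funext i
    fin_cases i <;> rfl
  have hW : ℓ ⁻¹' (U ∩ F ⁻¹' (F '' V)) ∈ nhds (a 1) := by
    apply hℓ.continuousAt
    rwa [hℓa]
  set W := ℓ ⁻¹' (U ∩ F ⁻¹' (F '' V))
  have hWinf : W.Infinite := infinite_of_mem_nhds (a 1) hW
  have hSfin := jc_cofinite hF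
  let S := hSfin.toFinset
  -- an injection from `S` to `W`
  obtain ⟨D, hDW, hDcard⟩ := hWinf.exists_subset_card_eq S.card
  let e : S ≃ D := Finset.equivOfCardEq hDcard.symm
  let t : (Fin 2 → ℂ) → (Fin 2 → ℂ) := fun s => if hs : s ∈ S then ℓ (e ⟨s, hs⟩) else 0
  have htS : ∀ s (hs : s ∈ S), t s = ℓ (e ⟨s, hs⟩) := fun s hs => by simp [t, hs]
  have htinj : Set.InjOn (fun s => t s 1) S := by
    intro s hs s' hs' hss
    have h1 : s ∈ S := hs
    have h2 : s' ∈ S := hs'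
    simp only [htS s h1, htS s' h2] at hss
    have h3 : (e ⟨s, h1⟩ : ℂ) = e ⟨s', h2⟩ := hss
    have h4 := e.injective (Subtype.ext h3)
    exact congrArg Subtype.val h4
  obtain ⟨A, hA, hAt, hAF⟩ := jc_move S t htinj
  let T : Set (Fin 2 → ℂ) := ℓ '' (D : Set ℂ)
  have hTfin : T.Finite := D.finite_toSet.image _
  have hAS : A '' (S : Set (Fin 2 → ℂ)) = T := by
    ext z
    constructor
    · rintro ⟨s, hs, rfl⟩
      have hs' : s ∈ S := hs
      rw [hAt s hs', htS s hs']
      exact ⟨_, (e ⟨s, hs'⟩).2, rfl⟩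
    · rintro ⟨w, hw, rfl⟩
      refine ⟨e.symm ⟨w, hw⟩, (e.symm ⟨w, hw⟩).2, ?_⟩
      rw [hAt _ (e.symm ⟨w, hw⟩).2, htS _ (e.symm ⟨w, hw⟩).2]
      simp
  have hTU : T ⊆ U ∩ F ⁻¹' (F '' V) := by
    rintro _ ⟨w, hw, rfl⟩
    exact hDW hw
  have hVT : ∀ v ∈ V, v ∉ T := fun v hv hvT =>
    Set.disjoint_left.1 hUV (hTU hvT).1 hv
  have hFT : F '' Tᶜ = (S : Set (Fin 2 → ℂ))ᶜ := by
    ext y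
    constructor
    · rintro ⟨x, _, rfl⟩
      simp [S]
    · intro hy
      have : ∃ x, F x = y := by simpa [S] using hy
      obtain ⟨x, rfl⟩ := this
      by_cases hx : x ∈ T
      · obtain ⟨v, hv, hvx⟩ := (hTU hx).2
        exact ⟨v, hVT v hv, hvx⟩
      · exact ⟨x, hx, rfl⟩
  have hinv : (A ∘ F) '' Tᶜ = Tᶜ := by
    rw [Set.image_comp, hFT, Set.image_compl_eq hA, hAS]
  have hI := H (A ∘ F) (hAF F hF) Tᶜ (by rwa [compl_compl]) hinv
  obtain ⟨w, hwW, hwD⟩ := hWinf.exists_notMem_finset D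
  obtain ⟨hwU, v, hv, hvw⟩ := hwW
  have hwT : ℓ w ∉ T := by
    rintro ⟨w', hw', hww⟩
    have : w' = w := congrFun hww 1
    exact hwD (this ▸ hw')
  have heq : v = ℓ w := hI (hVT v hv) hwT (congrArg A hvw)
  exact Set.disjoint_left.1 hUV hwU (heq ▸ hv)

end main

/-- `JC(ℂ,2)` holds iff every Jacobian pair is injective on every cofinite
subset `Ω ⊆ ℂ²` with `f(Ω) = Ω`. -/
theorem jc2_iff_injective_on_invariant_cofinite :
    JC2 ↔
      ∀ F : (Fin 2 → ℂ) → (Fin 2 → ℂ), IsJacobianPair F →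
        ∀ Ω : Set (Fin 2 → ℂ), Ωᶜ.Finite → F '' Ω = Ω → Set.InjOn F Ω := by
  constructor
  · intro h F hF Ω _ _
    obtain ⟨G, _, hl, _⟩ := h F hF
    exact hl.injective.injOn
  · intro H F hF
    exact jc_of_injective hF (jc_injective H hF)
end

section
/- The two-dimensional complex Jacobian conjecture JC(ℂ,2) is true if, and only if, every surjective étale endomorphism of a cofinite subset of ℂ² is injective. Precisely: (every Jacobian pair is bijective with polynomial inverse) if and only if (for every cofinite subset Ω ⊆ ℂ² and every map f : Ω → Ω that is the restriction of a polynomial map F : ℂ² → ℂ² whose Jacobian determinant is nonzero at every point of Ω, if f(Ω) = Ω then f is injective). -/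
/-- An étale endomorphism of a cofinite subset `Ω ⊆ ℂ²`: the restriction to `Ω` of a
polynomial map `ℂ² → ℂ²` mapping `Ω` into `Ω` whose Jacobian determinant is nonzero at
every point of `Ω`. -/
def IsEtaleEndo (Ω : Set (Fin 2 → ℂ)) (F : (Fin 2 → ℂ) → (Fin 2 → ℂ)) : Prop :=
  Set.MapsTo F Ω Ω ∧
  ∃ q : Fin 2 → MvPolynomial (Fin 2) ℂ,
    (∀ x i, F x i = MvPolynomial.eval x (q i)) ∧
    ∀ x ∈ Ω,
      (Matrix.of fun i j => MvPolynomial.eval x (MvPolynomial.pderiv j (q i))).det ≠ 0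

open MvPolynomial

/-- The coordinate ring of the plane. -/
abbrev P2 := MvPolynomial (Fin 2) ℂ

/-- The coordinate ring of the source plane, seen as an algebra over the target ring via `q`. -/
def SrcRing (_q : Fin 2 → P2) : Type := P2

namespace SrcRing
variable (q : Fin 2 → P2)
noncomputable instance : CommRing (SrcRing q) := inferInstanceAs (CommRing P2)
noncomputable instance : Algebra ℂ (SrcRing q) := inferInstanceAs (Algebra ℂ P2)
instance : IsDomain (SrcRing q) := inferInstanceAs (IsDomain P2)
instance : Algebra.FiniteType ℂ (SrcRing q) := inferInstanceAs (Algebra.FiniteType ℂ P2)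
noncomputable instance : Algebra P2 (SrcRing q) :=
  RingHom.toAlgebra (S := SrcRing q) ((aeval q : P2 →ₐ[ℂ] P2).toRingHom)
theorem algebraMap_eq (p : P2) : algebraMap P2 (SrcRing q) p = (aeval q p : P2) := rfl
instance : IsScalarTower ℂ P2 (SrcRing q) := IsScalarTower.of_algebraMap_eq fun x => by
  rw [algebraMap_eq]; exact (AlgHom.commutes (aeval q : P2 →ₐ[ℂ] P2) x).symm
end SrcRing

theorem taylor_sq_zero {B : Type*} [CommRing B] [Algebra ℂ B] (I : Ideal B) (hI : I ^ 2 = ⊥)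
    (b d : Fin 2 → B) (hd : ∀ i, d i ∈ I) (p : P2) :
    aeval (b + d) p = aeval b p + ∑ j, aeval b (pderiv j p) * d j := by
  have hdd : ∀ i j, d i * d j = 0 := fun i j => by
    have : d i * d j ∈ I ^ 2 := by rw [sq]; exact Ideal.mul_mem_mul (hd i) (hd j)
    rwa [hI] at this
  induction p using MvPolynomial.induction_on with
  | C a => simp
  | add p r hp hr => simp only [map_add, hp, hr, Fin.sum_univ_two]; ring
  | mul_X p i hp =>
    simp only [map_mul, aeval_X, hp, Fin.sum_univ_two, Derivation.leibniz, pderiv_X, smul_eq_mul,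
      map_add, Pi.add_apply]
    have h0 := hdd 0 i
    have h1 := hdd 1 i
    fin_cases i
    · simp at h0 h1 ⊢
      linear_combination (aeval b (pderiv 0 p)) * h0 + (aeval b (pderiv 1 p)) * h1
    · simp at h0 h1 ⊢
      linear_combination (aeval b (pderiv 0 p)) * h0 + (aeval b (pderiv 1 p)) * h1

/-- The Jacobian matrix. -/
noncomputable def jacMat (q : Fin 2 → P2) : Matrix (Fin 2) (Fin 2) P2 :=
  Matrix.of fun i j => pderiv j (q i)

theorem src_etale (q : Fin 2 → P2) (hq : IsUnit (jacMat q).det) :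
    Algebra.Etale P2 (SrcRing q) := by
  have hfe : Algebra.FormallyEtale P2 (SrcRing q) := by
    rw [Algebra.FormallyEtale.iff_comp_bijective]
    intro B _ _ I hI
    let : Algebra ℂ B := ((algebraMap P2 B).comp C).toAlgebra
    have : IsScalarTower ℂ P2 B := IsScalarTower.of_algebraMap_eq fun x => rfl
    have hunit : ∀ b : Fin 2 → B, IsUnit ((jacMat q).map (aeval b : P2 →ₐ[ℂ] B)).det := by
      intro b
      have := hq.map (aeval b : P2 →ₐ[ℂ] B)
      rwa [AlgHom.map_det] at this
    have hT : ∀ b d : Fin 2 → B, (∀ i, d i ∈ I) → ∀ i, aeval (b + d) (q i) =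
        aeval b (q i) + ((jacMat q).map (aeval b : P2 →ₐ[ℂ] B)).mulVec d i := by
      intro b d hd i
      rw [taylor_sq_zero I hI b d hd]
      rfl
    -- a hom out of the source ring
    have hhom : ∀ (A : Type) [CommRing A] [Algebra P2 A] [Algebra ℂ A] [IsScalarTower ℂ P2 A]
        (f : SrcRing q →ₐ[P2] A) (p : P2), f p = aeval (fun i => f (X i : P2)) p := by
      intro A _ _ _ _ f p
      have := MvPolynomial.algHom_ext (A := A) (f := (f.restrictScalars ℂ : P2 →ₐ[ℂ] A)) (g := aeval (fun i => f (X i : P2)))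
        (by intro i; rw [aeval_X]; rfl)
      exact DFunLike.congr_fun this p
    have hX : ∀ (A : Type) [CommRing A] [Algebra P2 A] [Algebra ℂ A] [IsScalarTower ℂ P2 A]
        (f : SrcRing q →ₐ[P2] A) (i : Fin 2),
        aeval (fun i => f (X i : P2)) (q i) = algebraMap P2 A (X i) := by
      intro A _ _ _ _ f i
      rw [← hhom A f, ← f.commutes, SrcRing.algebraMap_eq, aeval_X]
    constructor
    · intro f g hfg
      set b : Fin 2 → B := fun i => f (X i : P2) with hb
      set d : Fin 2 → B := fun i => g (X i : P2) - b i with hd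
      have hdI : ∀ i, d i ∈ I := by
        intro i
        have := DFunLike.congr_fun hfg (X i : P2)
        change Ideal.Quotient.mk I (f (X i : P2)) = Ideal.Quotient.mk I (g (X i : P2)) at this
        exact (Ideal.Quotient.eq).1 this.symm
      have hbd : b + d = fun i => g (X i : P2) := by ext i; simp [d]
      have h0 : ((jacMat q).map (aeval b : P2 →ₐ[ℂ] B)).mulVec d = 0 := by
        ext i
        have := hT b d hdI i
        rw [hbd, hX B g, hX B f] at this
        simpa using this
      have hd0 : d = 0 := by
        have := congrArg (((jacMat q).map (aeval b : P2 →ₐ[ℂ] B))⁻¹.mulVec) h0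
        rwa [Matrix.mulVec_mulVec, Matrix.nonsing_inv_mul _ (hunit b), Matrix.one_mulVec,
          Matrix.mulVec_zero] at this
      ext p
      rw [hhom B f p, hhom B g p, ← hbd, hd0, add_zero]
    · intro g
      let : Algebra ℂ (B ⧸ I) := inferInstance
      have : IsScalarTower ℂ P2 (B ⧸ I) := inferInstance
      choose b hb using fun i : Fin 2 => Ideal.Quotient.mk_surjective (I := I) (g (X i : P2))
      have hbmk : ∀ (c : Fin 2 → B) (p : P2), Ideal.Quotient.mk I (aeval c p) =
          aeval (fun i => Ideal.Quotient.mk I (c i)) p := by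
        intro c p
        have := DFunLike.congr_fun (MvPolynomial.comp_aeval (R := ℂ) c (Ideal.Quotient.mkₐ ℂ I)) p
        exact this
      set e : Fin 2 → B := fun i => algebraMap P2 B (X i) - aeval b (q i) with he
      have heI : ∀ i, e i ∈ I := by
        intro i
        rw [← Ideal.Quotient.eq_zero_iff_mem]
        simp only [e, map_sub, hbmk, hb, hX (B ⧸ I) g]
        exact sub_self _
      set J := (jacMat q).map (aeval b : P2 →ₐ[ℂ] B) with hJ
      set d : Fin 2 → B := J⁻¹.mulVec e with hd
      have hdI : ∀ i, d i ∈ I := by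
        intro i
        change ∑ j, J⁻¹ i j * e j ∈ I
        exact Ideal.sum_mem _ fun j _ => Ideal.mul_mem_left _ _ (heI j)
      have hJd : J.mulVec d = e := by
        rw [hd, Matrix.mulVec_mulVec, Matrix.mul_nonsing_inv _ (hunit b), Matrix.one_mulVec]
      have hsol : ∀ i, aeval (b + d) (q i) = algebraMap P2 B (X i) := by
        intro i
        rw [hT b d hdI i, ← hJ, hJd]; simp [e]
      have hcomm : ∀ r : P2, aeval (b + d) (aeval q r : P2) = algebraMap P2 B r := by
        intro r
        have : ((aeval (b + d) : P2 →ₐ[ℂ] B).comp (aeval q : P2 →ₐ[ℂ] P2)) =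
            IsScalarTower.toAlgHom ℂ P2 B := by
          apply MvPolynomial.algHom_ext
          intro i
          simp [hsol]
        exact DFunLike.congr_fun this r
      let f : SrcRing q →ₐ[P2] B :=
        { toRingHom := ((aeval (b + d) : P2 →ₐ[ℂ] B).toRingHom : P2 →+* B)
          commutes' := hcomm }
      refine ⟨f, ?_⟩
      ext p
      rw [hhom (B ⧸ I) g p]
      change Ideal.Quotient.mk I (aeval (b + d) (p : P2)) = _
      refine (hbmk _ _).trans ?_
      have hfun : (fun i => Ideal.Quotient.mk I ((b + d) i)) = fun i => g (X i : P2) := ?_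
      · rw [hfun]
      ext i
      have : Ideal.Quotient.mk I (d i) = 0 := Ideal.Quotient.eq_zero_iff_mem.2 (hdI i)
      simp only [Pi.add_apply, map_add, this, hb, add_zero]
  have hfp : Algebra.FinitePresentation P2 (SrcRing q) := by
    have : Algebra.FiniteType P2 (SrcRing q) :=
      Algebra.FiniteType.of_restrictScalars_finiteType ℂ P2 (SrcRing q)
    exact Algebra.FinitePresentation.of_finiteType.1 this
  exact {}

theorem exists_point_of_maximal (A : Type) [CommRing A] [Algebra ℂ A] [Algebra.FiniteType ℂ A]
    (M : Ideal A) [M.IsMaximal] : ∃ f : A →ₐ[ℂ] ℂ, ∀ a ∈ M, f a = 0 := by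
  let _ : Field (A ⧸ M) := Ideal.Quotient.field M
  have : Algebra.FiniteType ℂ (A ⧸ M) :=
    Algebra.FiniteType.of_surjective (Ideal.Quotient.mkₐ ℂ M) (Ideal.Quotient.mkₐ_surjective ℂ M)
  have : Module.Finite ℂ (A ⧸ M) := finite_of_finite_type_of_isJacobsonRing ℂ (A ⧸ M)
  have hb : Function.Bijective (algebraMap ℂ (A ⧸ M)) :=
    IsAlgClosed.algebraMap_bijective_of_isIntegral
  let e : ℂ ≃ₐ[ℂ] (A ⧸ M) := AlgEquiv.ofBijective (Algebra.ofId ℂ (A ⧸ M)) hb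
  refine ⟨e.symm.toAlgHom.comp (Ideal.Quotient.mkₐ ℂ M), fun a ha => ?_⟩
  have : Ideal.Quotient.mk M a = 0 := Ideal.Quotient.eq_zero_iff_mem.2 ha
  simp [this]

/-- The map of affine planes attached to `q`. -/
noncomputable def polyMap (q : Fin 2 → P2) (x : Fin 2 → ℂ) : Fin 2 → ℂ := fun i => eval x (q i)

theorem eval_aeval (q : Fin 2 → P2) (x : Fin 2 → ℂ) (p : P2) :
    eval x (aeval q p : P2) = eval (polyMap q x) p := by
  have : (aeval x : P2 →ₐ[ℂ] ℂ).comp (aeval q : P2 →ₐ[ℂ] P2) = aeval (polyMap q x) := by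
    apply MvPolynomial.algHom_ext
    intro i
    simp [polyMap, aeval_eq_eval]
  have := DFunLike.congr_fun this p
  simpa [aeval_eq_eval] using this

theorem src_hom (q : Fin 2 → P2) (f : SrcRing q →ₐ[ℂ] ℂ) :
    ∃ x : Fin 2 → ℂ, ∀ p : P2, f p = eval x p := by
  refine ⟨fun i => f (X i : P2), fun p => ?_⟩
  have : (f : P2 →ₐ[ℂ] ℂ) = aeval (fun i => f (X i : P2)) := by
    apply MvPolynomial.algHom_ext
    intro i
    rw [aeval_X]
    rfl
  have := DFunLike.congr_fun this p
  exact this.trans (congrFun (aeval_eq_eval (fun i => f (X i : P2))) p)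

/-- A point of the plane not in the image gives a maximal ideal not in the image. -/
theorem mem_range_of_comap (q : Fin 2 → P2) (y : Fin 2 → ℂ) (Q : PrimeSpectrum (SrcRing q))
    (hQ : ∀ p : P2, eval y p = 0 → algebraMap P2 (SrcRing q) p ∈ Q.asIdeal) :
    ∃ x, polyMap q x = y := by
  obtain ⟨M, hM, hQM⟩ := Ideal.exists_le_maximal Q.asIdeal Q.2.ne_top
  obtain ⟨f, hf⟩ := exists_point_of_maximal (SrcRing q) M
  obtain ⟨x, hx⟩ := src_hom q f
  refine ⟨x, ?_⟩
  ext i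
  have h1 := hf _ (hQM (hQ (X i - C (y i)) (by simp)))
  rw [SrcRing.algebraMap_eq, hx, eval_aeval] at h1
  simpa [sub_eq_zero] using h1

open TensorProduct in
theorem src_epi (q : Fin 2 → P2) (hq : IsUnit (jacMat q).det)
    (hinj : Function.Injective (polyMap q)) (s : SrcRing q) :
    (1 : SrcRing q) ⊗ₜ[P2] s = s ⊗ₜ[P2] (1 : SrcRing q) := by
  have := src_etale q hq
  obtain ⟨t, ht, ht1⟩ := Algebra.FormallyUnramified.iff_exists_tensorProduct.1
    (inferInstance : Algebra.FormallyUnramified P2 (SrcRing q))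
  have hft : Algebra.FiniteType ℂ (SrcRing q ⊗[P2] SrcRing q) :=
    Algebra.FiniteType.trans (S := SrcRing q) inferInstance inferInstance
  have hu : IsUnit t := by
    by_contra hnu
    obtain ⟨M, hM, htM⟩ := exists_max_ideal_of_mem_nonunits hnu
    obtain ⟨f, hf⟩ := exists_point_of_maximal (SrcRing q ⊗[P2] SrcRing q) M
    let iL : SrcRing q →ₐ[ℂ] SrcRing q ⊗[P2] SrcRing q :=
      (Algebra.TensorProduct.includeLeft : SrcRing q →ₐ[P2] _).restrictScalars ℂ
    let iR : SrcRing q →ₐ[ℂ] SrcRing q ⊗[P2] SrcRing q :=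
      (Algebra.TensorProduct.includeRight : SrcRing q →ₐ[P2] _).restrictScalars ℂ
    obtain ⟨x, hx⟩ := src_hom q (f.comp iL)
    obtain ⟨y, hy⟩ := src_hom q (f.comp iR)
    have hxy : x = y := by
      apply hinj
      ext i
      have h1 := hx (aeval q (X i : P2))
      have h2 := hy (aeval q (X i : P2))
      have h3 : iL (algebraMap P2 (SrcRing q) (X i)) = iR (algebraMap P2 (SrcRing q) (X i)) := by
        change Algebra.TensorProduct.includeLeft (R := P2) (S := P2) _ =
          Algebra.TensorProduct.includeRight _
        rw [AlgHom.commutes, AlgHom.commutes]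
      rw [eval_aeval, eval_X] at h1 h2
      rw [← h1, ← h2]
      exact congrArg f h3
    have hfac : ∀ z : SrcRing q ⊗[P2] SrcRing q,
        f z = f.comp iL (Algebra.TensorProduct.lmul' P2 z) := by
      intro z
      induction z using TensorProduct.induction_on with
      | zero => simp
      | add a b ha hb => rw [map_add, map_add, map_add, ha, hb]
      | tmul a b =>
        rw [Algebra.TensorProduct.lmul'_apply_tmul, map_mul]
        have : f.comp iL b = f.comp iR b := (hx b).trans ((hxy ▸ (hy b).symm))
        rw [this]
        have hab : a ⊗ₜ[P2] b = iL a * iR b := by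
          simp [iL, iR]
        rw [hab, map_mul]; rfl
    have := hf t htM
    rw [hfac, ht1, map_one] at this
    exact one_ne_zero this
  have := ht s
  rw [hu.mul_left_eq_zero] at this
  exact sub_eq_zero.1 this

theorem src_bijective (q : Fin 2 → P2) (hq : IsUnit (jacMat q).det)
    (hinj : Function.Injective (polyMap q)) :
    Function.Bijective (algebraMap P2 (SrcRing q)) := by
  have := src_etale q hq
  have hflat : Module.Flat P2 (SrcRing q) := inferInstance
  have hff : Module.FaithfullyFlat P2 (SrcRing q) := by
    constructor
    intro m hm htop
    obtain ⟨f, hf⟩ := exists_point_of_maximal P2 m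
    obtain ⟨x, hx⟩ := ax_grothendieck_univ q hinj (fun i => f (X i))
    have hfe : f = aeval (polyMap q x) := by
      apply MvPolynomial.algHom_ext
      intro i
      rw [aeval_X]
      exact (congrFun hx i).symm
    let ev : SrcRing q →+* ℂ := (eval x : P2 →+* ℂ)
    have hle : Ideal.map (algebraMap P2 (SrcRing q)) m ≤ RingHom.ker ev := by
      rw [Ideal.map_le_iff_le_comap]
      intro p hp
      rw [Ideal.mem_comap, RingHom.mem_ker]
      change eval x (aeval q p : P2) = 0
      rw [eval_aeval]
      have := hf p hp
      rwa [hfe, aeval_eq_eval] at this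
    have h1 : (1 : SrcRing q) ∈ m • (⊤ : Submodule P2 (SrcRing q)) := by
      rw [htop]; exact Submodule.mem_top
    rw [Ideal.smul_top_eq_map] at h1
    have h2 := hle h1
    rw [RingHom.mem_ker, map_one] at h2
    exact one_ne_zero h2
  refine ⟨FaithfulSMul.algebraMap_injective _ _, fun s => ?_⟩
  have he := Algebra.IsEffective.of_faithfullyFlat P2 (SrcRing q)
  refine (he s).1 ?_
  rw [Algebra.TensorProduct.includeLeftSubRight_apply, src_epi q hq hinj s, sub_self]

theorem exists_inverse (q : Fin 2 → P2) (hq : IsUnit (jacMat q).det)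
    (hinj : Function.Injective (polyMap q)) :
    ∃ r : Fin 2 → P2, Function.LeftInverse (polyMap r) (polyMap q) ∧
      Function.RightInverse (polyMap r) (polyMap q) := by
  choose r hr using fun i : Fin 2 => (src_bijective q hq hinj).2 (X i : P2)
  have hl : Function.LeftInverse (polyMap r) (polyMap q) := by
    intro x
    ext i
    change eval (polyMap q x) (r i) = x i
    rw [← eval_aeval]
    have : (aeval q (r i) : P2) = X i := hr i
    rw [this, eval_X]
  exact ⟨r, hl, hl.rightInverse_of_surjective (ax_grothendieck_univ q hinj)⟩

theorem prime_mem_range (q : Fin 2 → P2) (hq : IsUnit (jacMat q).det)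
    (P : PrimeSpectrum P2) (hP : P ∉ Set.range (PrimeSpectrum.comap (algebraMap P2 (SrcRing q)))) :
    P.asIdeal.IsMaximal := by
  have := src_etale q hq
  have hflat : Module.Flat P2 (SrcRing q) := inferInstance
  have hinj : Function.Injective (algebraMap P2 (SrcRing q)) :=
    FaithfulSMul.algebraMap_injective _ _
  have hopen : IsOpen (Set.range (PrimeSpectrum.comap (algebraMap P2 (SrcRing q)))) :=
    PrimeSpectrum.isOpenMap_comap_of_hasGoingDown_of_finitePresentation.isOpen_range
  by_contra hmax
  have hbot : P.asIdeal ≠ ⊥ := by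
    intro h
    apply hP
    refine ⟨⟨⊥, Ideal.isPrime_bot⟩, ?_⟩
    apply PrimeSpectrum.ext
    rw [h]
    exact (RingHom.injective_iff_ker_eq_bot _).1 hinj
  obtain ⟨h, hhP, hh⟩ := Ideal.IsPrime.exists_mem_prime_of_ne_bot P.2 hbot
  let H : PrimeSpectrum P2 := ⟨Ideal.span {h}, (Ideal.span_singleton_prime hh.ne_zero).2 hh⟩
  have hHP : H ≤ P := (Ideal.span_singleton_le_iff_mem _).2 hhP
  have hHeq : H = P := by
    by_contra hne
    have hlt : H < P := lt_of_le_of_ne hHP hne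
    obtain ⟨m, hm, hPm⟩ := Ideal.exists_le_maximal P.asIdeal P.2.ne_top
    let M : PrimeSpectrum P2 := ⟨m, hm.isPrime⟩
    have hPM : P < M := lt_of_le_of_ne hPm (fun h => hmax (h ▸ hm))
    let B : PrimeSpectrum P2 := ⟨⊥, Ideal.isPrime_bot⟩
    have hBH : B < H := by
      refine lt_of_le_of_ne (show (⊥ : Ideal P2) ≤ _ from bot_le) (fun h => ?_)
      have h1 : (⊥ : Ideal P2) = Ideal.span {_} := congrArg PrimeSpectrum.asIdeal h
      exact hh.ne_zero (Ideal.span_singleton_eq_bot.1 h1.symm)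
    let l : LTSeries (PrimeSpectrum P2) :=
      { length := 3
        toFun := ![B, H, P, M]
        step := by
          intro i
          fin_cases i
          · exact hBH
          · exact hlt
          · exact hPM }
    have h1 := Order.LTSeries.length_le_krullDim l
    have h2 : Order.krullDim (PrimeSpectrum P2) = 2 := by
      have := MvPolynomial.ringKrullDim_of_isNoetherianRing (R := ℂ) (ι := Fin 2)
      rw [ringKrullDim_eq_zero_of_field] at this
      simpa [ringKrullDim] using this
    have h3 : l.length = 3 := rfl
    rw [h2, h3] at h1
    norm_cast at h1
  have hu : IsUnit (algebraMap P2 (SrcRing q) h) := by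
    by_contra hnu
    obtain ⟨M, hM, hhM⟩ := exists_max_ideal_of_mem_nonunits hnu
    have hspec : P ⤳ PrimeSpectrum.comap (algebraMap P2 (SrcRing q)) ⟨M, hM.isPrime⟩ := by
      rw [← PrimeSpectrum.le_iff_specializes, ← hHeq]
      exact (Ideal.span_singleton_le_iff_mem _).2 hhM
    exact hP (hspec.mem_open hopen ⟨_, rfl⟩)
  obtain ⟨c, -, hc⟩ := MvPolynomial.isUnit_iff_eq_C_of_isReduced.1 (show IsUnit (aeval q h : P2) from hu)
  have : h = C c := by
    apply hinj
    rw [SrcRing.algebraMap_eq, SrcRing.algebraMap_eq, hc]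
    simp only [algHom_C]
    rfl
  apply hh.not_isUnit
  rw [this]
  refine (IsUnit.mk0 c ?_).map C
  rintro rfl
  exact hh.ne_zero (by simpa using this)

theorem finite_compl_range (q : Fin 2 → P2) (hq : IsUnit (jacMat q).det) :
    (Set.range (polyMap q))ᶜ.Finite := by
  have := src_etale q hq
  have hflat : Module.Flat P2 (SrcRing q) := inferInstance
  have hopen : IsOpen (Set.range (PrimeSpectrum.comap (algebraMap P2 (SrcRing q)))) :=
    PrimeSpectrum.isOpenMap_comap_of_hasGoingDown_of_finitePresentation.isOpen_range
  obtain ⟨I, hI⟩ := (PrimeSpectrum.isClosed_iff_zeroLocus_ideal _).1 hopen.isClosed_compl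
  have hfin := Ideal.finite_minimalPrimes_of_isNoetherianRing P2 I
  have hpr : ∀ y : Fin 2 → ℂ, (RingHom.ker (eval y : P2 →+* ℂ)).IsPrime := fun y =>
    RingHom.ker_isPrime _
  refine Set.Finite.of_finite_image (f := fun y => RingHom.ker (eval y : P2 →+* ℂ))
    (hfin.subset ?_) ?_
  · rintro _ ⟨y, hy, rfl⟩
    have hmem : (⟨_, hpr y⟩ : PrimeSpectrum P2) ∈ PrimeSpectrum.zeroLocus (I : Set P2) := by
      rw [← hI]
      rintro ⟨Q, hQ⟩
      apply hy
      refine mem_range_of_comap q y Q fun p hp => ?_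
      have h1 : p ∈ (PrimeSpectrum.comap (algebraMap P2 (SrcRing q)) Q).asIdeal := by
        rw [hQ]; exact hp
      exact h1
    have hle : I ≤ RingHom.ker (eval y : P2 →+* ℂ) := hmem
    have := hpr y
    obtain ⟨p, hp, hpy⟩ := Ideal.exists_minimalPrimes_le hle
    have hpZ : (⟨p, hp.1.1⟩ : PrimeSpectrum P2) ∈ PrimeSpectrum.zeroLocus (I : Set P2) := hp.1.2
    rw [← hI] at hpZ
    have hm : p.IsMaximal := prime_mem_range q hq _ hpZ
    have := hm.eq_of_le (hpr y).ne_top hpy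
    change RingHom.ker (eval y : P2 →+* ℂ) ∈ _
    rw [← this]; exact hp
  · intro y _ z _ hyz
    ext i
    have h1 : (X i - C (y i) : P2) ∈ RingHom.ker (eval y : P2 →+* ℂ) := by
      simp [RingHom.mem_ker]
    have h2 : (X i - C (y i) : P2) ∈ RingHom.ker (eval z : P2 →+* ℂ) := by
      have hyz' : RingHom.ker (eval y : P2 →+* ℂ) = RingHom.ker (eval z : P2 →+* ℂ) := hyz
      rwa [← hyz']
    rw [RingHom.mem_ker] at h2
    simp [sub_eq_zero] at h2
    exact h2.symm

theorem hasStrictFDerivAt_eval (p : P2) (x : Fin 2 → ℂ) :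
    HasStrictFDerivAt (fun x : Fin 2 → ℂ => eval x p)
      (∑ j, eval x (pderiv j p) • (ContinuousLinearMap.proj j : (Fin 2 → ℂ) →L[ℂ] ℂ)) x := by
  induction p using MvPolynomial.induction_on with
  | C a =>
    simp only [eval_C]
    refine (hasStrictFDerivAt_const (𝕜 := ℂ) a x).congr_fderiv ?_
    ext v
    simp
  | add p r hp hr =>
    simp only [map_add]
    refine (hp.add hr).congr_fderiv ?_
    ext v
    simp [Fin.sum_univ_two]
    ring
  | mul_X p i hp =>
    have hX : HasStrictFDerivAt (fun x : Fin 2 → ℂ => x i)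
      (ContinuousLinearMap.proj i : (Fin 2 → ℂ) →L[ℂ] ℂ) x := hasStrictFDerivAt_apply i x
    have := hp.mul hX
    simp only [map_mul, eval_X]
    refine this.congr_fderiv ?_
    ext v
    fin_cases i <;> simp [Fin.sum_univ_two, pderiv_X, Pi.single_apply] <;> ring

theorem map_nhds_polyMap (q : Fin 2 → P2) (hq : IsUnit (jacMat q).det) (x : Fin 2 → ℂ) :
    Filter.map (polyMap q) (nhds x) = nhds (polyMap q x) := by
  have hd : HasStrictFDerivAt (polyMap q) (ContinuousLinearMap.pi fun i =>
      ∑ j, eval x (pderiv j (q i)) • (ContinuousLinearMap.proj j : (Fin 2 → ℂ) →L[ℂ] ℂ)) x :=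
    hasStrictFDerivAt_pi.2 fun i => hasStrictFDerivAt_eval (q i) x
  refine hd.map_nhds_eq_of_surj ?_
  rw [LinearMap.range_eq_top]
  intro v
  have hu : IsUnit ((jacMat q).map (eval x)).det := by
    have := hq.map (eval x)
    rwa [RingHom.map_det] at this
  refine ⟨((jacMat q).map (eval x))⁻¹.mulVec v, ?_⟩
  have h1 : ((jacMat q).map (eval x)).mulVec (((jacMat q).map (eval x))⁻¹.mulVec v) = v := by
    rw [Matrix.mulVec_mulVec, Matrix.mul_nonsing_inv _ hu, Matrix.one_mulVec]
  conv_rhs => rw [← h1]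
  ext i
  simp [Matrix.mulVec, dotProduct, jacMat]

theorem continuous_polyMap (q : Fin 2 → P2) : Continuous (polyMap q) :=
  continuous_pi fun i => MvPolynomial.continuous_eval (q i)

/-- A polynomial in two variables with finitely many zeros is a nonzero constant. -/
theorem const_of_finite_zeros (D : P2) (h : {x : Fin 2 → ℂ | eval x D = 0}.Finite) :
    ∃ c : ℂ, c ≠ 0 ∧ D = C c := by
  have hD : D ≠ 0 := by
    rintro rfl
    refine Set.infinite_univ (α := Fin 2 → ℂ) ?_
    simpa using h
  have hdeg : ∀ i : Fin 2, ∀ k : Fin 2, k ≠ i → degreeOf k D = 0 := by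
    intro i k hki
    let g : P2 := ∏ t ∈ h.toFinset, (X i - C (t i))
    have hlin : ∀ a : ℂ, (X i - C a : P2) ≠ 0 := by
      intro a h0
      have := congrArg (eval (fun _ => a + 1)) h0
      simp at this
    have hg0 : g ≠ 0 := Finset.prod_ne_zero_iff.2 fun t _ => hlin _
    have hgd : degreeOf k g = 0 := by
      have : degreeOf k g ≤ ∑ t ∈ h.toFinset, degreeOf k (X i - C (t i) : P2) :=
        degreeOf_prod_le _ _ _
      refine Nat.le_zero.1 (this.trans (le_of_eq (Finset.sum_eq_zero fun t _ => ?_)))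
      have h2 := degreeOf_sub_le k (X i : P2) (C (t i))
      rw [degreeOf_X, if_neg hki, degreeOf_C] at h2
      simpa using h2
    have hmem : g ∈ (Ideal.span {D}).radical := by
      rw [← vanishingIdeal_zeroLocus_eq_radical (K := ℂ), mem_vanishingIdeal_iff]
      intro x hx
      have hx0 : eval x D = 0 := by
        have := hx D (Ideal.mem_span_singleton_self D)
        rwa [aeval_eq_eval] at this
      rw [aeval_eq_eval]
      change eval x g = 0
      rw [map_prod]
      exact Finset.prod_eq_zero (i := x) (by simpa using hx0) (by simp)
    obtain ⟨n, hn⟩ := hmem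
    obtain ⟨r, hr⟩ := Ideal.mem_span_singleton.1 hn
    have hr0 : r ≠ 0 := by
      rintro rfl
      exact pow_ne_zero n hg0 (by simpa using hr)
    have h3 := degreeOf_pow_le k g n
    rw [hr, degreeOf_mul_eq hD hr0, hgd] at h3
    omega
  have hC : D = C (coeff 0 D) := by
    rw [← totalDegree_eq_zero_iff_eq_C, totalDegree_eq_zero_iff]
    intro m hm k
    have h1 : degreeOf k D = 0 := hdeg (1 - k) k (by fin_cases k <;> decide)
    have := (degreeOf_le_iff.1 h1.le) m hm
    omega
  refine ⟨coeff 0 D, fun h0 => hD ?_, hC⟩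
  rw [hC, h0, C_0]

theorem eval_jac (q : Fin 2 → P2) (x : Fin 2 → ℂ) :
    (Matrix.of fun i j => MvPolynomial.eval x (MvPolynomial.pderiv j (q i))).det =
      eval x (jacMat q).det := by
  rw [RingHom.map_det]
  rfl

theorem injective_of_hyp
    (H : ∀ Ω : Set (Fin 2 → ℂ), Ωᶜ.Finite →
        ∀ F : (Fin 2 → ℂ) → (Fin 2 → ℂ), IsEtaleEndo Ω F →
          F '' Ω = Ω → Set.InjOn F Ω)
    (q : Fin 2 → P2) (hq : IsUnit (jacMat q).det) : Function.Injective (polyMap q) := by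
  intro a b hab
  by_contra hne
  have hS := finite_compl_range q hq
  set S := (Set.range (polyMap q))ᶜ with hSdef
  obtain ⟨U0, V, hU0, hV, haU, hbV, hdisj⟩ := t2_separation hne
  have hFV : polyMap q '' V ∈ nhds (polyMap q a) := by
    rw [hab, ← map_nhds_polyMap q hq b]
    exact Filter.image_mem_map (hV.mem_nhds hbV)
  have hU : U0 ∩ polyMap q ⁻¹' (polyMap q '' V) ∈ nhds a :=
    Filter.inter_mem (hU0.mem_nhds haU) ((continuous_polyMap q).continuousAt hFV)
  set U := U0 ∩ polyMap q ⁻¹' (polyMap q '' V) with hUdef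
  obtain ⟨ε, hε0, hε⟩ : ∃ ε : ℂ, ε ≠ 0 ∧ ∀ s ∈ S, a + ε • s ∈ U := by
    have h1 : ∀ᶠ ε : ℂ in nhds 0, ∀ s ∈ S, a + ε • s ∈ U := by
      rw [Filter.eventually_all_finite hS]
      intro s _
      have hc : Continuous fun ε : ℂ => a + ε • s := by fun_prop
      have := hc.tendsto 0
      simp only [zero_smul, add_zero] at this
      exact this hU
    have h2 : ∀ᶠ ε : ℂ in nhdsWithin 0 {0}ᶜ, ∀ s ∈ S, a + ε • s ∈ U :=
      h1.filter_mono nhdsWithin_le_nhds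
    obtain ⟨ε, h3, h4⟩ := (h2.and self_mem_nhdsWithin).exists
    exact ⟨ε, h4, h3⟩
  let A : (Fin 2 → ℂ) → (Fin 2 → ℂ) := fun y => a + ε • y
  have hAinj : Function.Injective A := by
    intro y z hyz
    have : ε • y = ε • z := add_left_cancel hyz
    exact smul_right_injective _ hε0 this
  have hAsurj : Function.Surjective A := by
    intro y
    refine ⟨ε⁻¹ • (y - a), ?_⟩
    simp [A, smul_smul, hε0]
  set T := A '' S with hT
  have hTfin : T.Finite := hS.image A
  have hTU : T ⊆ U := by
    rintro _ ⟨s, hs, rfl⟩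
    exact hε s hs
  have hVT : ∀ x ∈ V, x ∉ T := fun x hx hxT =>
    Set.disjoint_left.1 hdisj (hTU hxT).1 hx
  let G : (Fin 2 → ℂ) → (Fin 2 → ℂ) := fun x => A (polyMap q x)
  have hGT : ∀ x, G x ∉ T := by
    rintro x ⟨s, hs, hsx⟩
    exact hs ⟨x, (hAinj hsx).symm⟩
  have hG : IsEtaleEndo Tᶜ G := by
    refine ⟨fun x _ => hGT x, fun i => C (a i) + C ε * q i, ?_, ?_⟩
    · intro x i
      simp [G, A, polyMap]
    · intro x _
      have h1 := (hq.map (eval x)).ne_zero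
      rw [← eval_jac] at h1
      rw [Matrix.det_fin_two] at h1 ⊢
      simp only [Matrix.of_apply, map_add, pderiv_C, Derivation.leibniz, smul_eq_mul, zero_add,
        mul_zero, add_zero, map_mul, eval_C] at h1 ⊢
      intro h2
      apply h1
      have h3 : ε * ε ≠ 0 := mul_ne_zero hε0 hε0
      apply mul_left_cancel₀ h3
      linear_combination h2
  have himg : G '' Tᶜ = Tᶜ := by
    apply Set.Subset.antisymm
    · rintro _ ⟨x, _, rfl⟩
      exact hGT x
    · intro y hy
      obtain ⟨z, rfl⟩ := hAsurj y
      have hz : z ∈ Set.range (polyMap q) := by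
        by_contra hz
        exact hy ⟨z, hz, rfl⟩
      obtain ⟨x, rfl⟩ := hz
      by_cases hx : x ∈ T
      · obtain ⟨v, hv, hvx⟩ := (hTU hx).2
        exact ⟨v, hVT v hv, congrArg A hvx⟩
      · exact ⟨x, hx, rfl⟩
  have hinj := H Tᶜ (by rwa [compl_compl]) G hG himg
  obtain ⟨p, hpU, hpT⟩ := ((infinite_of_mem_nhds a hU).sdiff hTfin).nonempty
  obtain ⟨v, hv, hvp⟩ := hpU.2
  have := hinj (hVT v hv) hpT (congrArg A hvp)
  exact Set.disjoint_left.1 hdisj hpU.1 (this ▸ hv)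

/-- `JC(ℂ,2)` holds iff every surjective étale endomorphism of a cofinite
subset of `ℂ²` is injective. -/
theorem jc2_iff_surjective_etale_endo_injective :
    JC2 ↔
      ∀ Ω : Set (Fin 2 → ℂ), Ωᶜ.Finite →
        ∀ F : (Fin 2 → ℂ) → (Fin 2 → ℂ), IsEtaleEndo Ω F →
          F '' Ω = Ω → Set.InjOn F Ω := by
  constructor
  · rintro hJ Ω hΩ F ⟨-, q, hFq, hdet⟩ -
    obtain ⟨c, hc, hD⟩ := const_of_finite_zeros (jacMat q).det (hΩ.subset fun x hx hxΩ =>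
      hdet x hxΩ ((eval_jac q x).trans hx))
    obtain ⟨G, -, hG, -⟩ := hJ F ⟨q, hFq, c, hc, fun x => by rw [eval_jac, hD, eval_C]⟩
    exact hG.injective.injOn
  · rintro H F ⟨q, hFq, c, hc, hdet⟩
    have hD : (jacMat q).det = C c := by
      apply MvPolynomial.funext
      intro x
      rw [← eval_jac, hdet, eval_C]
    have hq : IsUnit (jacMat q).det := by
      rw [hD]
      exact (IsUnit.mk0 c hc).map C
    have hF : F = polyMap q := by
      ext x i
      exact hFq x i
    obtain ⟨r, hl, hr⟩ := exists_inverse q hq (injective_of_hyp H q hq)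
    rw [hF]
    exact ⟨polyMap r, ⟨r, fun _ _ => rfl⟩, hl, hr⟩
end

section
/- Let X and Y be closed complex algebraic subsets of ℂ^N and let f : X → Y be a polynomial map that is open with respect to the strong (Euclidean) topology. For n ≥ 0 let A(f,n) = { y ∈ Y : the fiber f^{-1}(y) has at most n elements }. Then each A(f,n) is a closed algebraic subset of ℂ^N (in particular, it is the common zero set in ℂ^N of a family of polynomials, and it is closed in Y). -/
/-- Lifting a point through an integral extension with prescribed value of one element. -/
theorem BF.exists_lift {A B : Type} [CommRing A] [IsDomain A] [IsIntegrallyClosed A]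
    [CommRing B] [IsDomain B] [Algebra A B] [Algebra.IsIntegral A B] [FaithfulSMul A B]
    (φ : A →+* ℂ) (h : B) (r : ℂ) (hr : (minpoly A h).eval₂ φ r = 0) :
    ∃ ψ : B →+* ℂ, (∀ a, ψ (algebraMap A B a) = φ a) ∧ ψ h = r := by
  have : Module.IsTorsionFree A B := .trans_faithfulSMul A B B
  let θ : Polynomial A →+* ℂ := Polynomial.eval₂RingHom φ r
  let ev : Polynomial A →+* B := (Polynomial.aeval h : Polynomial A →ₐ[A] B).toRingHom
  have hev : ev.IsIntegral := by
    have h1 : (ev.comp Polynomial.C).IsIntegral := by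
      have : ev.comp Polynomial.C = algebraMap A B := by
        ext a; simp [ev]
      rw [this]
      exact algebraMap_isIntegral_iff.mpr inferInstance
    exact RingHom.IsIntegral.tower_top _ _ h1
  have hInt : IsIntegral A h := Algebra.IsIntegral.isIntegral h
  have hker : RingHom.ker ev ≤ RingHom.ker θ := by
    intro p hp
    have hp' : Polynomial.aeval h p = 0 := hp
    obtain ⟨q, rfl⟩ := minpoly.isIntegrallyClosed_dvd hInt hp'
    simp [RingHom.mem_ker, θ, Polynomial.eval₂_mul, hr]
  let : Algebra (Polynomial A) B := ev.toAlgebra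
  have : Algebra.IsIntegral (Polynomial A) B := ⟨hev⟩
  have : (RingHom.ker θ).IsPrime := RingHom.ker_isPrime θ
  obtain ⟨Q, hQp, hQ⟩ := Ideal.exists_ideal_over_prime_of_isIntegral_of_isDomain
    (S := B) (RingHom.ker θ) hker
  have : Q.LiesOver (RingHom.ker θ) := ⟨hQ.symm⟩
  let : Algebra (Polynomial A ⧸ RingHom.ker θ) ℂ := (RingHom.kerLift θ).toAlgebra
  have : FaithfulSMul (Polynomial A ⧸ RingHom.ker θ) ℂ :=
    (faithfulSMul_iff_algebraMap_injective _ _).mpr (RingHom.kerLift_injective θ)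
  have : Algebra.IsIntegral (Polynomial A ⧸ RingHom.ker θ) (B ⧸ Q) := inferInstance
  have : FaithfulSMul (Polynomial A ⧸ RingHom.ker θ) (B ⧸ Q) :=
    Ideal.Quotient.instFaithfulSMul Q (RingHom.ker θ)
  have : Module.IsTorsionFree (Polynomial A ⧸ RingHom.ker θ) (B ⧸ Q) :=
    .trans_faithfulSMul _ (B ⧸ Q) _
  have : Module.IsTorsionFree (Polynomial A ⧸ RingHom.ker θ) ℂ :=
    .trans_faithfulSMul _ ℂ _
  have : Algebra.IsAlgebraic (Polynomial A ⧸ RingHom.ker θ) (B ⧸ Q) :=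
    Algebra.IsIntegral.isAlgebraic
  let l : (B ⧸ Q) →ₐ[Polynomial A ⧸ RingHom.ker θ] ℂ := IsAlgClosed.lift
  have key : ∀ p : Polynomial A, l (Ideal.Quotient.mk Q (ev p)) = θ p := by
    intro p
    have := l.commutes (Ideal.Quotient.mk _ p)
    exact this
  refine ⟨l.toRingHom.comp (Ideal.Quotient.mk Q), fun a => ?_, ?_⟩
  · have := key (Polynomial.C a)
    simpa [ev, θ] using this
  · have := key Polynomial.X
    simpa [ev, θ] using this

theorem BF.exists_small_root (p : Polynomial ℂ) (hp : p.Monic) (hd : 0 < p.natDegree) :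
    ∃ r, p.eval r = 0 ∧ ‖r‖ ^ p.natDegree ≤ ‖p.coeff 0‖ := by
  have hs : p.Splits := IsAlgClosed.splits p
  have hcard : p.roots.card = p.natDegree := hs.natDegree_eq_card_roots.symm
  have hc := hs.coeff_zero_eq_prod_roots_of_monic hp
  have hne : p.roots.toFinset.Nonempty := by
    rw [Multiset.toFinset_nonempty]
    intro h0
    rw [h0] at hcard
    simp at hcard
    omega
  obtain ⟨r, hr, hmin⟩ := Finset.exists_min_image p.roots.toFinset (fun z => ‖z‖₊) hne
  refine ⟨r, ?_, ?_⟩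
  · exact Polynomial.isRoot_of_mem_roots (Multiset.mem_toFinset.mp hr)
  · have h1 : ‖p.coeff 0‖₊ = (p.roots.map (fun z => ‖z‖₊)).prod := by
      rw [hc]
      simp only [nnnorm_mul, nnnorm_pow, nnnorm_neg, nnnorm_one, one_pow, one_mul]
      exact map_multiset_prod (nnnormHom : ℂ →*₀ NNReal) _
    have h2 : ‖r‖₊ ^ p.natDegree ≤ ‖p.coeff 0‖₊ := by
      rw [h1, ← hcard, ← Multiset.card_map (fun z => ‖z‖₊)]
      apply Multiset.pow_card_le_prod
      intro x hx
      obtain ⟨z, hz, rfl⟩ := Multiset.mem_map.mp hx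
      exact hmin z (Multiset.mem_toFinset.mpr hz)
    exact_mod_cast h2

theorem BF.exists_seq_ne {s : ℕ} (G : MvPolynomial (Fin s) ℂ) (hG : G ≠ 0) (y : Fin s → ℂ) :
    ∃ u : ℕ → (Fin s → ℂ), (∀ i, MvPolynomial.eval (u i) G ≠ 0) ∧
      Filter.Tendsto u Filter.atTop (nhds y) := by
  have : y ∈ closure {z | MvPolynomial.eval z G ≠ 0} := by
    rw [mem_closure_iff_frequently]
    intro hev
    apply hG
    have han : AnalyticOnNhd ℂ (fun z : Fin s → ℂ => MvPolynomial.eval z G) Set.univ :=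
      AnalyticOnNhd.eval_mvPolynomial G
    have h0 : AnalyticOnNhd ℂ (fun z : Fin s → ℂ => (0 : ℂ)) Set.univ := analyticOnNhd_const
    have := han.eq_of_eventuallyEq h0 (z₀ := y) (by
      filter_upwards [hev] with z hz
      simpa using hz)
    apply MvPolynomial.funext
    intro z
    simpa using congrFun this z
  obtain ⟨u, hu, hu'⟩ := mem_closure_iff_seq_limit.mp this
  exact ⟨u, hu, hu'⟩

theorem BF.exists_separating {N : ℕ} (S : Set (Fin N → ℂ)) (hS : S.Finite) (x : Fin N → ℂ) :
    ∃ h : MvPolynomial (Fin N) ℂ, MvPolynomial.eval x h = 0 ∧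
      ∀ z ∈ S, MvPolynomial.eval z h = 0 → z = x := by
  classical
  have : ∀ z : Fin N → ℂ, ∃ p : MvPolynomial (Fin N) ℂ, MvPolynomial.eval x p = 1 ∧
      (z ≠ x → MvPolynomial.eval z p = 0) := by
    intro z
    by_cases hz : z = x
    · exact ⟨1, by simp, fun h => absurd hz h⟩
    · obtain ⟨k, hk⟩ := Function.ne_iff.mp hz
      refine ⟨MvPolynomial.C (x k - z k)⁻¹ * (MvPolynomial.X k - MvPolynomial.C (z k)), ?_, ?_⟩
      · have : x k - z k ≠ 0 := sub_ne_zero.mpr (Ne.symm hk)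
        simp [this]
      · simp
  choose p hp hp' using this
  refine ⟨1 - ∏ z ∈ hS.toFinset, p z, by simp [map_prod, hp], ?_⟩
  intro z hz h0
  by_contra hne
  have : ∏ w ∈ hS.toFinset, MvPolynomial.eval z (p w) = 0 :=
    Finset.prod_eq_zero (hS.mem_toFinset.mpr hz) (hp' z hne)
  simp [map_prod, this] at h0

theorem BF.root_bound {s : ℕ} (m : Polynomial (MvPolynomial (Fin s) ℂ)) (hm : m.Monic) :
    ∃ c : (Fin s → ℂ) → NNReal, Continuous c ∧
      ∀ y r, m.eval₂ (MvPolynomial.eval y) r = 0 → ‖r‖₊ ≤ c y := by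
  refine ⟨fun y => (Finset.range m.natDegree).sup
    (fun i => ‖MvPolynomial.eval y (m.coeff i)‖₊) + 1, ?_, ?_⟩
  · refine Continuous.add (Continuous.finset_sup_apply fun i _ => ?_) continuous_const
    exact (MvPolynomial.continuous_eval _).nnnorm
  · intro y r hr
    have hmm := hm.map (MvPolynomial.eval y)
    have h1 : (m.map (MvPolynomial.eval y)).IsRoot r := by
      rw [Polynomial.IsRoot.def, Polynomial.eval_map, hr]
    have := h1.norm_lt_cauchyBound hmm.ne_zero
    rw [Polynomial.cauchyBound, hmm.leadingCoeff, hm.natDegree_map] at this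
    simpa using this.le

theorem BF.dense_of_prime {N : ℕ} (P : Ideal (MvPolynomial (Fin N) ℂ)) [hP : P.IsPrime]
    (g : MvPolynomial (Fin N) ℂ) (hg : g ∉ P) (x : Fin N → ℂ)
    (hx : ∀ p ∈ P, MvPolynomial.eval x p = 0) :
    x ∈ closure {z : Fin N → ℂ | (∀ p ∈ P, MvPolynomial.eval z p = 0) ∧
      MvPolynomial.eval z g ≠ 0} := by
  obtain ⟨s, -, π, hinj, hInt⟩ := exists_integral_inj_algHom_of_quotient P hP.ne_top
  let : Algebra (MvPolynomial (Fin s) ℂ) (MvPolynomial (Fin N) ℂ ⧸ P) := π.toRingHom.toAlgebra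
  have hInt' : Algebra.IsIntegral (MvPolynomial (Fin s) ℂ) (MvPolynomial (Fin N) ℂ ⧸ P) := ⟨hInt⟩
  have hfaith : FaithfulSMul (MvPolynomial (Fin s) ℂ) (MvPolynomial (Fin N) ℂ ⧸ P) :=
    (faithfulSMul_iff_algebraMap_injective _ _).mpr hinj
  have halg : ∀ a, algebraMap (MvPolynomial (Fin s) ℂ) (MvPolynomial (Fin N) ℂ ⧸ P) a = π a :=
    fun _ => rfl
  -- coordinates of the projection
  have : ∀ j, ∃ p : MvPolynomial (Fin N) ℂ, Ideal.Quotient.mk P p = π (MvPolynomial.X j) :=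
    fun j => Ideal.Quotient.mk_surjective _
  choose t ht using this
  let pr : (Fin N → ℂ) → (Fin s → ℂ) := fun z j => MvPolynomial.eval z (t j)
  have hpr : Continuous pr := continuous_pi fun j => MvPolynomial.continuous_eval _
  -- evaluation at points of the variety
  have hev : ∀ z : Fin N → ℂ, (∀ p ∈ P, MvPolynomial.eval z p = 0) →
      ∃ e : (MvPolynomial (Fin N) ℂ ⧸ P) →+* ℂ,
        (∀ p, e (Ideal.Quotient.mk P p) = MvPolynomial.eval z p) ∧
        (∀ a, e (π a) = MvPolynomial.eval (pr z) a) := by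
    intro z hz
    let e := Ideal.Quotient.lift P (MvPolynomial.eval z) hz
    have he : ∀ p, e (Ideal.Quotient.mk P p) = MvPolynomial.eval z p :=
      fun p => Ideal.Quotient.lift_mk _ _ _
    refine ⟨e, he, ?_⟩
    have : e.comp π.toRingHom = MvPolynomial.eval (pr z) := by
      apply MvPolynomial.ringHom_ext
      · intro c
        have : π (MvPolynomial.C c) = Ideal.Quotient.mk P (MvPolynomial.C c) :=
          π.commutes c
        simp [this, he]
      · intro j
        simp [← ht, he, pr]
    intro a
    exact congrArg (fun f => f a) this
  have hev2 : ∀ z : Fin N → ℂ, (∀ p ∈ P, MvPolynomial.eval z p = 0) →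
      ∀ (p : MvPolynomial (Fin N) ℂ) (m : Polynomial (MvPolynomial (Fin s) ℂ)),
        Polynomial.aeval (Ideal.Quotient.mk P p) m = 0 →
        m.eval₂ (MvPolynomial.eval (pr z)) (MvPolynomial.eval z p) = 0 := by
    intro z hz p m hm
    obtain ⟨e, he1, he2⟩ := hev z hz
    have := congrArg e hm
    rw [Polynomial.aeval_def, Polynomial.hom_eval₂, he1, map_zero] at this
    have h3 : e.comp (algebraMap (MvPolynomial (Fin s) ℂ) (MvPolynomial (Fin N) ℂ ⧸ P)) =
        MvPolynomial.eval (pr z) := RingHom.ext he2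
    rwa [h3] at this
  have hpoint : ∀ (y : Fin s → ℂ) (e : (MvPolynomial (Fin N) ℂ ⧸ P) →+* ℂ),
      (∀ a, e (π a) = MvPolynomial.eval y a) →
      ∃ z : Fin N → ℂ, ∀ p, e (Ideal.Quotient.mk P p) = MvPolynomial.eval z p := by
    intro y e he
    refine ⟨fun k => e (Ideal.Quotient.mk P (MvPolynomial.X k)), fun p => ?_⟩
    have : e.comp (Ideal.Quotient.mk P) =
        MvPolynomial.eval (fun k => e (Ideal.Quotient.mk P (MvPolynomial.X k))) := by
      apply MvPolynomial.ringHom_ext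
      · intro c
        have h1 : π (MvPolynomial.C c) = Ideal.Quotient.mk P (MvPolynomial.C c) :=
          π.commutes c
        rw [RingHom.comp_apply, ← h1, he, MvPolynomial.eval_C, MvPolynomial.eval_C]
      · intro j
        simp
    exact congrArg (fun f => f p) this
  -- integral equations of the coordinates
  have hcoord : ∀ k : Fin N, ∃ m : Polynomial (MvPolynomial (Fin s) ℂ), m.Monic ∧
      Polynomial.aeval (Ideal.Quotient.mk P (MvPolynomial.X k)) m = 0 :=
    fun k => hInt'.isIntegral (Ideal.Quotient.mk P (MvPolynomial.X k))
  choose m hmm hm0 using hcoord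
  have hroot : ∀ z : Fin N → ℂ, (∀ p ∈ P, MvPolynomial.eval z p = 0) → ∀ k,
      (m k).eval₂ (MvPolynomial.eval (pr z)) (z k) = 0 := by
    intro z hz k
    simpa using hev2 z hz _ _ (hm0 k)
  have hfin : {z : Fin N → ℂ | (∀ p ∈ P, MvPolynomial.eval z p = 0) ∧ pr z = pr x}.Finite := by
    refine Set.Finite.subset (Set.Finite.pi' (ι := Fin N)
      (t := fun k => {r : ℂ | ((m k).map (MvPolynomial.eval (pr x))).IsRoot r})
      fun k => Polynomial.finite_setOfPred_isRoot ((hmm k).map _).ne_zero) ?_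
    rintro z ⟨hz, hzx⟩ k
    have := hroot z hz k
    rw [hzx] at this
    simpa [Polynomial.IsRoot.def, Polynomial.eval_map] using this
  choose c hc hc' using fun k => BF.root_bound (m k) (hmm k)
  obtain ⟨h, hhx, hhs⟩ := BF.exists_separating _ hfin x
  -- minimal polynomial
  set H := Ideal.Quotient.mk P h with hH
  have hHInt : IsIntegral (MvPolynomial (Fin s) ℂ) H := hInt'.isIntegral H
  set M := minpoly (MvPolynomial (Fin s) ℂ) H with hM
  have hMm : M.Monic := minpoly.monic hHInt
  have hMd : 0 < M.natDegree := minpoly.natDegree_pos hHInt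
  have ha0 : MvPolynomial.eval (pr x) (M.coeff 0) = 0 := by
    have := hev2 x hx h M (minpoly.aeval _ _)
    rw [hhx] at this
    simpa [Polynomial.eval₂_at_zero] using this
  have hgne : Ideal.Quotient.mk P g ≠ 0 := by
    rwa [Ne, Ideal.Quotient.eq_zero_iff_mem]
  obtain ⟨G, hG0, b, hGb⟩ := (hInt'.isIntegral (Ideal.Quotient.mk P g)).isAlgebraic.exists_nonzero_dvd
    (mem_nonZeroDivisors_of_ne_zero hgne)
  rw [halg] at hGb
  obtain ⟨u, huG, hu⟩ := BF.exists_seq_ne G hG0 (pr x)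
  have hlift : ∀ i, ∃ z : Fin N → ℂ, (∀ p ∈ P, MvPolynomial.eval z p = 0) ∧ pr z = u i ∧
      MvPolynomial.eval z g ≠ 0 ∧
      ‖MvPolynomial.eval z h‖ ^ M.natDegree ≤ ‖MvPolynomial.eval (u i) (M.coeff 0)‖ := by
    intro i
    obtain ⟨r, hr, hr'⟩ := BF.exists_small_root (M.map (MvPolynomial.eval (u i))) (hMm.map _)
      (by rwa [hMm.natDegree_map])
    rw [hMm.natDegree_map, Polynomial.coeff_map] at hr'
    rw [Polynomial.eval_map] at hr
    obtain ⟨ψ, hψ1, hψ2⟩ := BF.exists_lift (MvPolynomial.eval (u i)) H r hr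
    obtain ⟨z, hz⟩ := hpoint (u i) ψ hψ1
    refine ⟨z, ?_, ?_, ?_, ?_⟩
    · intro p hp
      rw [← hz, Ideal.Quotient.eq_zero_iff_mem.mpr hp, map_zero]
    · funext j
      have := hψ1 (MvPolynomial.X j)
      rw [halg, ← ht, hz] at this
      simpa [pr] using this
    · intro h0
      apply huG i
      rw [← hψ1 G, halg, hGb, map_mul, hz, h0, zero_mul]
    · rw [← hz, ← hH, hψ2]
      exact hr'
  choose z hzP hzu hzg hzh using hlift
  -- boundedness
  have hbd : ∃ R : ℝ, ∀ i, z i ∈ Metric.closedBall (0 : Fin N → ℂ) R := by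
    have h1 : ∀ k, ∃ R : ℝ, ∀ i, ‖z i k‖ ≤ R := by
      intro k
      have h2 : Filter.Tendsto (fun i => ((c k (u i) : NNReal) : ℝ)) Filter.atTop
          (nhds (c k (pr x))) :=
        ((NNReal.continuous_coe.comp (hc k)).tendsto (pr x)).comp hu
      obtain ⟨R, hR⟩ := h2.bddAbove_range
      refine ⟨R, fun i => le_trans ?_ (hR ⟨i, rfl⟩)⟩
      have := hc' k (u i) (z i k) (by rw [← hzu i]; exact hroot _ (hzP i) k)
      exact_mod_cast this
    choose R hR using h1
    refine ⟨∑ k, |R k|, fun i => ?_⟩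
    rw [mem_closedBall_zero_iff, pi_norm_le_iff_of_nonneg (by positivity)]
    intro k
    refine (hR k i).trans ((le_abs_self _).trans ?_)
    exact Finset.single_le_sum (f := fun k => |R k|) (fun _ _ => abs_nonneg _) (Finset.mem_univ k)
  obtain ⟨R, hR⟩ := hbd
  obtain ⟨w, -, φ, hφ, hw⟩ := (isCompact_closedBall (0 : Fin N → ℂ) R).tendsto_subseq hR
  have hwP : ∀ p ∈ P, MvPolynomial.eval w p = 0 := by
    intro p hp
    have h1 := ((MvPolynomial.continuous_eval p).tendsto w).comp hw
    refine tendsto_nhds_unique h1 ?_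
    refine tendsto_const_nhds.congr fun i => ?_
    simp [hzP _ p hp]
  have huφ := hu.comp hφ.tendsto_atTop
  have hwpr : pr w = pr x := by
    refine tendsto_nhds_unique ((hpr.tendsto w).comp hw) ?_
    refine huφ.congr fun i => ?_
    simp [hzu]
  have hwh : MvPolynomial.eval w h = 0 := by
    have h1 := (((MvPolynomial.continuous_eval h).tendsto w).comp hw).norm.pow M.natDegree
    have h2 := (((MvPolynomial.continuous_eval (M.coeff 0)).tendsto (pr x)).comp huφ).norm
    have h3 := le_of_tendsto_of_tendsto' h1 h2 (fun i => hzh (φ i))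
    rw [ha0, norm_zero] at h3
    have h4 : ‖MvPolynomial.eval w h‖ ^ M.natDegree = 0 := le_antisymm h3 (by positivity)
    exact norm_eq_zero.mp (pow_eq_zero_iff hMd.ne' |>.mp h4)
  have hwx : w = x := hhs w ⟨hwP, hwpr⟩ hwh
  subst hwx
  exact mem_closure_of_tendsto hw (Filter.Eventually.of_forall fun i => ⟨hzP _, hzg _⟩)

/-- The point of the prime spectrum attached to a point of affine space. -/
noncomputable def BF.pt {σ : Type} (z : σ → ℂ) : PrimeSpectrum (MvPolynomial σ ℂ) :=
  ⟨RingHom.ker (MvPolynomial.eval z), RingHom.ker_isPrime _⟩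

theorem BF.mem_pt {σ : Type} (z : σ → ℂ) (p : MvPolynomial σ ℂ) :
    p ∈ (BF.pt z).asIdeal ↔ MvPolynomial.eval z p = 0 := Iff.rfl

/-- A constructible set which is closed in the strong topology is algebraic. -/
theorem BF.algebraic_of_constructible {N : ℕ} (S : Set (Fin N → ℂ)) (hS : IsClosed S)
    (K : Set (PrimeSpectrum (MvPolynomial (Fin N) ℂ))) (hK : Topology.IsConstructible K)
    (hSK : ∀ z, z ∈ S ↔ BF.pt z ∈ K) :
    ∃ Q : Set (MvPolynomial (Fin N) ℂ), S = {z | ∀ p ∈ Q, MvPolynomial.eval z p = 0} := by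
  classical
  obtain ⟨D, rfl⟩ := PrimeSpectrum.exists_constructibleSetData_iff.mpr hK
  let T : Set (Ideal (MvPolynomial (Fin N) ℂ)) :=
    {P | (∃ C ∈ D, P ∈ (Ideal.span (Set.range C.g)).minimalPrimes) ∧
      ∀ z, (∀ p ∈ P, MvPolynomial.eval z p = 0) → z ∈ S}
  have hT : T.Finite := by
    have h1 : (⋃ C ∈ D, (Ideal.span (Set.range C.g)).minimalPrimes).Finite :=
      Set.Finite.biUnion D.finite_toSet
        fun C _ => Ideal.finite_minimalPrimes_of_isNoetherianRing _ _
    refine h1.subset ?_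
    rintro P ⟨⟨C, hC, hP⟩, -⟩
    simp only [Set.mem_iUnion]
    exact ⟨C, hC, hP⟩
  have hcov : ∀ z ∈ S, ∃ P ∈ T, ∀ p ∈ P, MvPolynomial.eval z p = 0 := by
    intro z hz
    have h1 := (hSK z).mp hz
    simp only [PrimeSpectrum.ConstructibleSetData.toSet, Set.mem_iUnion] at h1
    obtain ⟨C, hC, hzg, hzf⟩ := h1
    have hle : Ideal.span (Set.range C.g) ≤ (BF.pt z).asIdeal := Ideal.span_le.mpr hzg
    obtain ⟨P, hP, hPz⟩ := Ideal.exists_minimalPrimes_le hle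
    have hfz : C.f ∉ (BF.pt z).asIdeal := by
      intro h; apply hzf
      simpa [PrimeSpectrum.mem_zeroLocus] using h
    have hPp : P.IsPrime := hP.1.1
    refine ⟨P, ⟨⟨C, hC, hP⟩, fun w hw => ?_⟩, fun p hp => hPz hp⟩
    have h2 := BF.dense_of_prime P C.f (fun h => hfz (hPz h)) w hw
    refine closure_minimal ?_ hS h2
    rintro v ⟨hv1, hv2⟩
    rw [hSK]
    simp only [PrimeSpectrum.ConstructibleSetData.toSet, Set.mem_iUnion]
    refine ⟨C, hC, ?_, ?_⟩
    · intro p hp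
      exact hv1 p (hP.1.2 (Ideal.subset_span hp))
    · intro h
      exact hv2 (h (Set.mem_singleton _))
  refine ⟨{p | ∀ z ∈ S, MvPolynomial.eval z p = 0}, Set.Subset.antisymm ?_ ?_⟩
  · intro z hz p hp
    exact hp z hz
  · intro z hz
    by_contra hzS
    have h1 : ∀ P : Ideal (MvPolynomial (Fin N) ℂ), ∃ p : MvPolynomial (Fin N) ℂ, P ∈ T →
        p ∈ P ∧ MvPolynomial.eval z p ≠ 0 := by
      intro P
      by_cases hP : P ∈ T
      · have : ¬ ∀ p ∈ P, MvPolynomial.eval z p = 0 := fun h => hzS (hP.2 z h)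
        push Not at this
        obtain ⟨p, hp⟩ := this
        exact ⟨p, fun _ => hp⟩
      · exact ⟨0, fun h => absurd h hP⟩
    choose f hf using h1
    have h2 := hz (∏ P ∈ hT.toFinset, f P) (by
      intro w hw
      obtain ⟨P, hP, hPw⟩ := hcov w hw
      rw [map_prod]
      exact Finset.prod_eq_zero (hT.mem_toFinset.mpr hP) (hPw _ (hf P hP).1))
    rw [map_prod, Finset.prod_eq_zero_iff] at h2
    obtain ⟨P, hP, h0⟩ := h2
    exact (hf P (hT.mem_toFinset.mp hP)).2 h0

theorem BF.constructible_zeroLocus {σ : Type} [Finite σ] (E : Set (MvPolynomial σ ℂ)) :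
    Topology.IsConstructible (PrimeSpectrum.zeroLocus E) := by
  rw [← Topology.isConstructible_compl]
  exact (TopologicalSpace.NoetherianSpace.isCompact _).isConstructible
    (PrimeSpectrum.isClosed_zeroLocus E).isOpen_compl

theorem BF.encard_iff {α : Type} (s : Set α) (n : ℕ) :
    s.encard ≤ (n : ℕ∞) ↔ ¬ ∃ x : Fin (n + 1) → α, Function.Injective x ∧ ∀ i, x i ∈ s := by
  rw [← not_lt, not_iff_not]
  have h0 : (n : ℕ∞) < s.encard ↔ ((n + 1 : ℕ) : ℕ∞) ≤ s.encard := by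
    rw [Nat.cast_add, Nat.cast_one, ENat.add_one_le_iff (ENat.natCast_ne_top n)]
  rw [h0]
  constructor
  · intro h
    obtain ⟨t, hts, ht⟩ := Set.exists_subset_encard_eq h
    have htf : t.Finite := Set.finite_of_encard_eq_coe ht
    have hc : Nat.card t = n + 1 := by
      rw [Nat.card_coe_set_eq, Set.ncard, ht, ENat.toNat_natCast]
    have : Finite t := htf
    let e := Finite.equivFinOfCardEq hc
    exact ⟨fun i => (e.symm i : α), Subtype.val_injective.comp e.symm.injective,
      fun i => hts (e.symm i).2⟩
  · rintro ⟨x, hx, hxs⟩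
    have h1 : (Set.range x).encard = ((n + 1 : ℕ) : ℕ∞) := by
      rw [← Set.image_univ, hx.encard_image, Set.encard_univ]; simp
    rw [← h1]
    exact Set.encard_le_encard (Set.range_subset_iff.mpr hxs)

theorem BF.closed_part {α β : Type} [TopologicalSpace α] [T2Space α] [TopologicalSpace β]
    (X : Set α) (Y : Set β) (hY : IsClosed Y) (F : α → β) (hmaps : Set.MapsTo F X Y)
    (hopen : IsOpenMap (Set.MapsTo.restrict F X Y hmaps)) (n : ℕ) :
    IsClosed {y ∈ Y | {x ∈ X | F x = y}.encard ≤ (n : ℕ∞)} := by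
  have hO : IsOpen {y : Y | ∃ x : Fin (n + 1) → α, Function.Injective x ∧
      ∀ i, x i ∈ {x ∈ X | F x = y}} := by
    rw [isOpen_iff_mem_nhds]
    rintro y ⟨x, hx, hxs⟩
    obtain ⟨U, hU, hd⟩ := (Set.finite_range x).t2_separation
    have h1 : ∀ i, (Set.MapsTo.restrict F X Y hmaps) '' (Subtype.val ⁻¹' U (x i)) ∈ nhds y := by
      intro i
      refine (hopen _ ((hU (x i)).2.preimage continuous_subtype_val)).mem_nhds ?_
      exact ⟨⟨x i, (hxs i).1⟩, (hU (x i)).1, Subtype.ext (hxs i).2⟩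
    filter_upwards [Filter.iInter_mem.mpr h1] with w hw
    rw [Set.mem_iInter] at hw
    choose v hv hvw using hw
    refine ⟨fun i => v i, fun i j hij => ?_, fun i => ⟨(v i).2, congrArg Subtype.val (hvw i)⟩⟩
    by_contra hne
    have h2 := hd ⟨i, rfl⟩ ⟨j, rfl⟩ (fun h => hne (hx h))
    have h3 : (v i : α) ∈ U (x j) := by
      have := hv j
      simp only [Set.mem_preimage] at this
      simp only at hij
      rwa [hij]
    exact Set.disjoint_left.mp h2 (hv i) h3
  have h1 := hY.isClosedEmbedding_subtypeVal.isClosedMap _ hO.isClosed_compl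
  convert h1 using 1
  ext y
  constructor
  · rintro ⟨hy, hle⟩
    exact ⟨⟨y, hy⟩, (BF.encard_iff _ n).mp hle, rfl⟩
  · rintro ⟨y, hy, rfl⟩
    exact ⟨y.2, (BF.encard_iff _ n).mpr hy⟩

theorem BF.chevalley {N : ℕ} (n : ℕ) (PX : Set (MvPolynomial (Fin N) ℂ))
    (q : Fin N → MvPolynomial (Fin N) ℂ) :
    ∃ K : Set (PrimeSpectrum (MvPolynomial (Fin N) ℂ)), Topology.IsConstructible K ∧
      ∀ y : Fin N → ℂ, BF.pt y ∈ K ↔ ∃ x : Fin (n + 1) → (Fin N → ℂ), Function.Injective x ∧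
        ∀ i, (∀ p ∈ PX, MvPolynomial.eval (x i) p = 0) ∧
          ∀ k, MvPolynomial.eval (x i) (q k) = y k := by
  classical
  let ι : Fin (n + 1) → MvPolynomial (Fin N) ℂ →ₐ[ℂ] (MvPolynomial (Fin (n + 1) × Fin N) ℂ) := fun i =>
    MvPolynomial.rename (fun k => (i, k))
  have hι : ∀ i (w : Fin (n + 1) × Fin N → ℂ) p, MvPolynomial.eval w (ι i p) =
      MvPolynomial.eval (fun k => w (i, k)) p := by
    intro i w p
    simp only [ι, MvPolynomial.eval_rename, Function.comp_def]
  let φ : MvPolynomial (Fin N) ℂ →ₐ[ℂ] (MvPolynomial (Fin (n + 1) × Fin N) ℂ) := MvPolynomial.aeval (fun k => ι 0 (q k))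
  have hφX : ∀ k, φ (MvPolynomial.X k) = ι 0 (q k) := fun k => MvPolynomial.aeval_X _ _
  have hφ : ∀ (w : Fin (n + 1) × Fin N → ℂ) p, MvPolynomial.eval w (φ p) =
      MvPolynomial.eval (fun k => MvPolynomial.eval (fun k => w (0, k)) (q k)) p := by
    intro w p
    have : (MvPolynomial.eval w).comp φ.toRingHom =
        MvPolynomial.eval (fun k => MvPolynomial.eval (fun k => w (0, k)) (q k)) := by
      apply MvPolynomial.ringHom_ext
      · intro c; simp [φ]
      · intro k
        simp [φ, hι]
    exact congrArg (fun f => f p) this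
  have hfp : φ.toRingHom.FinitePresentation :=
    RingHom.FinitePresentation.of_finiteType.mp (by
      have : (φ.toRingHom.comp (algebraMap ℂ (MvPolynomial (Fin N) ℂ))).FiniteType := by
        have h1 : φ.toRingHom.comp (algebraMap ℂ (MvPolynomial (Fin N) ℂ)) = algebraMap ℂ (MvPolynomial (Fin (n + 1) × Fin N) ℂ) :=
          φ.comp_algebraMap
        rw [h1, RingHom.finiteType_algebraMap]
        infer_instance
      exact this.of_comp_finiteType)
  let E : Set (MvPolynomial (Fin (n + 1) × Fin N) ℂ) := {p | (∃ i, ∃ f ∈ PX, p = ι i f) ∨ ∃ i k, p = ι i (q k) - ι 0 (q k)}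
  let Dl : Fin (n + 1) → Fin (n + 1) → Set (MvPolynomial (Fin (n + 1) × Fin N) ℂ) := fun i j =>
    {p | ∃ k, p = MvPolynomial.X (i, k) - MvPolynomial.X (j, k)}
  let C : Set (PrimeSpectrum (MvPolynomial (Fin (n + 1) × Fin N) ℂ)) := PrimeSpectrum.zeroLocus E ∩
    ⋂ i, ⋂ j, {P | i ≠ j → P ∉ PrimeSpectrum.zeroLocus (Dl i j)}
  have hC : Topology.IsConstructible C := by
    refine (BF.constructible_zeroLocus E).inter (.iInter fun i => .iInter fun j => ?_)
    by_cases hij : i = j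
    · simp [hij]
    · have h1 : {P | i ≠ j → P ∉ PrimeSpectrum.zeroLocus (Dl i j)} =
        (PrimeSpectrum.zeroLocus (Dl i j))ᶜ := by
        ext P
        exact ⟨fun h => h hij, fun h _ => h⟩
      rw [h1]
      exact (BF.constructible_zeroLocus (Dl i j)).compl
  refine ⟨PrimeSpectrum.comap φ.toRingHom '' C,
    PrimeSpectrum.isConstructible_comap_image hfp hC, fun y => ⟨?_, ?_⟩⟩
  · rintro ⟨P, ⟨hPE, hPD⟩, hPy⟩
    have hd : ∀ i j, ∃ d : (MvPolynomial (Fin (n + 1) × Fin N) ℂ), i ≠ j → d ∈ Dl i j ∧ d ∉ P.asIdeal := by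
      intro i j
      by_cases hij : i = j
      · exact ⟨0, fun h => absurd hij h⟩
      · have := Set.mem_iInter.mp (Set.mem_iInter.mp hPD i) j hij
        rw [PrimeSpectrum.mem_zeroLocus, Set.not_subset] at this
        obtain ⟨d, hd⟩ := this
        exact ⟨d, fun _ => hd⟩
    choose d hd using hd
    let Δ : (MvPolynomial (Fin (n + 1) × Fin N) ℂ) := ∏ i, ∏ j, if i = j then 1 else d i j
    have hΔ : Δ ∉ P.asIdeal := by
      intro h
      obtain ⟨i, -, h⟩ := (P.2.prod_mem_iff).mp h
      obtain ⟨j, -, h⟩ := (P.2.prod_mem_iff).mp h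
      by_cases hij : i = j
      · rw [if_pos hij] at h
        exact P.2.ne_top ((Ideal.eq_top_iff_one _).mpr h)
      · rw [if_neg hij] at h
        exact (hd i j hij).2 h
    have hPp := P.2
    rw [← MvPolynomial.IsPrime.vanishingIdeal_zeroLocus (K := ℂ) P.asIdeal,
      MvPolynomial.mem_vanishingIdeal_iff] at hΔ
    push Not at hΔ
    obtain ⟨w, hw, hwΔ⟩ := hΔ
    have hw' : ∀ p ∈ P.asIdeal, MvPolynomial.eval w p = 0 := fun p hp => by
      have := hw p hp
      rwa [MvPolynomial.aeval_eq_eval] at this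
    have hy0 : ∀ k, MvPolynomial.eval (fun l => w (0, l)) (q k) = y k := by
      intro k
      have h1 : (MvPolynomial.X k - MvPolynomial.C (y k) : MvPolynomial (Fin N) ℂ) ∈
          (BF.pt y).asIdeal := by
        rw [BF.mem_pt]; simp
      rw [← hPy] at h1
      have h2 := hw' _ h1
      have h3 := hφ w (MvPolynomial.X k - MvPolynomial.C (y k))
      have h4 := h3.symm.trans h2
      simpa [sub_eq_zero] using h4
    refine ⟨fun i k => w (i, k), ?_, fun i => ⟨fun p hp => ?_, fun k => ?_⟩⟩
    · intro i j hij
      by_contra hne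
      obtain ⟨⟨k, hk⟩, -⟩ := hd i j hne
      apply hwΔ
      rw [MvPolynomial.aeval_eq_eval]
      simp only [Δ, map_prod]
      refine Finset.prod_eq_zero (Finset.mem_univ i) (Finset.prod_eq_zero (Finset.mem_univ j) ?_)
      rw [if_neg hne, hk]
      have := congrFun hij k
      simp only at this
      simp [this]
    · rw [← hι]
      exact hw' _ (hPE (Or.inl ⟨i, p, hp, rfl⟩))
    · have := hw' _ (hPE (Or.inr ⟨i, k, rfl⟩))
      rw [map_sub, hι, hι, hy0, sub_eq_zero] at this
      exact this
  · rintro ⟨x, hx, hxs⟩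
    let w : Fin (n + 1) × Fin N → ℂ := fun a => x a.1 a.2
    refine ⟨BF.pt w, ⟨?_, ?_⟩, ?_⟩
    · rintro p (⟨i, f, hf, rfl⟩ | ⟨i, k, rfl⟩)
      · rw [SetLike.mem_coe, BF.mem_pt, hι]
        exact (hxs i).1 f hf
      · rw [SetLike.mem_coe, BF.mem_pt, map_sub, hι, hι, sub_eq_zero]
        exact ((hxs i).2 k).trans ((hxs 0).2 k).symm
    · refine Set.mem_iInter.mpr fun i => Set.mem_iInter.mpr fun j => ?_
      intro hij hz
      apply hij
      apply hx
      funext k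
      have := hz ⟨k, rfl⟩
      rw [SetLike.mem_coe, BF.mem_pt] at this
      simpa [w, sub_eq_zero] using this
    · apply PrimeSpectrum.ext
      ext p
      have h1 : (fun k => MvPolynomial.eval (fun k => w (0, k)) (q k)) = y :=
        funext fun k => (hxs 0).2 k
      have h2 := hφ w p
      rw [h1] at h2
      rw [BF.mem_pt, ← h2]
      rfl


/-- For an open polynomial map `f : X → Y` of closed complex algebraic
subsets of `ℂ^N`, each set `A(f,n)` of points of `Y` with at most `n` inverse images is a
closed algebraic subset of `ℂ^N` (a common zero set of a family of polynomials, and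
closed). -/
theorem bounded_fiber_set_is_algebraic
    (N : ℕ) (PX PY : Set (MvPolynomial (Fin N) ℂ))
    (X Y : Set (Fin N → ℂ))
    (hX : X = {x | ∀ p ∈ PX, MvPolynomial.eval x p = 0})
    (hY : Y = {y | ∀ p ∈ PY, MvPolynomial.eval y p = 0})
    (F : (Fin N → ℂ) → (Fin N → ℂ))
    (hFpoly : ∃ q : Fin N → MvPolynomial (Fin N) ℂ,
      ∀ x i, F x i = MvPolynomial.eval x (q i))
    (hmaps : Set.MapsTo F X Y)
    (hopen : IsOpenMap (Set.MapsTo.restrict F X Y hmaps))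
    (n : ℕ) :
    ∃ Q : Set (MvPolynomial (Fin N) ℂ),
      {y ∈ Y | {x ∈ X | F x = y}.encard ≤ (n : ℕ∞)} =
        {z | ∀ p ∈ Q, MvPolynomial.eval z p = 0} ∧
      IsClosed {y ∈ Y | {x ∈ X | F x = y}.encard ≤ (n : ℕ∞)} := by
  obtain ⟨q, hq⟩ := hFpoly
  have hYc : IsClosed Y := by
    rw [hY, Set.ofPred_forall]
    refine isClosed_iInter fun p => ?_
    rw [Set.ofPred_forall]
    exact isClosed_iInter fun _ =>
      isClosed_eq (MvPolynomial.continuous_eval p) continuous_const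
  have hcl := BF.closed_part X Y hYc F hmaps hopen n
  obtain ⟨K, hK, hKy⟩ := BF.chevalley n PX q
  obtain ⟨Q, hQ⟩ := BF.algebraic_of_constructible _ hcl
    (PrimeSpectrum.zeroLocus PY ∩ Kᶜ) ((BF.constructible_zeroLocus PY).inter hK.compl) (by
      intro y
      have h1 : y ∈ Y ↔ BF.pt y ∈ PrimeSpectrum.zeroLocus PY := by
        rw [hY]; rfl
      rw [Set.mem_inter_iff, ← h1, Set.mem_compl_iff, hKy, Set.mem_ofPred_eq, BF.encard_iff]
      refine and_congr_right fun _ => not_congr (exists_congr fun x => and_congr_right fun _ =>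
        forall_congr' fun i => ?_)
      rw [Set.mem_ofPred_eq, hX, Set.mem_ofPred_eq, funext_iff]
      simp only [hq])
  exact ⟨Q, hQ, hcl⟩
end
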